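/- Let P and Q be irreducible elements of the polynomial ring Q̄[X,Y,Z] that are not associates of each other (neither is a unit multiple of the other). Then the holomorphic functions ψ_P and ψ_Q have no common zero in H: there is no a ∈ H with ψ_P(a) = 0 and ψ_Q(a) = 0. -/

import Mathlib

/-- The normalized Eisenstein series of even weight `k ≥ 4` (the definition also
makes sense for `k = 2`, giving the quasi-modular Eisenstein series `E₂`), defined by
its Fourier expansion `E_k(z) = 1 - (2k/B_k) ∑_{n≥1} σ_{k-1}(n) qⁿ`, `q = exp(2πiz)`. -/
noncomputable def Ek (k : ℕ) (z : ℂ) : ℂ :=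
  1 - (2 * (k : ℂ) / ((bernoulli k : ℚ) : ℂ)) *
    ∑' n : ℕ, (∑ d ∈ n.divisors, (d : ℂ) ^ (k - 1)) * Complex.exp (2 * Real.pi * Complex.I * z) ^ n

/-- `ψ_P = P(E₂, E₄, E₆)` as a function on the upper half-plane, for a polynomial `P`
in three variables. -/
noncomputable def psi (P : MvPolynomial (Fin 3) ℂ) (z : ℂ) : ℂ :=
  MvPolynomial.eval (![Ek 2 z, Ek 4 z, Ek 6 z]) P

section

open Polynomial
open scoped Matrix

theorem Polynomial.isCoprime_map_of_isRelPrime {R K : Type*} [CommRing R] [IsDomain R]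
    [NormalizedGCDMonoid R] [Field K] [Algebra R K] [IsFractionRing R K] {f g : R[X]}
    (hf : f ≠ 0) (h : IsRelPrime f g) :
    IsCoprime (f.map (algebraMap R K)) (g.map (algebraMap R K)) := by
  rw [← isRelPrime_iff_isCoprime]
  intro d hdf hdg
  have hd0 : d ≠ 0 := by
    rintro rfl
    rw [zero_dvd_iff, Polynomial.map_eq_zero_iff (IsFractionRing.injective R K)] at hdf
    exact hf hdf
  set p := (IsLocalization.integerNormalization (nonZeroDivisors R) d).primPart with hp
  obtain ⟨c, hc, hcd⟩ := IsLocalization.integerNormalization_spec (nonZeroDivisors R) d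
  have hdvd : p.map (algebraMap R K) ∣ d := by
    have h1 : p.map (algebraMap R K) ∣
        (IsLocalization.integerNormalization (nonZeroDivisors R) d).map (algebraMap R K) :=
      Polynomial.map_dvd _ (primPart_dvd _)
    rw [hcd, algebra_compatible_smul K, Polynomial.smul_eq_C_mul] at h1
    refine (IsUnit.dvd_mul_left ?_).1 h1
    refine isUnit_C.2 (IsUnit.mk0 _ ?_)
    exact IsLocalization.to_map_ne_zero_of_mem_nonZeroDivisors K le_rfl hc
  have hprim : p.IsPrimitive := isPrimitive_primPart _
  exact isUnit_or_eq_zero_of_isUnit_integerNormalization_primPart hd0 (h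
    ((hprim.dvd_iff_fraction_map_dvd_fraction_map (K := K)).2 (hdvd.trans hdf))
    ((hprim.dvd_iff_fraction_map_dvd_fraction_map (K := K)).2 (hdvd.trans hdg)))

theorem Int.resultant_ne_zero_of_isRelPrime {f g : ℤ[X]} (hf : f ≠ 0) (h : IsRelPrime f g) :
    resultant f g ≠ 0 := by
  have h1 := Polynomial.isCoprime_map_of_isRelPrime (K := ℚ) hf h
  have hinj : Function.Injective (algebraMap ℤ ℚ) := IsFractionRing.injective ℤ ℚ
  intro h0
  have h2 : resultant (f.map (algebraMap ℤ ℚ)) (g.map (algebraMap ℤ ℚ)) = 0 := by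
    rw [natDegree_map_eq_of_injective hinj, natDegree_map_eq_of_injective hinj,
      resultant_map_map, h0, map_zero]
  exact (resultant_eq_zero_iff.1 h2).2 h1

/-- A vanishing-order form of the determinant bound: if a row combination with a coefficient `1`
is small then so is the determinant. -/
theorem Matrix.norm_det_le_of_vecMul {n : Type*} [Fintype n] [DecidableEq n]
    (A : Matrix n n ℂ) (v : n → ℂ) (i : n) (hi : v i = 1) {ε x : ℝ} (hε : 0 < ε)
    (hA : ∀ i j, ‖A i j‖ ≤ x) (hv : ∀ j, ‖(v ᵥ* A) j‖ ≤ ε * x) :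
    ‖A.det‖ ≤ ε * ((Fintype.card n).factorial * x ^ Fintype.card n) := by
  have h1 : (A.updateRow i (v ᵥ* A)).det = A.det := by
    have := Matrix.det_updateRow_sum A i v
    rw [hi, one_smul] at this
    rw [← this]
    congr 2
    ext j
    simp [Matrix.vecMul, dotProduct]
  have h2 : v ᵥ* A = (ε : ℂ) • ((ε : ℂ)⁻¹ • (v ᵥ* A)) := by
    rw [smul_smul, mul_inv_cancel₀ (by exact_mod_cast hε.ne'), one_smul]
  rw [← h1, h2, Matrix.det_updateRow_smul, norm_mul, Complex.norm_real, Real.norm_eq_abs,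
    abs_of_pos hε]
  gcongr
  have h3 := Matrix.det_le (A := A.updateRow i ((ε : ℂ)⁻¹ • (v ᵥ* A)))
    (abv := (NormedField.toAbsoluteValue ℂ)) (x := x) ?_
  · simpa [NormedField.toAbsoluteValue] using h3
  intro k j
  change ‖(_ : ℂ)‖ ≤ x
  by_cases hk : k = i
  · subst hk
    rw [Matrix.updateRow_self, Pi.smul_apply, smul_eq_mul, norm_mul, norm_inv, Complex.norm_real,
      Real.norm_eq_abs, abs_of_pos hε, inv_mul_le_iff₀ hε]
    exact hv j
  · rw [Matrix.updateRow_ne hk]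
    exact hA k j

theorem Polynomial.vecMul_sylvester {R : Type*} [CommRing R] (f g : R[X]) {m n : ℕ}
    (hf : f.natDegree ≤ m) (hg : g.natDegree ≤ n) (θ : R) (j : Fin (m + n)) :
    ((fun i : Fin (m + n) => θ ^ (i : ℕ)) ᵥ* sylvester f g m n) j =
      j.addCases (fun j₁ => θ ^ (j₁ : ℕ) * g.eval θ) (fun j₁ => θ ^ (j₁ : ℕ) * f.eval θ) := by
  have key : ∀ (h : R[X]) (a k N : ℕ) (_ : h.natDegree ≤ k) (_ : a + k < N),
      (∑ i : Fin N, θ ^ (i : ℕ) * (if (i : ℕ) ∈ Set.Icc a (a + k) then h.coeff (i - a) else 0))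
        = θ ^ a * h.eval θ := by
    intro h a k N hk hN
    rw [Fin.sum_univ_eq_sum_range
      (fun i => θ ^ i * (if i ∈ Set.Icc a (a + k) then h.coeff (i - a) else 0)) N,
      eval_eq_sum_range' (Nat.lt_succ_of_le hk), Finset.mul_sum]
    symm
    refine Finset.sum_bij_ne_zero (fun i _ _ => a + i) ?_ ?_ ?_ ?_
    · intro i hi _
      simp only [Finset.mem_range] at hi ⊢
      omega
    · intro i _ _ i' _ _ h
      omega
    · intro b hb hb'
      have hmem : b ∈ Set.Icc a (a + k) := by
        by_contra hcon
        simp [hcon] at hb'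
      refine ⟨b - a, ?_, ?_, ?_⟩
      · simp only [Finset.mem_range]; have := hmem.2; omega
      · rw [if_pos hmem] at hb'
        intro h0
        apply hb'
        have : b = a + (b - a) := by have := hmem.1; omega
        rw [this, Nat.add_sub_cancel_left, pow_add, mul_assoc, mul_comm (θ ^ (b - a)), h0]
      · have := hmem.1; omega
    · intro i hi _
      simp only [Finset.mem_range] at hi
      have hmem : a + i ∈ Set.Icc a (a + k) := ⟨by omega, by omega⟩
      rw [if_pos hmem, Nat.add_sub_cancel_left, pow_add]
      ring
  induction j using Fin.addCases with
  | left j =>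
    simp only [Matrix.vecMul, dotProduct, sylvester, Matrix.of_apply, Fin.addCases_left]
    exact key g j n (m + n) hg (by omega)
  | right j =>
    simp only [Matrix.vecMul, dotProduct, sylvester, Matrix.of_apply, Fin.addCases_right]
    exact key f j m (m + n) hf (by omega)

/-- Two relatively prime integer polynomials cannot both be very small at the same point. -/
theorem Polynomial.one_le_mul_of_isRelPrime {f g : ℤ[X]} (hf0 : f ≠ 0) (h : IsRelPrime f g)
    {D : ℕ} {B T ε : ℝ} {θ : ℂ} (hf : f.natDegree ≤ D) (hg : g.natDegree ≤ D)
    (hB : 1 ≤ B) (hfB : ∀ i, |(f.coeff i : ℝ)| ≤ B) (hgB : ∀ i, |(g.coeff i : ℝ)| ≤ B)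
    (hT : 1 ≤ T) (hθ : ‖θ‖ ≤ T) (hε : 0 < ε) (hfθ : ‖aeval θ f‖ ≤ ε) (hgθ : ‖aeval θ g‖ ≤ ε) :
    1 ≤ ε * ((2 * D).factorial * (B * T ^ D) ^ (2 * D)) := by
  have hx : 1 ≤ B * T ^ D := one_le_mul_of_one_le_of_one_le hB (one_le_pow₀ hT)
  have hE : (1 : ℝ) ≤ ((2 * D).factorial * (B * T ^ D) ^ (2 * D)) :=
    one_le_mul_of_one_le_of_one_le (by exact_mod_cast Nat.factorial_pos _) (one_le_pow₀ hx)
  by_cases hmn : f.natDegree + g.natDegree = 0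
  · have hf1 : f = C (f.coeff 0) := eq_C_of_natDegree_eq_zero (by omega)
    have : 1 ≤ ε := by
      refine le_trans ?_ hfθ
      rw [hf1]
      rw [aeval_C, algebraMap_int_eq, eq_intCast, Complex.norm_intCast]
      have : f.coeff 0 ≠ 0 := by
        intro h0; rw [h0] at hf1; simp at hf1; exact hf0 hf1
      exact_mod_cast Int.one_le_abs this
    exact one_le_mul_of_one_le_of_one_le this hE
  set m := f.natDegree
  set n := g.natDegree
  set φ := Int.castRingHom ℂ
  have hinj : Function.Injective φ := φ.injective_int
  have hev : ∀ p : ℤ[X], (p.map φ).eval θ = aeval θ p := by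
    intro p
    rw [eval_map, aeval_def]; rfl
  have hres : 1 ≤ ‖resultant (f.map φ) (g.map φ) m n‖ := by
    rw [resultant_map_map]
    have := Int.resultant_ne_zero_of_isRelPrime hf0 h
    change 1 ≤ ‖((resultant f g m n : ℤ) : ℂ)‖
    rw [Complex.norm_intCast]
    exact_mod_cast Int.one_le_abs this
  have hcard : Fintype.card (Fin (m + n)) ≤ 2 * D := by simp; omega
  have hTD : 1 ≤ T ^ D := one_le_pow₀ hT
  have hpow : ∀ k ≤ D, ‖θ‖ ^ k ≤ B * T ^ D := fun k hk =>
    calc ‖θ‖ ^ k ≤ T ^ k := by gcongr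
      _ ≤ T ^ D := pow_le_pow_right₀ hT hk
      _ ≤ B * T ^ D := le_mul_of_one_le_left (by positivity) hB
  have := Matrix.norm_det_le_of_vecMul (sylvester (f.map φ) (g.map φ) m n)
    (fun i => θ ^ (i : ℕ)) ⟨0, by omega⟩ (by simp) (x := B * T ^ D) hε ?_ ?_
  · refine hres.trans (this.trans ?_)
    gcongr
  · intro i j
    have hBle : B ≤ B * T ^ D := le_mul_of_one_le_right (by linarith) hTD
    induction j using Fin.addCases with
    | left j =>
      simp only [sylvester, Matrix.of_apply, Fin.addCases_left]
      split_ifs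
      · rw [coeff_map]
        change ‖((g.coeff _ : ℤ) : ℂ)‖ ≤ _
        rw [Complex.norm_intCast]
        exact (hgB _).trans hBle
      · simp; positivity
    | right j =>
      simp only [sylvester, Matrix.of_apply, Fin.addCases_right]
      split_ifs
      · rw [coeff_map]
        change ‖((f.coeff _ : ℤ) : ℂ)‖ ≤ _
        rw [Complex.norm_intCast]
        exact (hfB _).trans hBle
      · simp; positivity
  · intro j
    rw [Polynomial.vecMul_sylvester _ _ natDegree_map_le natDegree_map_le]
    induction j using Fin.addCases with
    | left j =>
      rw [Fin.addCases_left, norm_mul, norm_pow, hev, mul_comm]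
      exact mul_le_mul hgθ (hpow _ (by omega)) (by positivity) hε.le
    | right j =>
      rw [Fin.addCases_right, norm_mul, norm_pow, hev, mul_comm]
      exact mul_le_mul hfθ (hpow _ (by omega)) (by positivity) hε.le

theorem Polynomial.abs_coeff_le_of_dvd {f g : ℤ[X]} (hf : f ≠ 0) (hg : g ∣ f) {D : ℕ} {B : ℝ}
    (hD : f.natDegree ≤ D) (hB : ∀ i, |(f.coeff i : ℝ)| ≤ B) (i : ℕ) :
    |(g.coeff i : ℝ)| ≤ 4 ^ D * B := by
  obtain ⟨h, rfl⟩ := hg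
  have hh : h ≠ 0 := right_ne_zero_of_mul hf
  have hg0 : g ≠ 0 := left_ne_zero_of_mul hf
  set φ := Int.castRingHom ℂ
  have hB0 : 0 ≤ B := (abs_nonneg _).trans (hB 0)
  have h1 := norm_coeff_le_choose_mul_mahlerMeasure_of_one_le_mahlerMeasure i (g.map φ) (h.map φ)
    (one_le_mahlerMeasure_of_ne_zero hh)
  have h2 := mahlerMeasure_le_sum_norm_coeff ((g * h).map φ)
  rw [← Polynomial.map_mul] at h1
  rw [coeff_map] at h1
  change ‖((g.coeff _ : ℤ) : ℂ)‖ ≤ _ at h1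
  rw [Complex.norm_intCast] at h1
  have h3 : (((g * h).map φ).sum fun _ a => ‖a‖) ≤ (D + 1) * B := by
    rw [Polynomial.sum_over_range' _ (by simp) (D + 1)
      (Nat.lt_succ_of_le (natDegree_map_le.trans hD))]
    calc ∑ a ∈ Finset.range (D + 1), ‖((g * h).map φ).coeff a‖
        ≤ ∑ a ∈ Finset.range (D + 1), B := by
          refine Finset.sum_le_sum fun a _ => ?_
          rw [coeff_map]
          change ‖(((g * h).coeff _ : ℤ) : ℂ)‖ ≤ _
          rw [Complex.norm_intCast]
          exact hB a
      _ = (D + 1) * B := by simp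
  have hgD : g.natDegree ≤ D := (natDegree_le_of_dvd ⟨h, rfl⟩ hf).trans hD
  have h4 : (((g.map φ).natDegree.choose i : ℕ) : ℝ) ≤ 2 ^ D := by
    have h5 : (g.map φ).natDegree.choose i ≤ 2 ^ D :=
      (Nat.choose_le_two_pow _ _).trans
        (Nat.pow_le_pow_right (by norm_num) (natDegree_map_le.trans hgD))
    exact_mod_cast h5
  have h6 : ((D : ℝ) + 1) ≤ 2 ^ D := by exact_mod_cast Nat.lt_two_pow_self (n := D)
  calc |(g.coeff i : ℝ)| ≤ _ := h1
    _ ≤ 2 ^ D * ((2 ^ D) * B) := by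
      refine mul_le_mul h4 ((h2.trans h3).trans (by gcongr)) (mahlerMeasure_nonneg _)
        (by positivity)
    _ = 4 ^ D * B := by
      rw [← mul_assoc, ← mul_pow]; norm_num

end

section

open Polynomial

/-- The polynomials of degree at most `D` and coefficients at most `exp D`. -/
def Polynomial.SizeLE (f : ℤ[X]) (D : ℕ) : Prop :=
  f ≠ 0 ∧ f.natDegree ≤ D ∧ ∀ i, |(f.coeff i : ℝ)| ≤ Real.exp D

theorem Polynomial.SizeLE.mono {f : ℤ[X]} {D D' : ℕ} (h : f.SizeLE D) (hD : D ≤ D') :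
    f.SizeLE D' :=
  ⟨h.1, h.2.1.trans hD, fun i => (h.2.2 i).trans (Real.exp_le_exp.2 (by exact_mod_cast hD))⟩

theorem Polynomial.exists_not_both_small (θ : ℂ) : ∃ C : ℝ, 0 < C ∧ ∀ (D : ℕ) (F G x y : ℤ[X]),
    F.SizeLE D → G.SizeLE D → x ∣ F → y ∣ G → IsRelPrime x y → ∀ ε : ℝ, 0 < ε →
    ‖aeval θ x‖ ≤ ε → ‖aeval θ y‖ ≤ ε → 1 ≤ ε * Real.exp (C * D ^ 2) := by
  set T := max 1 ‖θ‖ with hT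
  have hT1 : 1 ≤ T := le_max_left _ _
  have hTe : T = Real.exp (Real.log T) := (Real.exp_log (by linarith)).symm
  have hlog : 0 ≤ Real.log T := Real.log_nonneg hT1
  refine ⟨4 + 6 + 2 * Real.log T, by positivity, ?_⟩
  intro D F G x y hF hG hx hy hxy ε hε hxε hyε
  have h4 : (4 : ℝ) ^ D * Real.exp D ≤ Real.exp (3 * D) := by
    have h : (4 : ℝ) ≤ Real.exp 2 := by
      have := Real.add_one_le_exp (1 : ℝ)
      have h2 : Real.exp 2 = Real.exp 1 * Real.exp 1 := by rw [← Real.exp_add]; norm_num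
      rw [h2]; nlinarith
    calc (4 : ℝ) ^ D * Real.exp D ≤ Real.exp 2 ^ D * Real.exp D := by gcongr
      _ = Real.exp (3 * D) := by rw [← Real.exp_nat_mul, ← Real.exp_add]; ring_nf
  have hmain := Polynomial.one_le_mul_of_isRelPrime (f := x) (g := y) (D := D)
    (B := Real.exp (3 * D)) (T := T) (ε := ε) (θ := θ) (ne_zero_of_dvd_ne_zero hF.1 hx) hxy
    ((natDegree_le_of_dvd hx hF.1).trans hF.2.1) ((natDegree_le_of_dvd hy hG.1).trans hG.2.1)
    (Real.one_le_exp (by positivity))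
    (fun i => (Polynomial.abs_coeff_le_of_dvd hF.1 hx hF.2.1 hF.2.2 i).trans h4)
    (fun i => (Polynomial.abs_coeff_le_of_dvd hG.1 hy hG.2.1 hG.2.2 i).trans h4)
    hT1 (le_max_right _ _) hε hxε hyε
  refine hmain.trans ?_
  gcongr
  have hfac : ((2 * D).factorial : ℝ) ≤ Real.exp (4 * D ^ 2) := by
    calc ((2 * D).factorial : ℝ) ≤ ((2 * D : ℕ) : ℝ) ^ (2 * D) := by
          exact_mod_cast Nat.factorial_le_pow _
      _ ≤ Real.exp ((2 * D : ℕ) : ℝ) ^ (2 * D) := by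
          gcongr
          have := Real.add_one_le_exp ((2 * D : ℕ) : ℝ)
          linarith
      _ = Real.exp (4 * D ^ 2) := by rw [← Real.exp_nat_mul]; push_cast; ring_nf
  calc ((2 * D).factorial : ℝ) * (Real.exp (3 * D) * T ^ D) ^ (2 * D)
      ≤ Real.exp (4 * D ^ 2) * (Real.exp (3 * D) * Real.exp (Real.log T) ^ D) ^ (2 * D) := by
        rw [← hTe]; gcongr
    _ = Real.exp ((4 + 6 + 2 * Real.log T) * D ^ 2) := by
        rw [← Real.exp_nat_mul, ← Real.exp_add, ← Real.exp_nat_mul, ← Real.exp_add]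
        push_cast; ring_nf

/-- If relatively prime divisors of `F` are never simultaneously small at `θ`, then a small value
of `F` comes from a single prime power. -/
theorem Polynomial.exists_prime_pow_small {θ : ℂ} {F : ℤ[X]} (hF : aeval θ F ≠ 0) {E : ℝ}
    (hE : 1 ≤ E)
    (hE' : ∀ x y : ℤ[X], x ∣ F → y ∣ F → IsRelPrime x y → ∀ ε : ℝ, 0 < ε →
      ‖aeval θ x‖ ≤ ε → ‖aeval θ y‖ ≤ ε → 1 ≤ ε * E)
    (hsmall : ‖aeval θ F‖ * E ^ 3 < 1) :
    ∃ (p : ℤ[X]) (i : ℕ), Prime p ∧ p ^ i ∣ F ∧ ‖aeval θ p‖ ^ i ≤ E * ‖aeval θ F‖ := by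
  set ε := ‖aeval θ F‖ with hε
  have hε0 : 0 < ε := norm_pos_iff.2 hF
  have hE0 : 0 < E := by linarith
  have hE3 : E ≤ E ^ 3 := le_self_pow₀ hE (by norm_num)
  have key : ∀ f : ℤ[X], ∀ g : ℤ[X], F = f * g → IsRelPrime f g → ‖aeval θ f‖ ≤ E * ε →
      ∃ (p : ℤ[X]) (i : ℕ), Prime p ∧ p ^ i ∣ f ∧ ‖aeval θ p‖ ^ i ≤ E * ε := by
    intro f
    induction f using UniqueFactorizationMonoid.induction_on_coprime with
    | h0 =>
      intro g h
      simp [h] at hF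
    | h1 hu =>
      rename_i x
      intro g _ _ hx
      exfalso
      obtain ⟨r, hr, rfl⟩ := isUnit_iff.1 hu
      have : ‖aeval θ (C r)‖ = 1 := by
        rcases Int.isUnit_iff.1 hr with rfl | rfl <;> simp
      rw [this] at hx
      have : E * ε ≤ E ^ 3 * ε := by gcongr
      linarith
    | hpr i hp =>
      rename_i p
      intro g _ _ hx
      exact ⟨p, i, hp, dvd_rfl, by rwa [map_pow, norm_pow] at hx⟩
    | hcp hxy ihx ihy =>
      rename_i x y
      have claim : ∀ x y g : ℤ[X], F = x * y * g → IsRelPrime x y → IsRelPrime (x * y) g →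
          1 ≤ ‖aeval θ x‖ * E → ‖aeval θ (x * y)‖ ≤ E * ε → ‖aeval θ y‖ ≤ E * ε := by
        intro x y g hFe hxy hg hx hle
        have hx0 : 0 < ‖aeval θ x‖ := by
          by_contra hcon
          have : ‖aeval θ x‖ = 0 := le_antisymm (not_lt.1 hcon) (norm_nonneg _)
          rw [this] at hx; linarith
        rw [map_mul, norm_mul] at hle
        have h1 : ‖aeval θ y‖ ≤ E ^ 2 * ε := by
          calc ‖aeval θ y‖ ≤ (‖aeval θ x‖ * E) * ‖aeval θ y‖ :=
                le_mul_of_one_le_left (norm_nonneg _) hx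
            _ = E * (‖aeval θ x‖ * ‖aeval θ y‖) := by ring
            _ ≤ E * (E * ε) := by gcongr
            _ = E ^ 2 * ε := by ring
        have hrp : IsRelPrime (x * g) y :=
          IsRelPrime.mul_left hxy (IsRelPrime.symm (IsRelPrime.of_mul_left_right hg))
        have h2 : 1 ≤ ‖aeval θ (x * g)‖ * E := by
          by_contra hcon
          rw [not_le] at hcon
          have hm : max ‖aeval θ (x * g)‖ (E ^ 2 * ε) * E < 1 := by
            rw [max_mul_of_nonneg _ _ hE0.le, max_lt_iff]
            refine ⟨hcon, ?_⟩
            calc E ^ 2 * ε * E = ε * E ^ 3 := by ring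
              _ < 1 := hsmall
          have := hE' (x * g) y ⟨y, by rw [hFe]; ring⟩ ⟨x * g, by rw [hFe]; ring⟩ hrp
            (max ‖aeval θ (x * g)‖ (E ^ 2 * ε)) (lt_max_of_lt_right (by positivity))
            (le_max_left _ _) (h1.trans (le_max_right _ _))
          linarith
        calc ‖aeval θ y‖ ≤ (‖aeval θ (x * g)‖ * E) * ‖aeval θ y‖ :=
              le_mul_of_one_le_left (norm_nonneg _) h2
          _ = E * ε := by
            rw [hε, hFe]; simp only [map_mul, norm_mul]; ring
      intro g hFe hg hle
      by_cases hx : 1 ≤ ‖aeval θ x‖ * E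
      · have hy := claim x y g hFe hxy hg hx hle
        obtain ⟨p, i, hp, hpi, hs⟩ := ihy (x * g) (by rw [hFe]; ring)
          (IsRelPrime.mul_right hxy.symm (IsRelPrime.of_mul_left_right hg)) hy
        exact ⟨p, i, hp, hpi.trans (dvd_mul_left _ _), hs⟩
      · have hy : 1 ≤ ‖aeval θ y‖ * E := by
          by_contra hcon
          rw [not_le] at hx hcon
          have hF0 : aeval θ x ≠ 0 := by
            intro h0; apply hF; rw [hFe]; simp [h0]
          have := hE' x y ⟨y * g, by rw [hFe]; ring⟩ ⟨x * g, by rw [hFe]; ring⟩ hxy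
            (max ‖aeval θ x‖ ‖aeval θ y‖) (lt_max_of_lt_left (norm_pos_iff.2 hF0))
            (le_max_left _ _) (le_max_right _ _)
          rw [max_mul_of_nonneg _ _ hE0.le] at this
          have := max_lt hx hcon
          linarith
        have hx := claim y x g (by rw [hFe]; ring) hxy.symm (by rwa [mul_comm]) hy
          (by rwa [mul_comm])
        obtain ⟨p, i, hp, hpi, hs⟩ := ihx (y * g) (by rw [hFe]; ring)
          (IsRelPrime.mul_right hxy (IsRelPrime.of_mul_left_left hg)) hx
        exact ⟨p, i, hp, hpi.trans (dvd_mul_right _ _), hs⟩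
  refine key F 1 (by simp) isRelPrime_one_right (le_mul_of_one_le_left hε0.le hE)

/-- A Gelfond-type transcendence criterion. -/
theorem Polynomial.gelfond_criterion {θ : ℂ} (hθ : Transcendental ℤ θ) (R : ℕ → ℤ[X])
    (hR : ∀ᶠ k in Filter.atTop, (R k).SizeLE (k ^ 5) ∧
      ‖aeval θ (R k)‖ ≤ Real.exp (-(k : ℝ) ^ 11)) : False := by
  obtain ⟨C, hC, hCE⟩ := Polynomial.exists_not_both_small θ
  have hne : ∀ f : ℤ[X], f ≠ 0 → aeval θ f ≠ 0 := fun f hf h => hθ ⟨f, hf, h⟩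
  have hlarge : ∀ᶠ k : ℕ in Filter.atTop, (3 * C + 32 ^ 2 * C + 1 : ℝ) ≤ k :=
    tendsto_natCast_atTop_atTop.eventually_ge_atTop _
  obtain ⟨k₀, hk₀⟩ := (hR.and (hlarge.and (Filter.eventually_ge_atTop 1))).exists_forall_of_atTop
  have hp : ∀ k, ∃ (p : ℤ[X]) (i : ℕ), k₀ ≤ k → Prime p ∧ p ^ i ∣ R k ∧
      ‖aeval θ p‖ ^ i ≤ Real.exp (-(k : ℝ) ^ 11 + C * k ^ 10) := by
    intro k
    by_cases hk : k₀ ≤ k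
    swap
    · exact ⟨0, 0, fun h => absurd h hk⟩
    obtain ⟨⟨hs, hsm⟩, hkC, hk1⟩ := hk₀ k hk
    obtain ⟨p, i, hp, hpi, hle⟩ := Polynomial.exists_prime_pow_small (hne _ hs.1)
      (E := Real.exp (C * (k ^ 5 : ℕ) ^ 2)) (Real.one_le_exp (by positivity))
      (fun x y hx hy hxy => hCE (k ^ 5) (R k) (R k) x y hs hs hx hy hxy) (by
        calc ‖aeval θ (R k)‖ * Real.exp (C * (k ^ 5 : ℕ) ^ 2) ^ 3
            ≤ Real.exp (-(k : ℝ) ^ 11) * Real.exp (C * (k ^ 5 : ℕ) ^ 2) ^ 3 := by gcongr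
          _ = Real.exp (-(k : ℝ) ^ 11 + 3 * C * k ^ 10) := by
            rw [← Real.exp_nat_mul, ← Real.exp_add]; push_cast; ring_nf
          _ < 1 := by
            rw [Real.exp_lt_one_iff]
            have h1 : (1 : ℝ) ≤ k := by exact_mod_cast hk1
            have h10 : (1 : ℝ) ≤ (k : ℝ) ^ 10 := one_le_pow₀ h1
            have : 3 * C < k := by nlinarith
            nlinarith)
    refine ⟨p, i, fun _ => ⟨hp, hpi, hle.trans ?_⟩⟩
    calc Real.exp (C * (k ^ 5 : ℕ) ^ 2) * ‖aeval θ (R k)‖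
        ≤ Real.exp (C * (k ^ 5 : ℕ) ^ 2) * Real.exp (-(k : ℝ) ^ 11) := by gcongr
      _ = _ := by rw [← Real.exp_add]; push_cast; ring_nf
  choose p i hpi using hp
  have hsmall : ∀ k ≥ k₀, -(k : ℝ) ^ 11 + C * k ^ 10 < -(C * 32 ^ 2) * k ^ 10 := by
    intro k hk
    obtain ⟨_, hkC, hk1⟩ := hk₀ k hk
    have h1 : (1 : ℝ) ≤ k := by exact_mod_cast hk1
    have h10 : (1 : ℝ) ≤ (k : ℝ) ^ 10 := one_le_pow₀ h1
    have : (C + 32 ^ 2 * C) < k := by nlinarith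
    nlinarith
  have hassoc : ∀ k ≥ k₀, Associated (p k) (p (k + 1)) := by
    intro k hk
    obtain ⟨hp1, hd1, hl1⟩ := hpi k hk
    obtain ⟨hp2, hd2, hl2⟩ := hpi (k + 1) (by omega)
    by_contra hna
    have hrel : IsRelPrime (p k) (p (k + 1)) := by
      rw [hp1.irreducible.isRelPrime_iff_not_dvd]
      exact fun hdvd => hna (hp1.irreducible.associated_of_dvd hp2.irreducible hdvd)
    obtain ⟨⟨hs1, _⟩, hkC, hk1⟩ := hk₀ k hk
    obtain ⟨⟨hs2, _⟩, _, _⟩ := hk₀ (k + 1) (by omega)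
    have hs := hsmall k hk
    have hs' := hsmall (k + 1) (by omega)
    have hkk : (k : ℝ) ^ 10 ≤ ((k + 1 : ℕ) : ℝ) ^ 10 := by gcongr; omega
    have hcon := hCE ((k + 1) ^ 5) _ _ _ _ (hs1.mono (by gcongr; omega)) hs2 hd1 hd2
      (hrel.pow_left.pow_right)
      (Real.exp (-(C * 32 ^ 2) * k ^ 10)) (Real.exp_pos _)
      (by
        rw [map_pow, norm_pow]
        exact hl1.trans (Real.exp_le_exp.2 hs.le))
      (by
        rw [map_pow, norm_pow]
        refine hl2.trans (Real.exp_le_exp.2 (hs'.le.trans ?_))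
        have : 0 ≤ C * 32 ^ 2 := by positivity
        nlinarith)
    rw [← Real.exp_add, Real.one_le_exp_iff] at hcon
    have h1 : (1 : ℝ) ≤ k := by exact_mod_cast hk1
    have h2 : ((k + 1 : ℕ) : ℝ) ^ 10 < 32 ^ 2 * (k : ℝ) ^ 10 ∨ k = 1 := by
      rcases Nat.lt_or_ge 1 k with hk2 | hk2
      · left
        have : (2 : ℝ) ≤ k := by exact_mod_cast hk2
        have h3 : ((k + 1 : ℕ) : ℝ) ≤ (3 / 2) * k := by push_cast; linarith
        calc ((k + 1 : ℕ) : ℝ) ^ 10 ≤ ((3 / 2) * k) ^ 10 := by gcongr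
          _ = (3 / 2) ^ 10 * (k : ℝ) ^ 10 := by ring
          _ < 32 ^ 2 * (k : ℝ) ^ 10 := by
            have : (0 : ℝ) < (k : ℝ) ^ 10 := by positivity
            apply mul_lt_mul_of_pos_right _ this
            norm_num
      · right; omega
    rcases h2 with h2 | h2
    · push_cast at hcon h2
      nlinarith
    · subst h2
      have : (0 : ℝ) < C := hC
      push_cast at hkC
      nlinarith
  have hconst : ∀ k ≥ k₀, ‖aeval θ (p k)‖ = ‖aeval θ (p k₀)‖ := by
    intro k hk
    induction k, hk using Nat.le_induction with
    | base => rfl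
    | succ k hk ih =>
      rw [← ih]
      obtain ⟨u, hu⟩ := hassoc k hk
      obtain ⟨r, hr, hru⟩ := isUnit_iff.1 u.isUnit
      rw [← hu, ← hru]
      rcases Int.isUnit_iff.1 hr with rfl | rfl <;> simp
  set c := ‖aeval θ (p k₀)‖ with hc
  have hc0 : 0 < c := norm_pos_iff.2 (hne _ (hpi k₀ le_rfl).1.ne_zero)
  have hcle : ∀ k ≥ k₀, c ^ i k ≤ Real.exp (-(k : ℝ) ^ 11 + C * k ^ 10) := by
    intro k hk
    rw [← hconst k hk]
    exact (hpi k hk).2.2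
  have hneg : ∀ k ≥ k₀, Real.exp (-(k : ℝ) ^ 11 + C * k ^ 10) < 1 := by
    intro k hk
    rw [Real.exp_lt_one_iff]
    have h0 : 0 ≤ (C * 32 ^ 2) * (k : ℝ) ^ 10 := by positivity
    linarith [hsmall k hk]
  have hc1 : c < 1 := by
    by_contra hcon
    have := one_le_pow₀ (n := i k₀) (not_lt.1 hcon)
    linarith [hcle k₀ le_rfl, hneg k₀ le_rfl]
  have hik : ∀ k ≥ k₀, i k ≤ k ^ 5 := by
    intro k hk
    obtain ⟨hp1, hd1, hl1⟩ := hpi k hk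
    have hdeg : 1 ≤ (p k).natDegree := by
      by_contra hcon
      have h0 : p k = Polynomial.C ((p k).coeff 0) := eq_C_of_natDegree_eq_zero (by omega)
      have h1 : (p k).coeff 0 ≠ 0 := by
        intro h; rw [h] at h0; exact hp1.ne_zero (by simpa using h0)
      have h2 : 1 ≤ ‖aeval θ (p k)‖ := by
        rw [h0, aeval_C, algebraMap_int_eq, eq_intCast, Complex.norm_intCast]
        exact_mod_cast Int.one_le_abs h1
      rw [hconst k hk] at h2
      linarith
    obtain ⟨⟨hs1, _⟩, _⟩ := hk₀ k hk
    have := (natDegree_le_of_dvd hd1 hs1.1).trans hs1.2.1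
    rw [natDegree_pow] at this
    nlinarith
  set L := -Real.log c with hL
  have hL0 : 0 < L := by
    have := Real.log_neg hc0 hc1
    linarith
  obtain ⟨k, hk, hkL⟩ : ∃ k ≥ k₀, L + C < k := by
    obtain ⟨n, hn⟩ := exists_nat_gt (L + C)
    exact ⟨max k₀ n, le_max_left _ _, hn.trans_le (by exact_mod_cast le_max_right _ _)⟩
  have h1 : (1 : ℝ) ≤ k := by exact_mod_cast (hk₀ k hk).2.2
  have h2 : c ^ (k ^ 5) ≤ Real.exp (-(k : ℝ) ^ 11 + C * k ^ 10) :=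
    (pow_le_pow_of_le_one hc0.le hc1.le (hik k hk)).trans (hcle k hk)
  have h3 : c = Real.exp (-L) := by rw [hL, neg_neg, Real.exp_log hc0]
  rw [h3, ← Real.exp_nat_mul, Real.exp_le_exp] at h2
  push_cast at h2
  have h5 : (k : ℝ) ^ 5 ≤ (k : ℝ) ^ 10 := pow_le_pow_right₀ h1 (by norm_num)
  have h10 : (1 : ℝ) ≤ (k : ℝ) ^ 10 := one_le_pow₀ h1
  nlinarith

end

section

open Polynomial

/-- Two non-associated irreducible polynomials with a common zero force the last coordinates of
that zero to be algebraically dependent. -/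
theorem MvPolynomial.not_algebraicIndependent_of_common_zero {k : Type*} [Field k] [Algebra k ℂ]
    {n : ℕ} {P Q : MvPolynomial (Fin (n + 1)) k} (hP : Irreducible P) (hQ : Irreducible Q)
    (hPQ : ¬ Associated P Q) (x : Fin (n + 1) → ℂ) (hPx : MvPolynomial.aeval x P = 0)
    (hQx : MvPolynomial.aeval x Q = 0) :
    ¬ AlgebraicIndependent k (fun i : Fin n => x i.succ) := by
  intro hind
  let : NormalizedGCDMonoid (MvPolynomial (Fin n) k) := Classical.arbitrary _
  set e := MvPolynomial.finSuccEquiv k n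
  have hrel : IsRelPrime (e P) (e Q) := by
    have hP' : Irreducible (e P) := (MulEquiv.irreducible_iff e).2 hP
    have hQ' : Irreducible (e Q) := (MulEquiv.irreducible_iff e).2 hQ
    rw [hP'.isRelPrime_iff_not_dvd]
    intro h
    have h1 : P ∣ Q := (map_dvd_iff e).1 h
    exact hPQ (hP.associated_of_dvd hQ h1)
  have hP0 : e P ≠ 0 := by
    simpa using hP.ne_zero
  obtain ⟨u, v, huv⟩ := Polynomial.isCoprime_map_of_isRelPrime
    (K := FractionRing (MvPolynomial (Fin n) k)) hP0 hrel
  have hinj : Function.Injective (MvPolynomial.aeval (R := k) (fun i : Fin n => x i.succ)) :=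
    hind
  set φ : MvPolynomial (Fin n) k →+* ℂ :=
    (MvPolynomial.aeval (R := k) (fun i : Fin n => x i.succ) : _ →ₐ[k] ℂ).toRingHom with hφ
  have hφinj : Function.Injective φ := hinj
  set ψ : FractionRing (MvPolynomial (Fin n) k) →+* ℂ := IsFractionRing.lift hφinj
  have hev : ∀ A : MvPolynomial (Fin (n + 1)) k,
      ((e A).map (algebraMap _ (FractionRing (MvPolynomial (Fin n) k)))).eval₂ ψ (x 0) =
        MvPolynomial.aeval x A := by
    intro A
    rw [Polynomial.eval₂_map]
    have hcomp : ψ.comp (algebraMap _ (FractionRing (MvPolynomial (Fin n) k))) = φ := by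
      ext a <;> simp [ψ]
    rw [hcomp]
    have : ((eval₂RingHom φ (x 0)).comp e.toRingEquiv.toRingHom) =
        (MvPolynomial.aeval x : _ →ₐ[k] ℂ).toRingHom := by
      apply MvPolynomial.ringHom_ext
      · intro r
        simp [e, MvPolynomial.finSuccEquiv_apply, hφ]
      · intro i
        refine Fin.cases ?_ (fun j => ?_) i
        · simp [e, MvPolynomial.finSuccEquiv_X_zero]
        · simp [e, MvPolynomial.finSuccEquiv_X_succ, hφ]
    exact congrArg (fun f => f A) this
  have := congrArg (fun p => Polynomial.eval₂ ψ (x 0) p) huv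
  simp only [Polynomial.eval₂_add, Polynomial.eval₂_mul, hev, hPx, hQx, mul_zero, add_zero,
    Polynomial.eval₂_one] at this
  exact zero_ne_one this

/-- Algebraic dependence on a transcendental number, in terms of bivariate polynomials. -/
theorem exists_bivariate_of_not_algebraicIndependent {θ w : ℂ} (hθ : Transcendental ℤ θ)
    (h : ¬ AlgebraicIndependent ℤ ![w, θ]) :
    ∃ p : ℤ[X][X], p ≠ 0 ∧ p.eval₂ (aeval θ : ℤ[X] →ₐ[ℤ] ℂ).toRingHom w = 0 := by
  have hθ' : AlgebraicIndependent ℤ (fun _ : Unit => θ) :=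
    algebraicIndependent_unique_type_iff.2 hθ
  have h1 : ¬ Transcendental (Algebra.adjoin ℤ (Set.range fun _ : Unit => θ)) w := by
    rw [← hθ'.option_iff_transcendental]
    intro hcon
    apply h
    have := hcon.comp (![none, some ()]) (by decide)
    convert this using 1
    ext i
    fin_cases i <;> rfl
  rw [Transcendental, not_not] at h1
  obtain ⟨p, hp0, hp⟩ := h1
  have hrange : Algebra.adjoin ℤ (Set.range fun _ : Unit => θ) = (aeval (R := ℤ) θ).range := by
    rw [Set.range_const, Algebra.adjoin_singleton_eq_range_aeval]
  let f : Algebra.adjoin ℤ (Set.range fun _ : Unit => θ) ≃ₐ[ℤ] ℤ[X] :=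
    (Subalgebra.equivOfEq _ _ hrange).trans
      (AlgEquiv.ofInjective (aeval θ) (transcendental_iff_injective.1 hθ)).symm
  refine ⟨p.map f.toRingEquiv.toRingHom, ?_, ?_⟩
  · rwa [Ne, Polynomial.map_eq_zero_iff f.injective]
  · rw [eval₂_map]
    have : (aeval θ : ℤ[X] →ₐ[ℤ] ℂ).toRingHom.comp f.toRingEquiv.toRingHom =
        algebraMap (Algebra.adjoin ℤ (Set.range fun _ : Unit => θ)) ℂ := by
      ext a
      have h2 := congrArg Subtype.val
        ((AlgEquiv.ofInjective (aeval θ) (transcendental_iff_injective.1 hθ)).apply_symm_apply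
          (Subalgebra.equivOfEq _ _ hrange a))
      exact h2
    rw [this]
    exact hp

theorem exists_transcendental_of_common_zero (ι : AlgebraicClosure ℚ →+* ℂ)
    {P Q : MvPolynomial (Fin 3) (AlgebraicClosure ℚ)}
    (hP : Irreducible P) (hQ : Irreducible Q) (hPQ : ¬ Associated P Q) (ω : Fin 3 → ℂ)
    (hPω : MvPolynomial.eval ω (P.map ι) = 0) (hQω : MvPolynomial.eval ω (Q.map ι) = 0) :
    ∃ θ : ℂ, Transcendental ℤ θ ∧ ∀ i, ∃ p : ℤ[X][X], p ≠ 0 ∧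
      p.eval₂ (aeval θ : ℤ[X] →ₐ[ℤ] ℂ).toRingHom (ω i) = 0 := by
  by_cases hall : ∀ i, IsAlgebraic ℤ (ω i)
  · refine ⟨(liouvilleNumber (2 : ℕ) : ℂ), ?_, ?_⟩
    · have := transcendental_liouvilleNumber (m := 2) le_rfl
      exact (transcendental_algebraMap_iff (R := ℤ) (S := ℝ) (A := ℂ)
        Complex.ofReal_injective).2 this
    · intro i
      obtain ⟨p, hp0, hp⟩ := hall i
      refine ⟨p.map C, ?_, ?_⟩
      · rwa [Ne, Polynomial.map_eq_zero_iff C_injective]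
      · rw [eval₂_map]
        rw [aeval_def] at hp
        rwa [RingHom.ext_int ((aeval _ : ℤ[X] →ₐ[ℤ] ℂ).toRingHom.comp C) (algebraMap ℤ ℂ)]
  push Not at hall
  obtain ⟨i, hi⟩ := hall
  refine ⟨ω i, hi, fun j => ?_⟩
  by_cases hij : j = i
  · subst hij
    refine ⟨X - C X, X_sub_C_ne_zero _, ?_⟩
    simp
  refine exists_bivariate_of_not_algebraicIndependent hi fun hind => ?_
  let : Algebra (AlgebraicClosure ℚ) ℂ := ι.toAlgebra
  have : IsScalarTower ℤ (AlgebraicClosure ℚ) ℂ := IsScalarTower.of_algebraMap_eq' (RingHom.ext_int _ _)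
  have : Algebra.IsAlgebraic ℤ (AlgebraicClosure ℚ) := by
    have : Algebra.IsAlgebraic ℤ ℚ := IsLocalization.isAlgebraic ℚ (nonZeroDivisors ℤ)
    have : Algebra.IsAlgebraic ℚ (AlgebraicClosure ℚ) := AlgebraicClosure.isAlgebraic ℚ
    exact Algebra.IsAlgebraic.trans ℤ ℚ _
  have hind' := hind.extendScalars (AlgebraicClosure ℚ)
  obtain ⟨σ, hσ1, hσ2⟩ : ∃ σ : Equiv.Perm (Fin 3), σ 1 = j ∧ σ 2 = i := by
    clear * - hij; revert i j; decide
  have hmap : ∀ A : MvPolynomial (Fin 3) (AlgebraicClosure ℚ),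
      MvPolynomial.aeval (ω ∘ σ) (MvPolynomial.rename σ.symm A) =
        MvPolynomial.eval ω (A.map ι) := by
    intro A
    rw [MvPolynomial.aeval_rename, MvPolynomial.eval_map, MvPolynomial.aeval_def]
    congr 1
    ext i; simp
  set e := MvPolynomial.renameEquiv (AlgebraicClosure ℚ) σ.symm
  refine MvPolynomial.not_algebraicIndependent_of_common_zero (P := e P) (Q := e Q)
    ((MulEquiv.irreducible_iff e).2 hP) ((MulEquiv.irreducible_iff e).2 hQ) ?_ (ω ∘ σ)
    ((hmap P).trans hPω) ((hmap Q).trans hQω) ?_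
  · rintro h
    apply hPQ
    have := h.map e.symm.toRingEquiv.toRingHom
    simpa using this
  · have hk : (fun k : Fin 2 => (ω ∘ σ) k.succ) = ![ω j, ω i] := by
      ext k
      fin_cases k
      · simp [← hσ1]
      · simp [← hσ2]
    rw [hk]
    exact hind'

end

section

open Polynomial
open scoped Matrix

/-- The sum of the absolute values of the coefficients of an integer polynomial. -/
noncomputable def Polynomial.len (f : ℤ[X]) : ℝ := f.sum fun _ a => |(a : ℝ)|

namespace Polynomial

theorem len_eq_sum {f : ℤ[X]} {s : Finset ℕ} (hs : f.support ⊆ s) :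
    f.len = ∑ i ∈ s, |(f.coeff i : ℝ)| :=
  Finset.sum_subset hs fun i _ hi => by simp [notMem_support_iff.1 hi]

theorem len_nonneg (f : ℤ[X]) : 0 ≤ f.len := Finset.sum_nonneg fun _ _ => abs_nonneg _

@[simp] theorem len_zero : (0 : ℤ[X]).len = 0 := by simp [len]

@[simp] theorem len_one : (1 : ℤ[X]).len = 1 := by
  rw [len, ← C_1, sum_C_index] <;> simp

theorem abs_coeff_le_len (f : ℤ[X]) (i : ℕ) : |(f.coeff i : ℝ)| ≤ f.len := by
  rw [len_eq_sum (Finset.subset_insert i f.support)]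
  exact Finset.single_le_sum (f := fun i => |(f.coeff i : ℝ)|) (fun _ _ => abs_nonneg _)
    (Finset.mem_insert_self _ _)

theorem len_add_le (f g : ℤ[X]) : (f + g).len ≤ f.len + g.len := by
  have h1 : (f + g).support ⊆ f.support ∪ g.support := support_add
  rw [len_eq_sum h1, len_eq_sum (Finset.subset_union_left (s₁ := f.support) (s₂ := g.support)),
    len_eq_sum (Finset.subset_union_right (s₁ := f.support) (s₂ := g.support)),
    ← Finset.sum_add_distrib]
  refine Finset.sum_le_sum fun i _ => ?_
  rw [coeff_add]
  push_cast
  exact abs_add_le _ _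

theorem len_sum_le {ι : Type*} (s : Finset ι) (f : ι → ℤ[X]) :
    (∑ i ∈ s, f i).len ≤ ∑ i ∈ s, (f i).len :=
  Finset.le_sum_of_subadditive len len_zero.le len_add_le s f

theorem len_monomial_mul (n : ℕ) (a : ℤ) (g : ℤ[X]) :
    (monomial n a * g).len ≤ |(a : ℝ)| * g.len := by
  have hs : (monomial n a * g).support ⊆ g.support.map (addLeftEmbedding n) := by
    intro i hi
    rw [mem_support_iff] at hi
    rw [Finset.mem_map]
    by_cases hni : n ≤ i
    · refine ⟨i - n, ?_, by simp [hni]⟩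
      rw [mem_support_iff]
      intro h0
      apply hi
      obtain ⟨k, rfl⟩ := Nat.exists_eq_add_of_le hni
      rw [add_comm, coeff_monomial_mul]
      simp at h0
      simp [h0]
    · exfalso
      apply hi
      rw [← C_mul_X_pow_eq_monomial, mul_assoc, coeff_C_mul, coeff_X_pow_mul', if_neg hni,
        mul_zero]
  rw [len_eq_sum hs, Finset.sum_map, len, sum_def, Finset.mul_sum]
  refine Finset.sum_le_sum fun i _ => ?_
  simp only [addLeftEmbedding_apply]
  rw [add_comm, coeff_monomial_mul]
  push_cast
  rw [abs_mul]

theorem len_mul_le (f g : ℤ[X]) : (f * g).len ≤ f.len * g.len := by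
  conv_lhs => rw [f.as_sum_support, Finset.sum_mul]
  refine (len_sum_le _ _).trans ?_
  rw [len, sum_def, Finset.sum_mul]
  exact Finset.sum_le_sum fun i _ => len_monomial_mul _ _ _

theorem len_C_mul_le (a : ℤ) (g : ℤ[X]) : (C a * g).len ≤ |(a : ℝ)| * g.len :=
  len_monomial_mul 0 a g

theorem len_pow_le (f : ℤ[X]) (n : ℕ) : (f ^ n).len ≤ f.len ^ n := by
  induction n with
  | zero => simp
  | succ n ih =>
    rw [pow_succ, pow_succ]
    exact (len_mul_le _ _).trans (mul_le_mul_of_nonneg_right ih (len_nonneg _))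

theorem len_prod_le {ι : Type*} (s : Finset ι) (f : ι → ℤ[X]) :
    (∏ i ∈ s, f i).len ≤ ∏ i ∈ s, (f i).len := by
  classical
  induction s using Finset.induction_on with
  | empty => simp
  | insert a s ha ih =>
    rw [Finset.prod_insert ha, Finset.prod_insert ha]
    exact (len_mul_le _ _).trans (mul_le_mul_of_nonneg_left ih (len_nonneg _))

theorem norm_aeval_le_len {θ : ℂ} {T : ℝ} (hT : 1 ≤ T) (hθ : ‖θ‖ ≤ T) {f : ℤ[X]} {D : ℕ}
    (hD : f.natDegree ≤ D) : ‖aeval θ f‖ ≤ f.len * T ^ D := by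
  rw [aeval_eq_sum_range, len_eq_sum (supp_subset_range_natDegree_succ), Finset.sum_mul]
  refine norm_sum_le_of_le _ fun i hi => ?_
  rw [zsmul_eq_mul, norm_mul, Complex.norm_intCast, norm_pow]
  gcongr
  calc ‖θ‖ ^ i ≤ T ^ i := by gcongr
    _ ≤ T ^ D := pow_le_pow_right₀ hT (by simp at hi; omega)

end Polynomial

/-- The sum of the lengths of the entries of a matrix of integer polynomials. -/
noncomputable def Matrix.len {n : ℕ} (M : Matrix (Fin n) (Fin n) ℤ[X]) : ℝ :=
  ∑ i, ∑ j, (M i j).len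

namespace Matrix

variable {n : ℕ}

theorem len_nonneg (M : Matrix (Fin n) (Fin n) ℤ[X]) : 0 ≤ M.len :=
  Finset.sum_nonneg fun _ _ => Finset.sum_nonneg fun _ _ => Polynomial.len_nonneg _

theorem len_apply_le (M : Matrix (Fin n) (Fin n) ℤ[X]) (i j : Fin n) : (M i j).len ≤ M.len :=
  (Finset.single_le_sum (f := fun j => (M i j).len) (fun _ _ => Polynomial.len_nonneg _)
    (Finset.mem_univ j)).trans
  (Finset.single_le_sum (f := fun i => ∑ j, (M i j).len)
    (fun _ _ => Finset.sum_nonneg fun _ _ => Polynomial.len_nonneg _) (Finset.mem_univ i))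

theorem len_one : (1 : Matrix (Fin n) (Fin n) ℤ[X]).len = n := by
  simp [len, Matrix.one_apply, apply_ite Polynomial.len]

theorem len_mul_le (A B : Matrix (Fin n) (Fin n) ℤ[X]) : (A * B).len ≤ A.len * B.len := by
  calc (A * B).len ≤ ∑ i, ∑ j, ∑ k, (A i k).len * (B k j).len := by
        refine Finset.sum_le_sum fun i _ => Finset.sum_le_sum fun j _ => ?_
        rw [Matrix.mul_apply]
        exact (Polynomial.len_sum_le _ _).trans
          (Finset.sum_le_sum fun k _ => Polynomial.len_mul_le _ _)
    _ = ∑ i, ∑ k, (A i k).len * ∑ j, (B k j).len := by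
        refine Finset.sum_congr rfl fun i _ => ?_
        rw [Finset.sum_comm]
        simp_rw [Finset.mul_sum]
    _ ≤ ∑ i, ∑ k, (A i k).len * B.len := by
        refine Finset.sum_le_sum fun i _ => Finset.sum_le_sum fun k _ => ?_
        refine mul_le_mul_of_nonneg_left ?_ (Polynomial.len_nonneg _)
        exact Finset.single_le_sum (f := fun k => ∑ j, (B k j).len)
          (fun _ _ => Finset.sum_nonneg fun _ _ => Polynomial.len_nonneg _) (Finset.mem_univ k)
    _ = A.len * B.len := by
        simp_rw [← Finset.sum_mul]; rfl

theorem len_pow_le (A : Matrix (Fin n) (Fin n) ℤ[X]) (k : ℕ) : (A ^ k).len ≤ n * A.len ^ k := by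
  induction k with
  | zero => simp [len_one]
  | succ k ih =>
    rw [pow_succ, pow_succ, ← mul_assoc]
    exact (len_mul_le _ _).trans (mul_le_mul_of_nonneg_right ih (len_nonneg _))

theorem len_smul_le (f : ℤ[X]) (A : Matrix (Fin n) (Fin n) ℤ[X]) :
    (f • A).len ≤ f.len * A.len := by
  simp only [len, Finset.mul_sum, Matrix.smul_apply, smul_eq_mul]
  exact Finset.sum_le_sum fun i _ => Finset.sum_le_sum fun j _ => Polynomial.len_mul_le _ _

theorem len_sum_le {ι : Type*} (s : Finset ι) (A : ι → Matrix (Fin n) (Fin n) ℤ[X]) :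
    (∑ k ∈ s, A k).len ≤ ∑ k ∈ s, (A k).len := by
  refine Finset.le_sum_of_subadditive len (by simp [len]) (fun A B => ?_) s A
  simp only [len, ← Finset.sum_add_distrib, Matrix.add_apply]
  exact Finset.sum_le_sum fun i _ => Finset.sum_le_sum fun j _ => Polynomial.len_add_le _ _

theorem len_det_le (A : Matrix (Fin n) (Fin n) ℤ[X]) {x : ℝ} (hx : ∀ i j, (A i j).len ≤ x) :
    A.det.len ≤ n.factorial * x ^ n := by
  rw [Matrix.det_apply]
  refine (Polynomial.len_sum_le _ _).trans ?_
  calc ∑ σ : Equiv.Perm (Fin n), (Equiv.Perm.sign σ • ∏ i, A (σ i) i).len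
      ≤ ∑ σ : Equiv.Perm (Fin n), x ^ n := by
        refine Finset.sum_le_sum fun σ _ => ?_
        have h1 : (Equiv.Perm.sign σ • ∏ i, A (σ i) i).len ≤ (∏ i, A (σ i) i).len := by
          rcases Int.units_eq_one_or (Equiv.Perm.sign σ) with h | h <;> rw [h]
          · simp
          · have := Polynomial.len_C_mul_le (-1) (∏ i, A (σ i) i)
            simpa using this
        refine h1.trans ((Polynomial.len_prod_le _ _).trans ?_)
        calc ∏ i, (A (σ i) i).len ≤ ∏ _i : Fin n, x :=
              Finset.prod_le_prod (fun _ _ => Polynomial.len_nonneg _) fun i _ => hx _ _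
          _ = x ^ n := by simp
    _ = n.factorial * x ^ n := by
        simp [Fintype.card_perm]

/-- Matrices of polynomials whose entries have degree at most `d`. -/
def NatDegreeLE (M : Matrix (Fin n) (Fin n) ℤ[X]) (d : ℕ) : Prop := ∀ i j, (M i j).natDegree ≤ d

theorem NatDegreeLE.mul {A B : Matrix (Fin n) (Fin n) ℤ[X]} {a b : ℕ} (hA : A.NatDegreeLE a)
    (hB : B.NatDegreeLE b) : (A * B).NatDegreeLE (a + b) := fun i j => by
  rw [Matrix.mul_apply]
  exact natDegree_sum_le_of_forall_le _ _ fun k _ => natDegree_mul_le_of_le (hA _ _) (hB _ _)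

theorem NatDegreeLE.pow {A : Matrix (Fin n) (Fin n) ℤ[X]} {a : ℕ} (hA : A.NatDegreeLE a) (k : ℕ) :
    (A ^ k).NatDegreeLE (a * k) := by
  induction k with
  | zero => intro i j; rw [pow_zero, Matrix.one_apply]; split_ifs <;> simp
  | succ k ih => rw [pow_succ, mul_add, mul_one]; exact ih.mul hA

theorem NatDegreeLE.smul {A : Matrix (Fin n) (Fin n) ℤ[X]} {a b : ℕ} {f : ℤ[X]}
    (hf : f.natDegree ≤ a) (hA : A.NatDegreeLE b) : (f • A).NatDegreeLE (a + b) := fun i j =>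
  natDegree_mul_le_of_le hf (hA i j)

theorem NatDegreeLE.sum {ι : Type*} {s : Finset ι} {A : ι → Matrix (Fin n) (Fin n) ℤ[X]} {a : ℕ}
    (hA : ∀ k ∈ s, (A k).NatDegreeLE a) : (∑ k ∈ s, A k).NatDegreeLE a := fun i j => by
  rw [Matrix.sum_apply]
  exact natDegree_sum_le_of_forall_le _ _ fun k hk => hA k hk i j

theorem NatDegreeLE.natDegree_det {A : Matrix (Fin n) (Fin n) ℤ[X]} {a : ℕ}
    (hA : A.NatDegreeLE a) : A.det.natDegree ≤ n * a := by
  rw [Matrix.det_apply]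
  refine natDegree_sum_le_of_forall_le _ _ fun σ _ => ?_
  have h1 : (Equiv.Perm.sign σ • ∏ i, A (σ i) i).natDegree ≤ (∏ i, A (σ i) i).natDegree := by
    rcases Int.units_eq_one_or (Equiv.Perm.sign σ) with h | h <;> rw [h] <;> simp
  refine h1.trans ((natDegree_prod_le _ _).trans ?_)
  calc ∑ i, (A (σ i) i).natDegree ≤ ∑ _i : Fin n, a := Finset.sum_le_sum fun i _ => hA _ _
    _ = n * a := by simp

end Matrix

end

section

open Polynomial
open scoped Matrix

/-- The sum of the absolute values of the coefficients. -/
noncomputable def MvPolynomial.len {σ : Type*} (P : MvPolynomial σ ℤ) : ℝ :=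
  ∑ m ∈ P.support, |((P.coeff m : ℤ) : ℝ)|

theorem MvPolynomial.len_nonneg {σ : Type*} (P : MvPolynomial σ ℤ) : 0 ≤ P.len :=
  Finset.sum_nonneg fun _ _ => abs_nonneg _

theorem Finsupp.sum_le_of_mem_support_fin_three {P : MvPolynomial (Fin 3) ℤ} {m : Fin 3 →₀ ℕ}
    (hm : m ∈ P.support) {d : ℕ} (hd : P.totalDegree ≤ d) : m 0 + m 1 + m 2 ≤ d := by
  have := (MvPolynomial.le_totalDegree hm).trans hd
  rwa [Finsupp.sum_fintype _ _ (fun _ => rfl), Fin.sum_univ_three] at this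

theorem MvPolynomial.aeval_fin_three {A : Type*} [CommRing A] [Algebra ℤ A] (w : Fin 3 → A)
    (P : MvPolynomial (Fin 3) ℤ) : MvPolynomial.aeval w P =
      ∑ m ∈ P.support, ((P.coeff m : ℤ) : A) * (w 0 ^ m 0 * w 1 ^ m 1 * w 2 ^ m 2) := by
  rw [MvPolynomial.aeval_def, MvPolynomial.eval₂_eq']
  simp [Fin.prod_univ_three]

/-- The homogenisation in degree `d` of `P`, evaluated at a scalar and three matrices. -/
noncomputable def Matrix.homEval {S : Type*} [CommRing S] {n : ℕ} (δ : S)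
    (M : Fin 3 → Matrix (Fin n) (Fin n) S) (d : ℕ) (P : MvPolynomial (Fin 3) ℤ) :
    Matrix (Fin n) (Fin n) S :=
  ∑ m ∈ P.support, ((P.coeff m : ℤ) : S) • δ ^ (d - (m 0 + m 1 + m 2)) •
    (M 0 ^ m 0 * M 1 ^ m 1 * M 2 ^ m 2)

theorem Matrix.homEval_map {S S' : Type*} [CommRing S] [CommRing S'] {n : ℕ} (φ : S →+* S')
    (δ : S) (M : Fin 3 → Matrix (Fin n) (Fin n) S) (d : ℕ) (P : MvPolynomial (Fin 3) ℤ) :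
    (Matrix.homEval δ M d P).map φ = Matrix.homEval (φ δ) (fun i => (M i).map φ) d P := by
  change φ.mapMatrix _ = _
  simp only [Matrix.homEval, map_sum]
  refine Finset.sum_congr rfl fun m _ => ?_
  have hs : ∀ (s : S) (A : Matrix (Fin n) (Fin n) S),
      φ.mapMatrix (s • A) = φ s • φ.mapMatrix A := by
    intro s A; ext i j; simp
  rw [hs, hs, map_mul, map_mul, map_pow, map_pow, map_pow, map_pow, map_intCast]
  rfl

theorem Matrix.homEval_smul_algHom {S K : Type*} [CommRing S] [CommRing K] [Algebra S K] {n : ℕ}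
    (φ : K →ₐ[S] Matrix (Fin n) (Fin n) S) (δ : S) (w : Fin 3 → K) {d : ℕ}
    {P : MvPolynomial (Fin 3) ℤ} (hd : P.totalDegree ≤ d) :
    Matrix.homEval δ (fun i => δ • φ (w i)) d P = δ ^ d • φ (MvPolynomial.aeval w P) := by
  rw [MvPolynomial.aeval_fin_three, map_sum, Finset.smul_sum, Matrix.homEval]
  refine Finset.sum_congr rfl fun m hm => ?_
  have hle := Finsupp.sum_le_of_mem_support_fin_three hm hd
  rw [map_mul, map_mul, map_mul, map_pow, map_pow, map_pow, map_intCast]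
  simp only [_root_.smul_pow, Matrix.smul_mul, Matrix.mul_smul, smul_smul]
  have : ((MvPolynomial.coeff m P : ℤ) : Matrix (Fin n) (Fin n) S) =
      ((MvPolynomial.coeff m P : ℤ) : S) • (1 : Matrix (Fin n) (Fin n) S) := by
    rw [Matrix.smul_one_eq_diagonal]; rfl
  rw [this, Matrix.smul_mul, one_mul, smul_smul]
  congr 1
  have h2 : d = (d - (m 0 + m 1 + m 2)) + m 0 + m 1 + m 2 := by omega
  conv_rhs => rw [h2]
  rw [pow_add, pow_add, pow_add]
  ring

theorem Matrix.natDegreeLE_homEval {n : ℕ} {δ : ℤ[X]} {M : Fin 3 → Matrix (Fin n) (Fin n) ℤ[X]}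
    {a d : ℕ} {P : MvPolynomial (Fin 3) ℤ} (hd : P.totalDegree ≤ d) (hδ : δ.natDegree ≤ a)
    (hM : ∀ i, (M i).NatDegreeLE a) : (Matrix.homEval δ M d P).NatDegreeLE (a * d) := by
  refine Matrix.NatDegreeLE.sum fun m hm => ?_
  have hle := Finsupp.sum_le_of_mem_support_fin_three hm hd
  have h1 : (δ ^ (d - (m 0 + m 1 + m 2))).natDegree ≤ (d - (m 0 + m 1 + m 2)) * a :=
    natDegree_pow_le_of_le _ hδ
  have h2 := Matrix.NatDegreeLE.smul h1
    ((((hM 0).pow (m 0)).mul ((hM 1).pow (m 1))).mul ((hM 2).pow (m 2)))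
  have h3 := Matrix.NatDegreeLE.smul (f := ((P.coeff m : ℤ) : ℤ[X])) (a := 0) (by simp) h2
  convert h3 using 1
  obtain ⟨e, he⟩ := Nat.exists_eq_add_of_le hle
  rw [he, Nat.add_sub_cancel_left]
  ring

theorem Matrix.len_homEval_le {n : ℕ} {δ : ℤ[X]} {M : Fin 3 → Matrix (Fin n) (Fin n) ℤ[X]}
    {d : ℕ} {B : ℝ} {P : MvPolynomial (Fin 3) ℤ} (hd : P.totalDegree ≤ d)
    (hδ : δ.len ≤ B) (hM : ∀ i, (M i).len ≤ B) :
    (Matrix.homEval δ M d P).len ≤ P.len * (n ^ 3 * B ^ d) := by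
  refine (Matrix.len_sum_le _ _).trans ?_
  rw [MvPolynomial.len, Finset.sum_mul]
  refine Finset.sum_le_sum fun m hm => ?_
  have hle := Finsupp.sum_le_of_mem_support_fin_three hm hd
  have hB : 0 ≤ B := (Polynomial.len_nonneg _).trans hδ
  have hc : ((P.coeff m : ℤ) : ℤ[X]).len ≤ |((P.coeff m : ℤ) : ℝ)| := by
    have := Polynomial.len_C_mul_le (P.coeff m) 1
    simpa using this
  have hp : ∀ i, (M i ^ m i).len ≤ n * B ^ m i := fun i =>
    (Matrix.len_pow_le _ _).trans (by gcongr; exacts [Matrix.len_nonneg _, hM i])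
  refine (Matrix.len_smul_le _ _).trans (mul_le_mul hc ?_ (Matrix.len_nonneg _) (abs_nonneg _))
  calc (δ ^ (d - (m 0 + m 1 + m 2)) • (M 0 ^ m 0 * M 1 ^ m 1 * M 2 ^ m 2)).len
      ≤ B ^ (d - (m 0 + m 1 + m 2)) * ((n * B ^ m 0) * (n * B ^ m 1) * (n * B ^ m 2)) := by
        refine (Matrix.len_smul_le _ _).trans (mul_le_mul ?_ ?_ (Matrix.len_nonneg _)
          (by positivity))
        · exact (Polynomial.len_pow_le _ _).trans (pow_le_pow_left₀ (Polynomial.len_nonneg _) hδ _)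
        · refine (Matrix.len_mul_le _ _).trans (mul_le_mul ((Matrix.len_mul_le _ _).trans
            (mul_le_mul (hp 0) (hp 1) (Matrix.len_nonneg _) (by positivity))) (hp 2)
            (Matrix.len_nonneg _) (by positivity))
    _ = n ^ 3 * B ^ d := by
        have h2 : d = (d - (m 0 + m 1 + m 2)) + m 0 + m 1 + m 2 := by omega
        conv_rhs => rw [h2]
        ring

theorem Polynomial.exists_len_bound {ι : Type*} [Finite ι] (f : ι → ℝ) : ∃ B : ℝ, 1 ≤ B ∧
    ∀ i, f i ≤ B := by
  obtain ⟨B, hB⟩ := (Set.finite_range f).bddAbove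
  exact ⟨max 1 B, le_max_left _ _, fun i => (hB ⟨i, rfl⟩).trans (le_max_right _ _)⟩

/-- From a polynomial in numbers algebraic over `ℚ(θ)` one obtains, by taking a norm, a polynomial
in `θ` whose size and value at `θ` are under control. -/
theorem exists_polynomial_of_algebraic {θ : ℂ} (hθ : Transcendental ℤ θ) {ω : Fin 3 → ℂ}
    (hω : ∀ i, ∃ p : ℤ[X][X], p ≠ 0 ∧
      p.eval₂ (aeval θ : ℤ[X] →ₐ[ℤ] ℂ).toRingHom (ω i) = 0) :
    ∃ C : ℝ, 0 < C ∧ ∀ (d : ℕ) (H : ℝ) (P : MvPolynomial (Fin 3) ℤ), 0 ≤ H →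
      P.totalDegree ≤ d → P.len ≤ Real.exp H → MvPolynomial.aeval ω P ≠ 0 →
      ∃ R : ℤ[X], R ≠ 0 ∧ (R.natDegree : ℝ) ≤ C * d ∧
        (∀ i, |(R.coeff i : ℝ)| ≤ Real.exp (C * (d + H + 1))) ∧
        ‖aeval θ R‖ ≤ ‖MvPolynomial.aeval ω P‖ * Real.exp (C * (d + H + 1)) := by
  set φ : ℤ[X] →+* ℂ := (aeval θ : ℤ[X] →ₐ[ℤ] ℂ).toRingHom with hφ
  have hinj : Function.Injective φ := transcendental_iff_injective.1 hθ
  let F := FractionRing ℤ[X]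
  let : Algebra F ℂ := (IsFractionRing.lift hinj).toAlgebra
  have hFφ : ∀ f : ℤ[X], algebraMap F ℂ (algebraMap ℤ[X] F f) = φ f := fun f =>
    IsFractionRing.lift_algebraMap hinj f
  have halg : ∀ i, IsIntegral F (ω i) := by
    intro i
    obtain ⟨p, hp0, hp⟩ := hω i
    refine IsAlgebraic.isIntegral ⟨p.map (algebraMap ℤ[X] F), ?_, ?_⟩
    · rwa [Ne, Polynomial.map_eq_zero_iff (IsFractionRing.injective ℤ[X] F)]
    · rw [aeval_def, eval₂_map]
      have : (algebraMap F ℂ).comp (algebraMap ℤ[X] F) = φ := RingHom.ext hFφ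
      rw [this, hp]
  let K := IntermediateField.adjoin F (Set.range ω)
  have : FiniteDimensional F K := by
    have := Set.finite_range ω
    refine IntermediateField.finiteDimensional_adjoin fun x hx => ?_
    obtain ⟨i, rfl⟩ := hx
    exact halg i
  set N := Module.finrank F K
  let b : Module.Basis (Fin N) F K := Module.finBasis F K
  let w : Fin 3 → K := fun i => ⟨ω i, IntermediateField.subset_adjoin F _ ⟨i, rfl⟩⟩
  let L := Algebra.leftMulMatrix b
  have hN : 0 < N := Module.finrank_pos
  let i₀ : Fin N := ⟨0, hN⟩
  obtain ⟨⟨δ, hδ⟩, hmul⟩ := IsLocalization.exist_integer_multiples_of_finite (nonZeroDivisors ℤ[X])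
    (fun x : Fin 3 × Fin N × Fin N => L (w x.1) x.2.1 x.2.2)
  choose m hm using hmul
  let M : Fin 3 → Matrix (Fin N) (Fin N) ℤ[X] := fun i => .of fun j k => m (i, j, k)
  have hML : ∀ i, (M i).map (algebraMap ℤ[X] F) = algebraMap ℤ[X] F δ • L (w i) := by
    intro i; ext j k
    have := hm (i, j, k)
    simp only [Algebra.smul_def] at this
    simpa [M] using this
  have hδ0 : δ ≠ 0 := nonZeroDivisors.ne_zero hδ
  -- the eigenvector
  let v : Fin N → ℂ := fun j => (b j : ℂ) / (b i₀ : ℂ)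
  have hb0 : ((b i₀ : K) : ℂ) ≠ 0 := by
    have := b.ne_zero i₀
    simpa using this
  have hv0 : v i₀ = 1 := div_self hb0
  have hvec : ∀ x : K, v ᵥ* (L x).map (algebraMap F ℂ) = (x : ℂ) • v := by
    intro x
    ext j
    have h1 : x * b j = ∑ i, L x i j • b i := by
      rw [← b.sum_repr (x * b j)]
      refine Finset.sum_congr rfl fun i _ => ?_
      rw [Algebra.leftMulMatrix_eq_repr_mul]
    have h2 := congrArg (fun y : K => (y : ℂ)) h1
    simp only [MulMemClass.coe_mul, AddSubmonoidClass.coe_finsetSum,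
      Algebra.smul_def] at h2
    simp only [Matrix.vecMul, dotProduct, Matrix.map_apply, Pi.smul_apply, smul_eq_mul, v]
    rw [← mul_div_assoc, h2, Finset.sum_div]
    refine Finset.sum_congr rfl fun i _ => ?_
    have h3 : ((algebraMap F K (L x i j) : K) : ℂ) = algebraMap F ℂ (L x i j) := rfl
    rw [h3]
    ring
  obtain ⟨a, ha1, ha⟩ : ∃ a : ℕ, δ.natDegree ≤ a ∧ ∀ i, (M i).NatDegreeLE a := by
    obtain ⟨a, ha⟩ := (Set.finite_range fun x => (m x).natDegree).bddAbove
    exact ⟨max δ.natDegree a, le_max_left _ _, fun i j k =>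
      (ha ⟨(i, j, k), rfl⟩).trans (le_max_right _ _)⟩
  set T := max 1 ‖θ‖
  have hT1 : 1 ≤ T := le_max_left _ _
  obtain ⟨B, hB1, hB⟩ := Polynomial.exists_len_bound
    (Sum.elim (fun i => (M i).len) (Sum.elim (fun j => ‖v j‖)
      ![δ.len, (N : ℝ) ^ 3, T ^ a, ‖φ δ‖]) : Fin 3 ⊕ (Fin N ⊕ Fin 4) → ℝ)
  have hBM : ∀ i, (M i).len ≤ B := fun i => hB (Sum.inl i)
  have hBv : ∀ i, ‖v i‖ ≤ B := fun i => hB (Sum.inr (Sum.inl i))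
  have hBδ : δ.len ≤ B := hB (Sum.inr (Sum.inr 0))
  have hBN : (N : ℝ) ^ 3 ≤ B := hB (Sum.inr (Sum.inr 1))
  have hBT : T ^ a ≤ B := hB (Sum.inr (Sum.inr 2))
  have hBφ : ‖φ δ‖ ≤ B := hB (Sum.inr (Sum.inr 3))
  have hBe : B = Real.exp (Real.log B) := (Real.exp_log (by linarith)).symm
  have hlB : 0 ≤ Real.log B := Real.log_nonneg hB1
  set C : ℝ := N.factorial + N * (1 + 2 * Real.log B) + N * a with hC
  have hfac : (1 : ℝ) ≤ N.factorial := by exact_mod_cast Nat.factorial_pos N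
  refine ⟨C, by positivity, ?_⟩
  intro d H P hH hd hlen hP
  set G := Matrix.homEval δ M d P with hG
  have hGF : G.map (algebraMap ℤ[X] F) = algebraMap ℤ[X] F δ ^ d • L (MvPolynomial.aeval w P) := by
    rw [hG, Matrix.homEval_map, funext hML]
    exact Matrix.homEval_smul_algHom L _ w hd
  have hcoe : ((MvPolynomial.aeval w P : K) : ℂ) = MvPolynomial.aeval ω P := by
    have := MvPolynomial.aeval_algebraMap_apply ℂ w P (R := ℤ)
    exact this.symm
  have hw0 : MvPolynomial.aeval w P ≠ 0 := by
    intro h0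
    apply hP
    rw [← hcoe, h0]; rfl
  have hdet : G.det ≠ 0 := by
    intro h0
    have h1 : (G.map (algebraMap ℤ[X] F)).det = 0 := by
      have := RingHom.map_det (algebraMap ℤ[X] F) G
      rw [h0, map_zero] at this
      exact this.symm
    rw [hGF, Matrix.det_smul, ← Algebra.norm_eq_matrix_det] at h1
    rcases mul_eq_zero.1 h1 with h1 | h1
    · exact hδ0 ((map_eq_zero_iff _ (IsFractionRing.injective ℤ[X] F)).1
        (eq_zero_of_pow_eq_zero (eq_zero_of_pow_eq_zero h1)))
    · exact hw0 (Algebra.norm_eq_zero_iff.1 h1)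
  have hGdeg : G.NatDegreeLE (a * d) := Matrix.natDegreeLE_homEval hd ha1 ha
  set x := Real.exp H * B ^ (2 * d + 1) with hx
  have hBpow : ∀ k ≤ 2 * d + 1, B ^ k ≤ B ^ (2 * d + 1) := fun k hk => pow_le_pow_right₀ hB1 hk
  have hGlen' : G.len ≤ Real.exp H * B ^ (d + 1) := by
    refine (Matrix.len_homEval_le hd hBδ hBM).trans ?_
    rw [pow_succ' B d]
    exact mul_le_mul hlen (mul_le_mul_of_nonneg_right hBN (by positivity)) (by positivity)
      (Real.exp_pos _).le
  have hGlen : ∀ i j, (G i j).len ≤ x := fun i j => by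
    refine (Matrix.len_apply_le G i j).trans (hGlen'.trans ?_)
    exact mul_le_mul_of_nonneg_left (hBpow _ (by omega)) (Real.exp_pos _).le
  have hbig : N.factorial * x ^ N ≤ Real.exp (C * (d + H + 1)) := by
    calc N.factorial * x ^ N ≤ Real.exp N.factorial * x ^ N := by
          gcongr
          have := Real.add_one_le_exp (N.factorial : ℝ)
          linarith
      _ = Real.exp (N.factorial + N * (H + (2 * d + 1) * Real.log B)) := by
          rw [hx]
          conv_lhs => rw [hBe]
          rw [← Real.exp_nat_mul, ← Real.exp_add, ← Real.exp_nat_mul, ← Real.exp_add]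
          push_cast; ring_nf
      _ ≤ Real.exp (C * (d + H + 1)) := by
          rw [Real.exp_le_exp, hC]
          have hd0 : (0 : ℝ) ≤ d := Nat.cast_nonneg _
          have hN0 : (0 : ℝ) ≤ N := Nat.cast_nonneg _
          have ha0 : (0 : ℝ) ≤ a := Nat.cast_nonneg _
          have e1 : 0 ≤ (N.factorial : ℝ) * (d + H) := by positivity
          have e2 : 0 ≤ (N : ℝ) * d := by positivity
          have e3 : 0 ≤ (N : ℝ) * Real.log B := by positivity
          have e4 : 0 ≤ (N : ℝ) * Real.log B * H := by positivity
          have e5 : 0 ≤ (N : ℝ) * a * (d + H + 1) := by positivity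
          nlinarith
  refine ⟨G.det, hdet, ?_, ?_, ?_⟩
  · have h1 := hGdeg.natDegree_det
    calc (G.det.natDegree : ℝ) ≤ (N * (a * d) : ℕ) := by exact_mod_cast h1
      _ = N * a * d := by push_cast; ring
      _ ≤ C * d := by
        gcongr
        rw [hC]
        have : 0 ≤ (N : ℝ) * (1 + 2 * Real.log B) := by positivity
        linarith
  · intro i
    exact (Polynomial.abs_coeff_le_len _ _).trans ((Matrix.len_det_le G hGlen).trans hbig)
  · have hdetθ : aeval θ G.det = (G.map φ).det := by
      exact RingHom.map_det φ G
    have hGφ : G.map φ = (G.map (algebraMap ℤ[X] F)).map (algebraMap F ℂ) := by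
      ext i j
      simp [hFφ]
    have hvG : v ᵥ* G.map φ = (φ δ ^ d * MvPolynomial.aeval ω P) • v := by
      rw [hGφ, hGF]
      have h1 : (algebraMap ℤ[X] F δ ^ d • L (MvPolynomial.aeval w P)).map (algebraMap F ℂ) =
          (φ δ ^ d) • (L (MvPolynomial.aeval w P)).map (algebraMap F ℂ) := by
        ext i j
        simp [hFφ]
      rw [h1, Matrix.vecMul_smul, hvec, hcoe, smul_smul]
    rw [hdetθ]
    have := Matrix.norm_det_le_of_vecMul (G.map φ) v i₀ hv0 (x := x) (norm_pos_iff.2 hP) ?_ ?_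
    · refine this.trans ?_
      rw [Fintype.card_fin]
      gcongr
    · intro i j
      rw [Matrix.map_apply]
      change ‖aeval θ (G i j)‖ ≤ x
      refine (Polynomial.norm_aeval_le_len hT1 (le_max_right _ _) (hGdeg i j)).trans ?_
      calc (G i j).len * T ^ (a * d) ≤ (Real.exp H * B ^ (d + 1)) * B ^ d := by
            rw [pow_mul]
            gcongr
            exact (Matrix.len_apply_le G i j).trans hGlen'
        _ = x := by rw [hx]; ring
    · intro j
      rw [hvG, Pi.smul_apply, smul_eq_mul, norm_mul, norm_mul, norm_pow]
      have h1 : ‖φ δ‖ ^ d * ‖v j‖ ≤ x := by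
        calc ‖φ δ‖ ^ d * ‖v j‖ ≤ B ^ d * B := by gcongr; exact hBv j
          _ = B ^ (d + 1) := by ring
          _ ≤ B ^ (2 * d + 1) := hBpow _ (by omega)
          _ ≤ x := le_mul_of_one_le_left (by positivity) (Real.one_le_exp hH)
      calc ‖φ δ‖ ^ d * ‖MvPolynomial.aeval ω P‖ * ‖v j‖
          = ‖MvPolynomial.aeval ω P‖ * (‖φ δ‖ ^ d * ‖v j‖) := by ring
        _ ≤ _ := by gcongr

end

section

open Finset in
/-- `f.WBound r B` means that `∑ |aₙ| rⁿ ≤ B` for the coefficients `aₙ` of `f`. -/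
def PowerSeries.WBound (f : PowerSeries ℤ) (r B : ℝ) : Prop :=
  ∀ N : ℕ, ∑ n ∈ range N, |((PowerSeries.coeff n f : ℤ) : ℝ)| * r ^ n ≤ B

/-- The value at `q` of the power series `f`. -/
noncomputable def PowerSeries.ev (f : PowerSeries ℤ) (q : ℂ) : ℂ :=
  ∑' n : ℕ, ((PowerSeries.coeff n f : ℤ) : ℂ) * q ^ n

/-- Convergence in the open unit disc. -/
def PowerSeries.Conv (f : PowerSeries ℤ) : Prop :=
  ∀ r : ℝ, 0 ≤ r → r < 1 → ∃ B, f.WBound r B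

namespace PowerSeries

section
open Finset
variable {f g : PowerSeries ℤ} {r B B' : ℝ}

theorem WBound.nonneg (hf : f.WBound r B) : 0 ≤ B := by simpa using hf 0

theorem WBound.mono (hf : f.WBound r B) (h : B ≤ B') : f.WBound r B' := fun N => (hf N).trans h

theorem WBound.mono_radius {s : ℝ} (hs : 0 ≤ s) (hsr : s ≤ r) (hf : f.WBound r B) :
    f.WBound s B := fun N =>
  (sum_le_sum fun n _ => by gcongr).trans (hf N)

theorem WBound.add (hf : f.WBound r B) (hg : g.WBound r B') (hr : 0 ≤ r) :
    (f + g).WBound r (B + B') := fun N => by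
  refine le_trans ?_ (add_le_add (hf N) (hg N))
  rw [← sum_add_distrib]
  refine sum_le_sum fun n _ => ?_
  rw [← add_mul, map_add, Int.cast_add]
  gcongr
  exact abs_add_le _ _

theorem WBound.zero : (0 : PowerSeries ℤ).WBound r 0 := fun N => by simp

theorem WBound.sum {ι : Type*} (s : Finset ι) {F : ι → PowerSeries ℤ} {b : ι → ℝ} (hr : 0 ≤ r)
    (h : ∀ i ∈ s, (F i).WBound r (b i)) : (∑ i ∈ s, F i).WBound r (∑ i ∈ s, b i) := by
  classical
  induction s using Finset.induction_on with
  | empty => simpa using WBound.zero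
  | insert a s ha ih =>
    rw [sum_insert ha, sum_insert ha]
    exact (h a (mem_insert_self _ _)).add (ih fun i hi => h i (mem_insert_of_mem hi)) hr

theorem WBound.mul (hf : f.WBound r B) (hg : g.WBound r B') (hr : 0 ≤ r) :
    (f * g).WBound r (B * B') := fun N => by
  calc ∑ n ∈ range N, |((coeff n (f * g) : ℤ) : ℝ)| * r ^ n
      ≤ ∑ n ∈ range N, ∑ p ∈ antidiagonal n, (|((coeff p.1 f : ℤ) : ℝ)| * r ^ p.1) *
          (|((coeff p.2 g : ℤ) : ℝ)| * r ^ p.2) := by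
        refine sum_le_sum fun n _ => ?_
        rw [coeff_mul, Int.cast_sum]
        calc |∑ p ∈ antidiagonal n, ((coeff p.1 f * coeff p.2 g : ℤ) : ℝ)| * r ^ n
            ≤ (∑ p ∈ antidiagonal n, |((coeff p.1 f * coeff p.2 g : ℤ) : ℝ)|) * r ^ n := by
              gcongr; exact abs_sum_le_sum_abs _ _
          _ = _ := by
              rw [sum_mul]
              refine sum_congr rfl fun p hp => ?_
              rw [← mem_antidiagonal.1 hp, pow_add, Int.cast_mul, abs_mul]
              ring
    _ ≤ ∑ p ∈ range N ×ˢ range N, (|((coeff p.1 f : ℤ) : ℝ)| * r ^ p.1) *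
          (|((coeff p.2 g : ℤ) : ℝ)| * r ^ p.2) := by
        refine le_trans (le_of_eq ?_) (sum_le_sum_of_subset_of_nonneg
          (s := (range N ×ˢ range N).filter fun p => p.1 + p.2 < N) (filter_subset _ _)
          fun p _ _ => by positivity)
        rw [sum_sigma']
        refine sum_bij' (fun x _ => x.2) (fun p _ => ⟨p.1 + p.2, p⟩) ?_ ?_ ?_ ?_ ?_
        · rintro ⟨n, p⟩ h
          simp only [mem_sigma, mem_range, HasAntidiagonal.mem_antidiagonal] at h
          simp only [mem_filter, mem_product, mem_range]
          omega
        · intro p h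
          simp only [mem_filter, mem_product, mem_range] at h
          simp [h.2]
        · rintro ⟨n, p⟩ h
          simp only [mem_sigma, mem_range, HasAntidiagonal.mem_antidiagonal] at h
          simp [h.2]
        · simp
        · simp
    _ = (∑ n ∈ range N, |((coeff n f : ℤ) : ℝ)| * r ^ n) *
          ∑ n ∈ range N, |((coeff n g : ℤ) : ℝ)| * r ^ n := by
        rw [sum_mul_sum, sum_product]
    _ ≤ B * B' := mul_le_mul (hf N) (hg N) (sum_nonneg fun _ _ => by positivity) hf.nonneg

theorem WBound.intCast (c : ℤ) (hr : 0 ≤ r) : (c : PowerSeries ℤ).WBound r |(c : ℝ)| := fun N => by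
  have : ∀ n, |((coeff n (c : PowerSeries ℤ) : ℤ) : ℝ)| * r ^ n = if n = 0 then |(c : ℝ)| else 0 := by
    intro n
    have h : (c : PowerSeries ℤ) = C c := by simp
    rw [h, coeff_C]
    split_ifs with h <;> simp [h]
  simp only [this]
  rw [sum_ite_eq']
  split_ifs
  · exact le_rfl
  · positivity

theorem WBound.one (hr : 0 ≤ r) : (1 : PowerSeries ℤ).WBound r 1 := by
  simpa using WBound.intCast 1 hr

theorem WBound.pow (hf : f.WBound r B) (hr : 0 ≤ r) (n : ℕ) : (f ^ n).WBound r (B ^ n) := by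
  induction n with
  | zero => simpa using WBound.one hr
  | succ n ih => rw [pow_succ, pow_succ]; exact ih.mul hf hr

theorem WBound.aeval {F : Fin 3 → PowerSeries ℤ} (hr : 0 ≤ r) (hB : 1 ≤ B)
    (hF : ∀ i, (F i).WBound r B) {d : ℕ} {A : MvPolynomial (Fin 3) ℤ} (hA : A.totalDegree ≤ d) :
    (MvPolynomial.aeval F A).WBound r (A.len * B ^ d) := by
  rw [MvPolynomial.aeval_fin_three, MvPolynomial.len, Finset.sum_mul]
  refine WBound.sum _ hr fun m hm => ?_
  refine (WBound.intCast _ hr).mul ?_ hr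
  refine (((((hF 0).pow hr _).mul ((hF 1).pow hr _) hr).mul ((hF 2).pow hr _) hr)).mono ?_
  rw [← pow_add, ← pow_add]
  exact pow_le_pow_right₀ hB (Finsupp.sum_le_of_mem_support_fin_three hm hA)

theorem WBound.abs_coeff_mul_le (hf : f.WBound r B) (hr : 0 ≤ r) (m : ℕ) :
    |((coeff m f : ℤ) : ℝ)| * r ^ m ≤ B := by
  refine le_trans ?_ (hf (m + 1))
  exact single_le_sum (f := fun n => |((coeff n f : ℤ) : ℝ)| * r ^ n)
    (fun n _ => by positivity) (mem_range.2 (Nat.lt_succ_self m))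

theorem WBound.summable (hf : f.WBound r B) (hr : 0 ≤ r) :
    Summable fun n => |((coeff n f : ℤ) : ℝ)| * r ^ n :=
  summable_of_sum_range_le (fun n => by positivity) hf

theorem WBound.tsum_le (hf : f.WBound r B) (hr : 0 ≤ r) :
    ∑' n, |((coeff n f : ℤ) : ℝ)| * r ^ n ≤ B :=
  Real.tsum_le_of_sum_range_le (fun n => by positivity) hf

theorem Conv.summable_norm (hf : f.Conv) {q : ℂ} (hq : ‖q‖ < 1) :
    Summable fun n => ‖((coeff n f : ℤ) : ℂ) * q ^ n‖ := by
  obtain ⟨B, hB⟩ := hf ‖q‖ (norm_nonneg _) hq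
  simpa using hB.summable (norm_nonneg _)

theorem Conv.hasSum (hf : f.Conv) {q : ℂ} (hq : ‖q‖ < 1) :
    HasSum (fun n => ((coeff n f : ℤ) : ℂ) * q ^ n) (f.ev q) :=
  (hf.summable_norm hq).of_norm.hasSum

theorem Conv.add (hf : f.Conv) (hg : g.Conv) : (f + g).Conv := fun r h0 h1 => by
  obtain ⟨B, hB⟩ := hf r h0 h1
  obtain ⟨B', hB'⟩ := hg r h0 h1
  exact ⟨_, hB.add hB' h0⟩

theorem Conv.mul (hf : f.Conv) (hg : g.Conv) : (f * g).Conv := fun r h0 h1 => by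
  obtain ⟨B, hB⟩ := hf r h0 h1
  obtain ⟨B', hB'⟩ := hg r h0 h1
  exact ⟨_, hB.mul hB' h0⟩

theorem Conv.intCast (c : ℤ) : (c : PowerSeries ℤ).Conv := fun _ h0 _ =>
  ⟨_, WBound.intCast c h0⟩

theorem ev_add (hf : f.Conv) (hg : g.Conv) {q : ℂ} (hq : ‖q‖ < 1) :
    (f + g).ev q = f.ev q + g.ev q := by
  refine ((hf.hasSum hq).add (hg.hasSum hq)).tsum_eq ▸ ?_
  simp only [ev, map_add, Int.cast_add, add_mul]

theorem ev_mul (hf : f.Conv) (hg : g.Conv) {q : ℂ} (hq : ‖q‖ < 1) :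
    (f * g).ev q = f.ev q * g.ev q := by
  rw [ev, ev, ev, tsum_mul_tsum_eq_tsum_sum_antidiagonal_of_summable_norm
    (hf.summable_norm hq) (hg.summable_norm hq)]
  refine tsum_congr fun n => ?_
  rw [coeff_mul, Int.cast_sum, sum_mul]
  refine sum_congr rfl fun p hp => ?_
  rw [← mem_antidiagonal.1 hp, pow_add, Int.cast_mul]
  ring

theorem ev_intCast (c : ℤ) (q : ℂ) : (c : PowerSeries ℤ).ev q = c := by
  have h : (c : PowerSeries ℤ) = C c := by simp
  rw [ev, tsum_eq_single 0]
  · rw [h, coeff_C, if_pos rfl, pow_zero, mul_one]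
  · intro n hn; rw [h, coeff_C, if_neg hn]; simp

theorem Conv.aeval {F : Fin 3 → PowerSeries ℤ} (hF : ∀ i, (F i).Conv)
    (A : MvPolynomial (Fin 3) ℤ) : (MvPolynomial.aeval F A).Conv := by
  induction A using MvPolynomial.induction_on with
  | C a => simpa using Conv.intCast a
  | add p q hp hq => rw [map_add]; exact hp.add hq
  | mul_X p i hp => rw [map_mul, MvPolynomial.aeval_X]; exact hp.mul (hF i)

theorem ev_aeval {F : Fin 3 → PowerSeries ℤ} (hF : ∀ i, (F i).Conv)
    (A : MvPolynomial (Fin 3) ℤ) {q : ℂ} (hq : ‖q‖ < 1) :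
    (MvPolynomial.aeval F A).ev q = MvPolynomial.aeval (fun i => (F i).ev q) A := by
  induction A using MvPolynomial.induction_on with
  | C a => simpa using ev_intCast a q
  | add p p' hp hp' => rw [map_add, map_add, ev_add (.aeval hF p) (.aeval hF p') hq, hp, hp']
  | mul_X p i hp =>
    rw [map_mul, map_mul, MvPolynomial.aeval_X, MvPolynomial.aeval_X,
      ev_mul (.aeval hF p) (hF i) hq, hp]

theorem WBound.norm_ev_le (hf : f.WBound r B) (hr : 0 < r) {q : ℂ} (hq : ‖q‖ ≤ r) {M : ℕ}
    (hM : ∀ m < M, coeff m f = 0) : ‖f.ev q‖ ≤ (‖q‖ / r) ^ M * B := by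
  have hs := hf.summable hr.le
  have hle : ∀ n, ‖((coeff n f : ℤ) : ℂ) * q ^ n‖ ≤
      (‖q‖ / r) ^ M * (|((coeff n f : ℤ) : ℝ)| * r ^ n) := by
    intro n
    rcases lt_or_ge n M with h | h
    · simp [hM n h]
    · rw [norm_mul, norm_pow, Complex.norm_intCast]
      have h1 : (‖q‖ / r) ^ n ≤ (‖q‖ / r) ^ M :=
        pow_le_pow_of_le_one (by positivity) (div_le_one_of_le₀ hq hr.le) h
      calc |((coeff n f : ℤ) : ℝ)| * ‖q‖ ^ n
          = (‖q‖ / r) ^ n * (|((coeff n f : ℤ) : ℝ)| * r ^ n) := by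
            rw [div_pow]; field_simp
        _ ≤ _ := by gcongr
  calc ‖f.ev q‖ ≤ ∑' n, (‖q‖ / r) ^ M * (|((coeff n f : ℤ) : ℝ)| * r ^ n) :=
        tsum_of_norm_bounded (hs.mul_left _).hasSum hle
    _ ≤ _ := by
        rw [tsum_mul_left]
        gcongr
        exact hf.tsum_le hr.le

theorem WBound.norm_ev_le' (hf : f.WBound r B) (hr : 0 < r) {q : ℂ} (hq : ‖q‖ ≤ r) :
    ‖f.ev q‖ ≤ B := by
  simpa using hf.norm_ev_le hr hq (M := 0) (by simp)

theorem ev_zero_arg (f : PowerSeries ℤ) : f.ev 0 = (coeff 0 f : ℤ) := by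
  rw [ev, tsum_eq_single 0]
  · simp
  · intro n hn; simp [hn]

/-- Division by the `M`-th power of the variable. -/
noncomputable def shift (f : PowerSeries ℤ) (M : ℕ) : PowerSeries ℤ := mk fun n => coeff (n + M) f

theorem WBound.shift (hf : f.WBound r B) (hr : 0 < r) (M : ℕ) :
    (f.shift M).WBound r (B / r ^ M) := fun N => by
  rw [le_div_iff₀ (by positivity), sum_mul]
  calc ∑ n ∈ range N, |((coeff n (f.shift M) : ℤ) : ℝ)| * r ^ n * r ^ M
      = ∑ n ∈ range N, |((coeff (n + M) f : ℤ) : ℝ)| * r ^ (n + M) :=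
        sum_congr rfl fun n _ => by rw [PowerSeries.shift, coeff_mk, pow_add]; ring
    _ ≤ ∑ n ∈ range (N + M), |((coeff n f : ℤ) : ℝ)| * r ^ n := by
        rw [add_comm N, sum_range_add]
        simp only [add_comm M]
        exact le_add_of_nonneg_left (sum_nonneg fun _ _ => by positivity)
    _ ≤ B := hf _

theorem Conv.shift (hf : f.Conv) (M : ℕ) : (f.shift M).Conv := by
  have key : ∀ r : ℝ, 0 < r → r < 1 → ∃ B, (f.shift M).WBound r B := fun r h0 h1 => by
    obtain ⟨B, hB⟩ := hf r h0.le h1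
    exact ⟨_, hB.shift h0 M⟩
  intro r h0 h1
  obtain ⟨B, hB⟩ := key ((r + 1) / 2) (by linarith) (by linarith)
  exact ⟨B, hB.mono_radius h0 (by linarith)⟩

theorem ev_eq_pow_mul_ev_shift (hf : f.Conv) {M : ℕ} (hM : ∀ m < M, coeff m f = 0) {q : ℂ}
    (hq : ‖q‖ < 1) : f.ev q = q ^ M * (f.shift M).ev q := by
  have h1 := (hf.hasSum hq).summable.sum_add_tsum_nat_add M
  rw [sum_eq_zero (fun i hi => by simp [hM i (mem_range.1 hi)]), zero_add] at h1
  rw [ev, ← h1, ev, ← tsum_mul_left]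
  refine tsum_congr fun n => ?_
  rw [PowerSeries.shift, coeff_mk, pow_add]
  ring

theorem Conv.differentiableOn (hf : f.Conv) : DifferentiableOn ℂ f.ev (Metric.ball 0 1) := by
  intro z hz
  have hz' : ‖z‖ < 1 := by simpa using hz
  obtain ⟨r, hzr, hr1⟩ := exists_between hz'
  have hr0 : 0 < r := (norm_nonneg _).trans_lt hzr
  obtain ⟨B, hB⟩ := hf r hr0.le hr1
  have h := Complex.differentiableOn_tsum_of_summable_norm
    (F := fun (n : ℕ) (q : ℂ) => ((coeff n f : ℤ) : ℂ) * q ^ n) (U := Metric.ball 0 r)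
    (hB.summable hr0.le) (fun n => by fun_prop) Metric.isOpen_ball (fun n w hw => by
      have hw' : ‖w‖ < r := by simpa using hw
      rw [norm_mul, norm_pow, Complex.norm_intCast]
      gcongr)
  exact (h.differentiableAt (Metric.isOpen_ball.mem_nhds (by simpa using hzr))).differentiableWithinAt

theorem Conv.eq_zero_of_ev_eq_zero (hf : f.Conv) (h : ∀ q : ℂ, q ≠ 0 → ‖q‖ < 1 → f.ev q = 0) :
    f = 0 := by
  by_contra hne
  obtain ⟨m, hm⟩ : ∃ m, coeff m f ≠ 0 := by
    by_contra! hcon; exact hne (PowerSeries.ext hcon)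
  classical
  have hex : ∃ m, coeff m f ≠ 0 := ⟨m, hm⟩
  let M := Nat.find hex
  have hM : coeff M f ≠ 0 := Nat.find_spec hex
  have hlt : ∀ m < M, coeff m f = 0 := fun m hm' => by
    simpa using Nat.find_min hex hm'
  have hcont : ContinuousAt (f.shift M).ev 0 :=
    ((hf.shift M).differentiableOn.differentiableAt
      (Metric.isOpen_ball.mem_nhds (by simp))).continuousAt
  have hev : ∀ᶠ q in nhdsWithin (0 : ℂ) {0}ᶜ, (f.shift M).ev q = 0 := by
    have hb : ∀ᶠ q in nhdsWithin (0 : ℂ) {0}ᶜ, q ∈ Metric.ball (0 : ℂ) 1 :=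
      mem_nhdsWithin_of_mem_nhds (Metric.isOpen_ball.mem_nhds (by simp))
    filter_upwards [hb, self_mem_nhdsWithin] with q hq hq0
    have hq1 : ‖q‖ < 1 := by simpa using hq
    have := h q hq0 hq1
    rw [ev_eq_pow_mul_ev_shift hf hlt hq1] at this
    exact (mul_eq_zero.1 this).resolve_left (pow_ne_zero _ hq0)
  have hlim : Filter.Tendsto (f.shift M).ev (nhdsWithin (0 : ℂ) {0}ᶜ) (nhds 0) :=
    tendsto_const_nhds.congr' (hev.mono fun _ h => h.symm)
  have h0 := tendsto_nhds_unique (hcont.tendsto.mono_left nhdsWithin_le_nhds) hlim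
  rw [ev_zero_arg, PowerSeries.shift, coeff_mk, zero_add] at h0
  exact hM (by exact_mod_cast h0)

end

end PowerSeries

/-- The integers `-24`, `240`, `-504`. -/
def eisCoeff : Fin 3 → ℤ := ![-24, 240, -504]

/-- The `q`-expansions of the Eisenstein series of weights `2`, `4`, `6`. -/
noncomputable def eis (i : Fin 3) : PowerSeries ℤ :=
  PowerSeries.mk fun n => if n = 0 then 1 else
    eisCoeff i * ∑ d ∈ n.divisors, (d : ℤ) ^ (2 * (i : ℕ) + 1)

theorem abs_coeff_eis_le (i : Fin 3) (n : ℕ) :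
    |((PowerSeries.coeff n (eis i) : ℤ) : ℝ)| ≤ 362880 * ((n + 6).choose 6 : ℝ) := by
  rw [eis, PowerSeries.coeff_mk]
  split_ifs with h
  · subst h; norm_num
  have hc : |((eisCoeff i : ℤ) : ℝ)| ≤ 504 := by
    fin_cases i <;> norm_num [eisCoeff]
  have hs : |∑ d ∈ n.divisors, (d : ℝ) ^ (2 * (i : ℕ) + 1)| ≤ n ^ 6 := by
    rw [abs_of_nonneg (by positivity)]
    have hn : 1 ≤ (n : ℝ) := by exact_mod_cast Nat.one_le_iff_ne_zero.2 h
    calc ∑ d ∈ n.divisors, (d : ℝ) ^ (2 * (i : ℕ) + 1) ≤ ∑ d ∈ n.divisors, (n : ℝ) ^ 5 := by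
          refine Finset.sum_le_sum fun d hd => ?_
          have hdn : (d : ℝ) ≤ n := by exact_mod_cast Nat.divisor_le hd
          exact (pow_le_pow_left₀ (by positivity) hdn _).trans
            (pow_le_pow_right₀ hn (by have := i.2; omega))
      _ = n.divisors.card * (n : ℝ) ^ 5 := by simp
      _ ≤ n * (n : ℝ) ^ 5 := by
          gcongr
          exact_mod_cast Nat.card_divisors_le_self n
      _ = n ^ 6 := by ring
  have hch : (n : ℝ) ^ 6 ≤ 720 * ((n + 6).choose 6 : ℝ) := by
    have h1 : (n + 1) ^ 6 ≤ (n + 6).descFactorial 6 := by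
      have := Nat.pow_sub_le_descFactorial (n + 6) 6
      simpa using this
    rw [Nat.descFactorial_eq_factorial_mul_choose] at h1
    have h2 : n ^ 6 ≤ 720 * (n + 6).choose 6 :=
      (Nat.pow_le_pow_left (Nat.le_succ n) 6).trans h1
    exact_mod_cast h2
  push_cast
  rw [abs_mul]
  calc _ ≤ 504 * (n : ℝ) ^ 6 := mul_le_mul hc hs (abs_nonneg _) (by norm_num)
    _ ≤ _ := by linarith

theorem eis_wBound (i : Fin 3) {r : ℝ} (h0 : 0 ≤ r) (h1 : r < 1) :
    (eis i).WBound r (362880 / (1 - r) ^ 7) := fun N => by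
  have h := (hasSum_choose_mul_geometric_of_norm_lt_one 6 (r := r)
    (by rwa [Real.norm_of_nonneg h0])).mul_left 362880
  have h2 := sum_le_hasSum (Finset.range N) (fun n _ => by positivity) h
  refine le_trans (Finset.sum_le_sum fun n _ => ?_) (h2.trans_eq (by ring))
  rw [← mul_assoc]
  gcongr
  exact abs_coeff_eis_le i n

theorem eis_conv (i : Fin 3) : (eis i).Conv := fun _ h0 h1 => ⟨_, eis_wBound i h0 h1⟩

end

section

namespace PowerSeries
open Finset
variable {f g : PowerSeries ℤ} {r B B' : ℝ}

/-- The operator `q d/dq` on power series. -/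
noncomputable def theta (f : PowerSeries ℤ) : PowerSeries ℤ := mk fun n => (n : ℤ) * coeff n f

theorem coeff_theta (f : PowerSeries ℤ) (n : ℕ) : coeff n (theta f) = n * coeff n f := coeff_mk _ _

theorem coeff_theta_iterate (f : PowerSeries ℤ) (t n : ℕ) :
    coeff n (theta^[t] f) = (n : ℤ) ^ t * coeff n f := by
  induction t with
  | zero => simp
  | succ t ih => rw [Function.iterate_succ_apply', coeff_theta, ih]; ring

theorem theta_add (f g : PowerSeries ℤ) : theta (f + g) = theta f + theta g := by
  ext n; simp [coeff_theta, mul_add]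

theorem theta_mul (f g : PowerSeries ℤ) : theta (f * g) = theta f * g + f * theta g := by
  ext n
  rw [coeff_theta, map_add, coeff_mul, coeff_mul, coeff_mul, mul_sum, ← sum_add_distrib]
  refine sum_congr rfl fun p hp => ?_
  rw [← HasAntidiagonal.mem_antidiagonal.1 hp, coeff_theta, coeff_theta]
  push_cast
  ring

theorem theta_intCast (c : ℤ) : theta (c : PowerSeries ℤ) = 0 := by
  ext n
  have h : (c : PowerSeries ℤ) = C c := by simp
  rw [coeff_theta, h, coeff_C]
  split_ifs with h0 <;> simp [h0]

theorem _root_.Real.pow_mul_pow_le_factorial_div {ρ : ℝ} (h0 : 0 < ρ) (h1 : ρ < 1) (n t : ℕ) :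
    (n : ℝ) ^ t * ρ ^ n ≤ t.factorial / (-Real.log ρ) ^ t := by
  have hl : 0 < -Real.log ρ := neg_pos.2 (Real.log_neg h0 h1)
  have hx : 0 ≤ n * -Real.log ρ := by positivity
  have h := Real.pow_div_factorial_le_exp _ hx t
  have he : Real.exp (n * -Real.log ρ) * ρ ^ n = 1 := by
    conv_lhs => rw [← Real.exp_log h0]
    rw [Real.log_exp, ← Real.exp_nat_mul, ← Real.exp_add]
    simp
  rw [div_le_iff₀ (by positivity), mul_pow] at h
  rw [le_div_iff₀ (by positivity)]
  calc (n : ℝ) ^ t * ρ ^ n * (-Real.log ρ) ^ t = (n : ℝ) ^ t * (-Real.log ρ) ^ t * ρ ^ n := by ring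
    _ ≤ Real.exp (n * -Real.log ρ) * t.factorial * ρ ^ n := by gcongr
    _ = (Real.exp (n * -Real.log ρ) * ρ ^ n) * t.factorial := by ring
    _ = t.factorial := by rw [he, one_mul]

theorem WBound.theta_iterate (hf : f.WBound r B) (hr : 0 ≤ r) {ρ : ℝ} (h0 : 0 < ρ) (h1 : ρ < 1)
    (t : ℕ) : (theta^[t] f).WBound (r * ρ) (t.factorial / (-Real.log ρ) ^ t * B) := fun N => by
  have hl : 0 < -Real.log ρ := neg_pos.2 (Real.log_neg h0 h1)
  refine le_trans ?_ (mul_le_mul_of_nonneg_left (hf N) (by positivity))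
  rw [mul_sum]
  refine sum_le_sum fun n _ => ?_
  rw [coeff_theta_iterate]
  push_cast
  rw [abs_mul, abs_of_nonneg (by positivity), mul_pow]
  calc (n : ℝ) ^ t * |((coeff n f : ℤ) : ℝ)| * (r ^ n * ρ ^ n)
      = ((n : ℝ) ^ t * ρ ^ n) * (|((coeff n f : ℤ) : ℝ)| * r ^ n) := by ring
    _ ≤ _ := by gcongr; exact Real.pow_mul_pow_le_factorial_div h0 h1 n t

theorem Conv.theta (hf : f.Conv) : (theta f).Conv := fun r h0 h1 => by
  obtain ⟨s, hs, hs1⟩ := exists_between h1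
  have hs0 : 0 < s := h0.trans_lt hs
  obtain ⟨B, hB⟩ := hf s hs0.le hs1
  obtain ⟨ρ, hρ, hρ1⟩ := exists_between ((div_lt_one hs0).2 hs)
  have hρ0 : 0 < ρ := (div_nonneg h0 hs0.le).trans_lt hρ
  have := hB.theta_iterate hs0.le hρ0 hρ1 1
  refine ⟨_, this.mono_radius h0 ?_⟩
  rw [div_lt_iff₀ hs0] at hρ
  linarith

theorem ev_theta (hf : f.Conv) {q : ℂ} (hq : ‖q‖ < 1) : (theta f).ev q = q * deriv f.ev q := by
  obtain ⟨r, hqr, hr1⟩ := exists_between hq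
  have hr0 : 0 < r := (norm_nonneg _).trans_lt hqr
  obtain ⟨B, hB⟩ := hf r hr0.le hr1
  have h := Complex.hasSum_deriv_of_summable_norm (z := q)
    (F := fun (n : ℕ) (q : ℂ) => ((coeff n f : ℤ) : ℂ) * q ^ n) (U := Metric.ball 0 r)
    (hB.summable hr0.le) (fun n => by fun_prop) Metric.isOpen_ball (fun n w hw => by
      have hw' : ‖w‖ < r := by simpa using hw
      rw [norm_mul, norm_pow, Complex.norm_intCast]
      gcongr) (by simpa using hqr)
  refine (((h.mul_left q).congr_fun ?_)).tsum_eq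
  intro n
  simp only [deriv_const_mul_field', deriv_pow_field, coeff_theta]
  rcases n with _ | n
  · simp
  · push_cast
    ring

theorem Conv.eq_mul_of_ev_eq (hf : f.Conv) (hg : g.Conv) (h1 : coeff 0 g = 1) {c : ℂ}
    (h : ∀ q : ℂ, q ≠ 0 → ‖q‖ < 1 → f.ev q = c * g.ev q) : f = (coeff 0 f : ℤ) * g := by
  have hc : c = (coeff 0 f : ℤ) := by
    have hcont : ∀ {F : PowerSeries ℤ}, F.Conv → Filter.Tendsto F.ev (nhdsWithin (0 : ℂ) {0}ᶜ)
        (nhds (coeff 0 F : ℤ)) := fun {F} hF => by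
      rw [← ev_zero_arg]
      exact (hF.differentiableOn.differentiableAt
        (Metric.isOpen_ball.mem_nhds (by simp))).continuousAt.tendsto.mono_left nhdsWithin_le_nhds
    have hb : ∀ᶠ q in nhdsWithin (0 : ℂ) {0}ᶜ, q ∈ Metric.ball (0 : ℂ) 1 :=
      mem_nhdsWithin_of_mem_nhds (Metric.isOpen_ball.mem_nhds (by simp))
    have hev : f.ev =ᶠ[nhdsWithin (0 : ℂ) {0}ᶜ] fun q => c * g.ev q := by
      filter_upwards [hb, self_mem_nhdsWithin] with q hq hq0
      exact h q hq0 (by simpa using hq)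
    have := tendsto_nhds_unique ((hcont hf).congr' hev) ((hcont hg).const_mul c)
    rw [h1] at this
    simpa using this.symm
  have h2 : f + ((-coeff 0 f : ℤ) : PowerSeries ℤ) * g = 0 := by
    refine (hf.add ((Conv.intCast _).mul hg)).eq_zero_of_ev_eq_zero fun q hq0 hq => ?_
    rw [ev_add hf ((Conv.intCast _).mul hg) hq, ev_mul (Conv.intCast _) hg hq, ev_intCast,
      h q hq0 hq, hc]
    push_cast; ring
  push_cast at h2
  linear_combination h2

end PowerSeries

end

section

open UpperHalfPlane ModularForm EisensteinSeries Derivative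
open scoped MatrixGroups Manifold

/-- The coordinate `q = exp (2πiτ)`. -/
noncomputable def qpar (z : ℂ) : ℂ := Complex.exp (2 * Real.pi * Complex.I * z)

theorem qpar_ne_zero (z : ℂ) : qpar z ≠ 0 := Complex.exp_ne_zero _

theorem norm_qpar (z : ℂ) : ‖qpar z‖ = Real.exp (-(2 * Real.pi * z.im)) := by
  rw [qpar, Complex.norm_exp]
  congr 1
  simp

theorem norm_qpar_lt_one {z : ℂ} (hz : 0 < z.im) : ‖qpar z‖ < 1 := by
  rw [norm_qpar, Real.exp_lt_one_iff]
  have := Real.pi_pos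
  have : 0 < 2 * Real.pi * z.im := by positivity
  linarith

theorem exists_qpar_eq {q : ℂ} (h0 : q ≠ 0) (h1 : ‖q‖ < 1) : ∃ τ : ℍ, qpar τ = q := by
  have hpi : (2 * Real.pi * Complex.I : ℂ) ≠ 0 := Complex.two_pi_I_ne_zero
  have hq : qpar (Complex.log q / (2 * Real.pi * Complex.I)) = q := by
    rw [qpar, mul_div_cancel₀ _ hpi, Complex.exp_log h0]
  refine ⟨⟨Complex.log q / (2 * Real.pi * Complex.I), ?_⟩, hq⟩
  by_contra hcon
  have h2 := norm_qpar (Complex.log q / (2 * Real.pi * Complex.I))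
  rw [hq] at h2
  have : (1 : ℝ) ≤ ‖q‖ := by
    rw [h2, ← Real.exp_zero, Real.exp_le_exp]
    have := Real.pi_pos
    nlinarith
  linarith

theorem E2_eq_ev (τ : ℍ) : E2 τ = (eis 0).ev (qpar τ) := by
  rw [PowerSeries.ev, ← (hasSum_qExpansion_E2 (z := τ)).tsum_eq]
  refine tsum_congr fun n => ?_
  rw [eis, PowerSeries.coeff_mk, qpar, smul_eq_mul]
  split_ifs with h
  · simp
  · rw [ArithmeticFunction.sigma_apply]
    simp [eisCoeff]

theorem eis_ev_eq (i : Fin 3) {q : ℂ} (hq : ‖q‖ < 1) : (eis i).ev q = 1 + (eisCoeff i : ℂ) *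
    ∑' n : ℕ+, (∑ d ∈ (n : ℕ).divisors, (d : ℂ) ^ (2 * (i : ℕ) + 1)) * q ^ (n : ℕ) := by
  have h1 := ((eis_conv i).hasSum hq).summable.sum_add_tsum_nat_add 1
  rw [PowerSeries.ev, ← h1, ← tsum_mul_left, tsum_pnat_eq_tsum_succ
    (f := fun n => (eisCoeff i : ℂ) * ((∑ d ∈ n.divisors, (d : ℂ) ^ (2 * (i : ℕ) + 1)) * q ^ n))]
  congr 1
  · simp [eis]
  · refine tsum_congr fun n => ?_
    rw [eis, PowerSeries.coeff_mk, if_neg (Nat.succ_ne_zero n)]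
    push_cast
    ring

theorem E₄_eq_ev (τ : ℍ) : E₄ τ = (eis 1).ev (qpar τ) := by
  rw [eis_ev_eq 1 (norm_qpar_lt_one τ.2), q_expansion_bernoulli _ ⟨2, rfl⟩,
    show bernoulli 4 = -1 / 30 by decide +kernel]
  simp only [ArithmeticFunction.sigma_apply, zpow_natCast, eisCoeff, qpar]
  push_cast
  norm_num

theorem E₆_eq_ev (τ : ℍ) : E₆ τ = (eis 2).ev (qpar τ) := by
  rw [eis_ev_eq 2 (norm_qpar_lt_one τ.2), q_expansion_bernoulli _ ⟨3, rfl⟩,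
    show bernoulli 6 = 1 / 42 by decide +kernel]
  simp only [ArithmeticFunction.sigma_apply, zpow_natCast, eisCoeff, qpar]
  push_cast
  norm_num
  ring

theorem hasDerivAt_ev_qpar {f : PowerSeries ℤ} (hf : f.Conv) {z : ℂ} (hz : 0 < z.im) :
    HasDerivAt (fun z => f.ev (qpar z)) (2 * Real.pi * Complex.I * (f.theta.ev (qpar z))) z := by
  have h1 : HasDerivAt qpar (qpar z * (2 * Real.pi * Complex.I)) z := by
    have := ((hasDerivAt_id z).const_mul (2 * Real.pi * Complex.I : ℂ)).cexp
    exact this.congr_deriv (by simp [qpar])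
  have h2 : HasDerivAt f.ev (deriv f.ev (qpar z)) (qpar z) :=
    (hf.differentiableOn.differentiableAt (Metric.isOpen_ball.mem_nhds
      (by simpa using norm_qpar_lt_one hz))).hasDerivAt
  have h3 := h2.comp z h1
  rw [PowerSeries.ev_theta hf (norm_qpar_lt_one hz)]
  exact h3.congr_deriv (by ring)

section
variable {f : PowerSeries ℤ} {F : ℍ → ℂ}

theorem ev_comp_ofComplex_eventuallyEq (hF : ∀ τ : ℍ, F τ = f.ev (qpar τ)) {z : ℂ} (hz : 0 < z.im) :
    F ∘ ofComplex =ᶠ[nhds z] fun z => f.ev (qpar z) := by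
  filter_upwards [isOpen_upperHalfPlaneSet.mem_nhds hz] with w hw
  rw [Function.comp_apply, hF, ofComplex_apply_of_im_pos hw]

theorem mdifferentiable_of_eq_ev (hf : f.Conv) (hF : ∀ τ : ℍ, F τ = f.ev (qpar τ)) : MDiff F := by
  rw [UpperHalfPlane.mdifferentiable_iff]
  intro z hz
  exact ((hasDerivAt_ev_qpar hf hz).congr_of_eventuallyEq
    (ev_comp_ofComplex_eventuallyEq hF hz)).differentiableAt.differentiableWithinAt

theorem normalizedDeriv_eq_ev (hf : f.Conv) (hF : ∀ τ : ℍ, F τ = f.ev (qpar τ)) (τ : ℍ) :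
    D F τ = f.theta.ev (qpar τ) := by
  rw [normalizedDerivOfComplex, ((hasDerivAt_ev_qpar hf τ.2).congr_of_eventuallyEq
    (ev_comp_ofComplex_eventuallyEq hF τ.2)).deriv]
  rw [inv_mul_cancel_left₀ Complex.two_pi_I_ne_zero]

theorem isBoundedAtImInfty_of_eq_ev (hf : f.Conv) (hF : ∀ τ : ℍ, F τ = f.ev (qpar τ)) :
    IsBoundedAtImInfty F := by
  refine isBoundedAtImInfty_of_hasSum_qExpansion (h := 1) one_pos
    (c := fun n => ((PowerSeries.coeff n f : ℤ) : ℂ)) fun τ => ?_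
  rw [hF]
  simpa [Function.Periodic.qParam, qpar] using hf.hasSum (norm_qpar_lt_one τ.2)

/-- A function with a convergent `q`-expansion that is invariant under the weight `k` action is a
modular form. -/
noncomputable def modularFormOfEv (k : ℤ) (hf : f.Conv) (hF : ∀ τ : ℍ, F τ = f.ev (qpar τ))
    (hinv : ∀ γ : SL(2, ℤ), F ∣[k] γ = F) : ModularForm 𝒮ℒ k where
  toFun := F
  slash_action_eq' := by
    rintro _ ⟨γ, rfl⟩
    exact hinv γ
  holo' := mdifferentiable_of_eq_ev hf hF
  bdd_at_cusps' hc := by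
    rw [OnePoint.isBoundedAt_iff_forall_SL2Z hc]
    intro γ _
    rw [hinv γ]
    exact isBoundedAtImInfty_of_eq_ev hf hF

theorem eq_mul_of_invariant {k : ℤ} (hf : f.Conv) (hF : ∀ τ : ℍ, F τ = f.ev (qpar τ))
    (hinv : ∀ γ : SL(2, ℤ), F ∣[k] γ = F) (hk : Module.rank ℂ (ModularForm 𝒮ℒ k) = 1)
    {g : PowerSeries ℤ} (hg : g.Conv) (hg1 : PowerSeries.coeff 0 g = 1) (G : ModularForm 𝒮ℒ k)
    (hG : ∀ τ : ℍ, G τ = g.ev (qpar τ)) : f = (PowerSeries.coeff 0 f : ℤ) * g := by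
  have hG0 : G ≠ 0 := by
    rintro rfl
    have : g = 0 := hg.eq_zero_of_ev_eq_zero fun q h0 h1 => by
      obtain ⟨τ, rfl⟩ := exists_qpar_eq h0 h1
      rw [← hG]; rfl
    simp [this] at hg1
  obtain ⟨c, hc⟩ := (finrank_eq_one_iff_of_nonzero' G hG0).1
    (Module.rank_eq_one_iff_finrank_eq_one.1 hk) (modularFormOfEv k hf hF hinv)
  refine hf.eq_mul_of_ev_eq hg hg1 (c := c) fun q h0 h1 => ?_
  obtain ⟨τ, rfl⟩ := exists_qpar_eq h0 h1
  rw [← hF, ← hG]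
  have := congrArg (fun H : ModularForm 𝒮ℒ k => H τ) hc
  exact this.symm

end

end

section

open UpperHalfPlane ModularForm EisensteinSeries Derivative
open scoped MatrixGroups Manifold

theorem coeff_zero_eis (i : Fin 3) : PowerSeries.coeff 0 (eis i) = 1 := by simp [eis]

theorem slash_E₄ (γ : SL(2, ℤ)) : (E₄ : ℍ → ℂ) ∣[(4 : ℤ)] γ = E₄ :=
  E₄.slash_action_eq' _ ⟨γ, rfl⟩

theorem slash_E₆ (γ : SL(2, ℤ)) : (E₆ : ℍ → ℂ) ∣[(6 : ℤ)] γ = E₆ :=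
  E₆.slash_action_eq' _ ⟨γ, rfl⟩

theorem hasDerivAt_D2 (γ : SL(2, ℤ)) (z : ℍ) : HasDerivAt (D2 γ ∘ ofComplex)
    ((2 * Real.pi * Complex.I * (γ 1 0 : ℂ)) * (-1 * (γ 1 0 : ℂ) * (denom γ z) ^ (-2 : ℤ))) z := by
  have h := (hasDerivAt_denom_zpow (γ : GL (Fin 2) ℝ) (-1) z).const_mul
    (2 * Real.pi * Complex.I * (γ 1 0 : ℂ))
  refine (h.congr_deriv ?_).congr_of_eventuallyEq ?_
  · norm_num
  · filter_upwards [isOpen_upperHalfPlaneSet.mem_nhds z.2] with w hw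
    simp [D2, ofComplex_apply_of_im_pos hw, div_eq_mul_inv]

theorem normalizedDeriv_D2 (γ : SL(2, ℤ)) (z : ℍ) :
    D (D2 γ) z = -(γ 1 0 / denom γ z) ^ 2 := by
  rw [normalizedDerivOfComplex, (hasDerivAt_D2 γ z).deriv]
  have : (2 * Real.pi * Complex.I : ℂ) ≠ 0 := Complex.two_pi_I_ne_zero
  rw [div_pow, zpow_neg]
  field_simp

theorem D2_mdifferentiable (γ : SL(2, ℤ)) : MDiff (D2 γ) := fun z =>
  UpperHalfPlane.mdifferentiableAt_iff.2 (hasDerivAt_D2 γ z).differentiableAt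

theorem normalizedDeriv_E2_slash (γ : SL(2, ℤ)) :
    (fun z => 12 * D E2 z - E2 z ^ 2) ∣[(4 : ℤ)] γ = fun z => 12 * D E2 z - E2 z ^ 2 := by
  ext z
  have h1 := congrFun (normalizedDerivOfComplex_SL_slash (k := 2) E2_mdifferentiable (γ := γ)) z
  rw [E2_slash_action, normalizedDerivOfComplex_sub _ _ E2_mdifferentiable
    ((D2_mdifferentiable γ).const_smul _),
    normalizedDerivOfComplex_smul _ _ (D2_mdifferentiable γ)] at h1
  have h2 := congrFun (E2_slash_action γ) z
  have h4 : denom γ z ^ (-(4 : ℤ)) = denom γ z ^ (-(2 : ℤ)) * denom γ z ^ (-(2 : ℤ)) := by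
    rw [← zpow_add₀ (denom_ne_zero γ z)]; norm_num
  simp only [Pi.sub_apply, Pi.smul_apply, smul_eq_mul, normalizedDeriv_D2, D2, SL_slash_apply,
    riemannZeta_two] at h1 h2 ⊢
  have hpi : (Real.pi : ℂ) ≠ 0 := by exact_mod_cast Real.pi_ne_zero
  rw [show -((2 : ℤ) + 2) = -4 by norm_num] at h1
  have h3 : 1 / (2 * ((Real.pi : ℂ) ^ 2 / 6)) *
      (2 * Real.pi * Complex.I * (γ 1 0 : ℂ) / denom γ z) =
      6 * (Real.pi : ℂ)⁻¹ * Complex.I * (γ 1 0 / denom γ z) := by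
    field_simp
  have h5 : 12 * (D E2 (γ • z) * denom γ z ^ (-(4 : ℤ))) -
      (E2 (γ • z) * denom γ z ^ (-(2 : ℤ))) ^ 2 = 12 * D E2 z - E2 z ^ 2 := by
    rw [h2]
    have h6 : (2 * (Real.pi : ℂ) * Complex.I)⁻¹ = -(Complex.I * (Real.pi : ℂ)⁻¹) / 2 := by
      field_simp
      simp
    have h7 : 1 / (2 * ((Real.pi : ℂ) ^ 2 / 6)) = 3 * (Real.pi : ℂ)⁻¹ ^ 2 := by
      field_simp
      norm_num
    rw [h3, h6, h7] at h1
    rw [h3]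
    generalize (γ 1 0 : ℂ) / denom γ z = u at h1 ⊢
    push_cast at h1
    linear_combination (-12) * h1 + (36 * (Real.pi : ℂ)⁻¹ ^ 2 * u ^ 2) * Complex.I_sq
  rw [← h5, h4]; ring

theorem rank_weight_eight : Module.rank ℂ (ModularForm 𝒮ℒ 8) = 1 :=
  (rank_eq_one_add_rank_cuspForm (k := 8) (by norm_num) ⟨4, rfl⟩).trans
    ((congrArg (1 + ·) (CuspForm.rank_eq_zero_of_weight_lt_twelve (by norm_num))).trans
      (by norm_cast))

end

section

open UpperHalfPlane ModularForm EisensteinSeries Derivative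
open scoped MatrixGroups Manifold

theorem conv_theta_sub (a : ℤ) (i : Fin 3) :
    ((a : PowerSeries ℤ) * (eis i).theta + ((-1 : ℤ) : PowerSeries ℤ) * (eis 0 * eis i)).Conv :=
  ((PowerSeries.Conv.intCast a).mul (eis_conv i).theta).add
    ((PowerSeries.Conv.intCast (-1)).mul ((eis_conv 0).mul (eis_conv i)))

theorem ev_theta_sub (a : ℤ) (i : Fin 3) {q : ℂ} (hq : ‖q‖ < 1) :
    ((a : PowerSeries ℤ) * (eis i).theta + ((-1 : ℤ) : PowerSeries ℤ) * (eis 0 * eis i)).ev q =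
      a * (eis i).theta.ev q - (eis 0).ev q * (eis i).ev q := by
  have h0 := eis_conv 0
  have hi := eis_conv i
  rw [PowerSeries.ev_add ((PowerSeries.Conv.intCast a).mul hi.theta)
    ((PowerSeries.Conv.intCast (-1)).mul (h0.mul hi)) hq,
    PowerSeries.ev_mul (PowerSeries.Conv.intCast a) hi.theta hq,
    PowerSeries.ev_mul (PowerSeries.Conv.intCast (-1)) (h0.mul hi) hq, PowerSeries.ev_mul h0 hi hq,
    PowerSeries.ev_intCast, PowerSeries.ev_intCast]
  push_cast
  ring

theorem coeff_zero_theta_sub (a : ℤ) (i : Fin 3) : PowerSeries.coeff 0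
    ((a : PowerSeries ℤ) * (eis i).theta + ((-1 : ℤ) : PowerSeries ℤ) * (eis 0 * eis i)) = -1 := by
  have h := coeff_zero_eis
  have hθ := PowerSeries.coeff_theta (eis i) 0
  rw [PowerSeries.coeff_zero_eq_constantCoeff_apply] at hθ ⊢
  simp only [PowerSeries.coeff_zero_eq_constantCoeff_apply] at h
  simp [h, hθ]

theorem theta_eis_zero : 12 * (eis 0).theta = eis 0 ^ 2 - eis 1 := by
  have h := eq_mul_of_invariant (k := 4) (conv_theta_sub 12 0)
    (F := fun τ => 12 * D E2 τ - E2 τ ^ 2) (fun τ => by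
      rw [ev_theta_sub _ _ (norm_qpar_lt_one τ.2), ← normalizedDeriv_eq_ev (eis_conv 0) E2_eq_ev,
        ← E2_eq_ev]
      push_cast; ring) normalizedDeriv_E2_slash levelOne_weight_four_rank_one (eis_conv 1)
      (coeff_zero_eis 1) E₄ E₄_eq_ev
  rw [coeff_zero_theta_sub] at h
  push_cast at h
  linear_combination h

theorem theta_eis_one : 3 * (eis 1).theta = eis 0 * eis 1 - eis 2 := by
  have h := eq_mul_of_invariant (k := 6) (conv_theta_sub 3 1)
    (F := (3 : ℂ) • serreDerivative ((4 : ℤ) : ℂ) E₄) (fun τ => by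
      rw [ev_theta_sub _ _ (norm_qpar_lt_one τ.2), ← normalizedDeriv_eq_ev (eis_conv 1) E₄_eq_ev,
        ← E2_eq_ev, ← E₄_eq_ev, Pi.smul_apply, serreDerivative_apply, smul_eq_mul]
      push_cast; ring) (fun γ => by
      rw [SL_smul_slash]
      exact congrArg _ (serreDerivative_slash_invariant
        (mdifferentiable_of_eq_ev (eis_conv 1) E₄_eq_ev) (slash_E₄ γ)))
      levelOne_weight_six_rank_one (eis_conv 2) (coeff_zero_eis 2) E₆ E₆_eq_ev
  rw [coeff_zero_theta_sub] at h
  push_cast at h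
  linear_combination h

theorem theta_eis_two : 2 * (eis 2).theta = eis 0 * eis 2 - eis 1 ^ 2 := by
  have h := eq_mul_of_invariant (k := 8) (conv_theta_sub 2 2)
    (F := (2 : ℂ) • serreDerivative ((6 : ℤ) : ℂ) E₆) (fun τ => by
      rw [ev_theta_sub _ _ (norm_qpar_lt_one τ.2), ← normalizedDeriv_eq_ev (eis_conv 2) E₆_eq_ev,
        ← E2_eq_ev, ← E₆_eq_ev, Pi.smul_apply, serreDerivative_apply, smul_eq_mul]
      push_cast; ring) (fun γ => by
      rw [SL_smul_slash]
      exact congrArg _ (serreDerivative_slash_invariant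
        (mdifferentiable_of_eq_ev (eis_conv 2) E₆_eq_ev) (slash_E₆ γ)))
      rank_weight_eight ((eis_conv 1).mul (eis_conv 1))
      (by have := coeff_zero_eis 1
          rw [PowerSeries.coeff_zero_eq_constantCoeff_apply] at this ⊢
          simp [this]) ((E₄.mul E₄).mcast (by norm_num))
      (fun τ => by
        rw [PowerSeries.ev_mul (eis_conv 1) (eis_conv 1) (norm_qpar_lt_one τ.2), ← E₄_eq_ev]
        rfl)
  rw [coeff_zero_theta_sub] at h
  push_cast at h
  linear_combination h

/-- The derivation of `ℤ[X₀, X₁, X₂]` corresponding to `12 θ` on quasi-modular forms. -/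
noncomputable def ramanujanDerivation :
    Derivation ℤ (MvPolynomial (Fin 3) ℤ) (MvPolynomial (Fin 3) ℤ) :=
  MvPolynomial.mkDerivation ℤ ![MvPolynomial.X 0 ^ 2 - MvPolynomial.X 1,
    4 * (MvPolynomial.X 0 * MvPolynomial.X 1 - MvPolynomial.X 2),
    6 * (MvPolynomial.X 0 * MvPolynomial.X 2 - MvPolynomial.X 1 ^ 2)]

theorem theta_aeval_eis (A : MvPolynomial (Fin 3) ℤ) :
    12 * (MvPolynomial.aeval eis A).theta = MvPolynomial.aeval eis (ramanujanDerivation A) := by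
  induction A using MvPolynomial.induction_on with
  | C a =>
    simp [ramanujanDerivation, PowerSeries.theta_intCast]
  | add p q hp hq => rw [map_add, PowerSeries.theta_add, mul_add, hp, hq, map_add, map_add]
  | mul_X p i hp =>
    have hX : 12 * (eis i).theta =
        MvPolynomial.aeval eis (ramanujanDerivation (MvPolynomial.X i)) := by
      rw [ramanujanDerivation, MvPolynomial.mkDerivation_X]
      fin_cases i
      · simpa using theta_eis_zero
      · simp; linear_combination 4 * theta_eis_one
      · simp; linear_combination 6 * theta_eis_two
    rw [map_mul, PowerSeries.theta_mul, Derivation.leibniz, map_add, smul_eq_mul, smul_eq_mul,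
      map_mul, map_mul, ← hX, ← hp, MvPolynomial.aeval_X]
    ring

theorem theta_iterate_aeval_eis (A : MvPolynomial (Fin 3) ℤ) (t : ℕ) :
    12 ^ t * (PowerSeries.theta^[t] (MvPolynomial.aeval eis A)) =
      MvPolynomial.aeval eis (ramanujanDerivation^[t] A) := by
  induction t with
  | zero => simp
  | succ t ih =>
    rw [Function.iterate_succ_apply', Function.iterate_succ_apply', ← theta_aeval_eis, ← ih]
    ext n
    have h12 : (12 : PowerSeries ℤ) = PowerSeries.C 12 := by simp
    rw [h12, ← map_pow, ← map_pow, PowerSeries.coeff_C_mul, PowerSeries.coeff_theta,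
      PowerSeries.coeff_C_mul, PowerSeries.coeff_theta, PowerSeries.coeff_C_mul]
    ring

theorem qpar_S_smul (z : ℍ) : qpar (ModularGroup.S • z : ℍ) = qpar (-1 / z) := by
  rw [modular_S_smul]
  rw [UpperHalfPlane.coe_mk, inv_neg, neg_div, one_div]

theorem eis_zero_ev_S (z : ℍ) : (eis 0).ev (qpar (-1 / z)) =
    (z : ℂ) ^ 2 * (eis 0).ev (qpar z) + 6 / (Real.pi * Complex.I) * z := by
  have h := congrFun (E2_slash_action ModularGroup.S) z
  rw [SL_slash_apply, Pi.sub_apply, Pi.smul_apply, D2_S, ModularGroup.denom_S, E2_eq_ev, E2_eq_ev, qpar_S_smul,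
    riemannZeta_two, smul_eq_mul] at h
  have hz : (z : ℂ) ≠ 0 := ne_zero z
  have hpi : (Real.pi : ℂ) ≠ 0 := by exact_mod_cast Real.pi_ne_zero
  have h2 : (z : ℂ) ^ (-2 : ℤ) = ((z : ℂ) ^ 2)⁻¹ := by rw [zpow_neg]; norm_cast
  rw [h2] at h
  field_simp at h ⊢
  rw [h]
  linear_combination (-6 * (z : ℂ)) * Complex.I_sq

theorem eis_one_ev_S (z : ℍ) :
    (eis 1).ev (qpar (-1 / z)) = (z : ℂ) ^ 4 * (eis 1).ev (qpar z) := by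
  have h := congrFun (slash_E₄ ModularGroup.S) z
  rw [SL_slash_apply, ModularGroup.denom_S, E₄_eq_ev, E₄_eq_ev, qpar_S_smul] at h
  have hz : (z : ℂ) ≠ 0 := ne_zero z
  rw [← h, mul_left_comm, ← zpow_natCast, ← zpow_add₀ hz]
  simp

theorem eis_two_ev_S (z : ℍ) :
    (eis 2).ev (qpar (-1 / z)) = (z : ℂ) ^ 6 * (eis 2).ev (qpar z) := by
  have h := congrFun (slash_E₆ ModularGroup.S) z
  rw [SL_slash_apply, ModularGroup.denom_S, E₆_eq_ev, E₆_eq_ev, qpar_S_smul] at h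
  have hz : (z : ℂ) ≠ 0 := ne_zero z
  rw [← h, mul_left_comm, ← zpow_natCast, ← zpow_add₀ hz]
  simp

end

section

open PowerSeries in
theorem exists_eis_eq_one_add (i : Fin 3) :
    ∃ f : PowerSeries ℤ, eis i = 1 + X * f ∧ constantCoeff f = eisCoeff i := by
  obtain ⟨f, hf⟩ : (X : PowerSeries ℤ) ∣ eis i - 1 := by
    rw [X_dvd_iff, map_sub, ← coeff_zero_eq_constantCoeff_apply, coeff_zero_eis]
    simp
  refine ⟨f, by rw [← hf]; ring, ?_⟩
  have h := congrArg (coeff 1) hf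
  have h1 : coeff 1 (X * f) = coeff 0 f := coeff_succ_X_mul 0 f
  rw [h1, coeff_zero_eq_constantCoeff_apply] at h
  rw [← h, map_sub, coeff_one]
  simp [eis]

open PowerSeries in
/-- A nonzero isobaric polynomial in `E₄` and `E₆` vanishes at the cusp to order at most its degree
in `E₆`. -/
theorem exists_coeff_ne_zero_of_isobaric {ι : Type*} {s : Finset ι} (hs : s.Nonempty)
    {c : ι → ℤ} (hc : ∀ i ∈ s, c i ≠ 0) {a b : ι → ℕ} {W d : ℕ}
    (hW : ∀ i ∈ s, 2 * a i + 3 * b i = W) (hb : ∀ i ∈ s, b i ≤ d) (hinj : Set.InjOn b s) :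
    ∃ v ≤ d, coeff v (∑ i ∈ s, (c i : PowerSeries ℤ) * (eis 1 ^ a i * eis 2 ^ b i)) ≠ 0 := by
  classical
  obtain ⟨f, hf, hf0⟩ := exists_eis_eq_one_add 1
  obtain ⟨g, hg, hg0⟩ := exists_eis_eq_one_add 2
  have hc1 : constantCoeff (eis 1) = 1 := by
    rw [← coeff_zero_eq_constantCoeff_apply, coeff_zero_eis]
  have hc2 : constantCoeff (eis 2) = 1 := by
    rw [← coeff_zero_eq_constantCoeff_apply, coeff_zero_eis]
  obtain ⟨e, he⟩ : ∃ e, eis 1 * e = 1 :=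
    (isUnit_iff_constantCoeff.2 (by rw [hc1]; exact isUnit_one)).exists_right_inv
  set U := eis 2 ^ 2 * e ^ 3 with hU
  have hU1 : eis 1 ^ 3 * U = eis 2 ^ 2 := by
    rw [hU, mul_left_comm, ← mul_pow, he, one_pow, mul_one]
  have hcU : constantCoeff U = 1 := by
    have := congrArg constantCoeff hU1
    simpa [hc1, hc2] using this
  obtain ⟨u, hu⟩ : (X : PowerSeries ℤ) ∣ U - 1 := by
    rw [X_dvd_iff, map_sub, hcU]; simp
  have hu0 : constantCoeff u = -1728 := by
    have h1 : X * (eis 1 ^ 3 * u) =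
        X * (2 * g - 3 * f + X * (g ^ 2 - 3 * f ^ 2 - X * f ^ 3)) := by
      rw [mul_left_comm, ← hu, mul_sub, hU1, hf, hg]; ring
    have h2 := congrArg constantCoeff (mul_left_cancel₀ X_ne_zero h1)
    simp only [map_mul, map_pow, hc1, map_add, map_sub, hf0, hg0, constantCoeff_X] at h2
    rw [map_ofNat, map_ofNat] at h2
    simpa [eisCoeff] using h2
  set N := (W - 3 * (W % 2)) / 2
  have hterm : ∀ i ∈ s, eis 1 ^ a i * eis 2 ^ b i = eis 1 ^ N * eis 2 ^ (W % 2) * U ^ (b i / 2) := by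
    intro i hi
    have h := hW i hi
    have hb2 : b i = 2 * (b i / 2) + W % 2 := by omega
    have ha : N = a i + 3 * (b i / 2) := by omega
    rw [ha, pow_add, pow_mul, mul_right_comm, mul_assoc (eis 1 ^ a i), ← mul_pow, hU1, ← pow_mul,
      mul_assoc, ← pow_add, ← hb2]
  set p : Polynomial ℤ := ∑ i ∈ s, Polynomial.monomial (b i / 2) (c i)
  have hp : ∑ i ∈ s, (c i : PowerSeries ℤ) * (eis 1 ^ a i * eis 2 ^ b i) =
      eis 1 ^ N * eis 2 ^ (W % 2) * Polynomial.aeval U p := by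
    simp only [p, map_sum, Polynomial.aeval_monomial, Finset.mul_sum]
    refine Finset.sum_congr rfl fun i hi => ?_
    rw [hterm i hi]; simp; ring
  have hp0 : p ≠ 0 := by
    obtain ⟨i, hi⟩ := hs
    refine fun h => hc i hi ?_
    have := congrArg (Polynomial.coeff · (b i / 2)) h
    simp only [p, Polynomial.finsetSum_coeff, Polynomial.coeff_monomial, Polynomial.coeff_zero]
      at this
    rwa [Finset.sum_eq_single i, if_pos rfl] at this
    · intro j hj hji
      refine if_neg fun hh => hji (hinj hj hi ?_)
      have := hW i hi
      have := hW j hj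
      omega
    · exact fun h => absurd hi h
  obtain ⟨r, hr, hrd⟩ := Polynomial.exists_eq_pow_rootMultiplicity_mul_and_not_dvd p hp0 1
  set v := p.rootMultiplicity 1
  refine ⟨v, ?_, ?_⟩
  · change p.rootMultiplicity 1 ≤ d
    rw [← Polynomial.count_roots]
    refine ((Multiset.count_le_card _ _).trans (Polynomial.card_roots' p)).trans
      (Polynomial.natDegree_sum_le_of_forall_le _ _ fun i hi => ?_)
    exact (Polynomial.natDegree_monomial_le _).trans ((Nat.div_le_self _ _).trans (hb i hi))
  · have h3 : Polynomial.aeval U p = X ^ v * (u ^ v * Polynomial.aeval U r) := by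
      conv_lhs => rw [hr]
      simp only [map_mul, map_pow, map_sub, Polynomial.aeval_X, map_one, hu]
      rw [mul_pow, mul_assoc]
    have h4 : constantCoeff (Polynomial.aeval U r) = r.eval 1 := by
      have := Polynomial.hom_eval₂ r (algebraMap ℤ (PowerSeries ℤ))
        (constantCoeff (R := ℤ)) U
      rw [hcU] at this
      rw [Polynomial.aeval_def, this, Polynomial.eval₂_eq_eval_map]
      congr 1
      conv_rhs => rw [← Polynomial.map_id (p := r)]
      congr 1
    rw [hp, h3, mul_left_comm, coeff_X_pow_mul', if_pos le_rfl, Nat.sub_self,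
      coeff_zero_eq_constantCoeff_apply]
    simp only [map_mul, map_pow, hc1, hc2, one_pow, one_mul, hu0, h4]
    refine mul_ne_zero (pow_ne_zero _ (by norm_num)) fun h => hrd ?_
    exact Polynomial.dvd_iff_isRoot.2 h

end

section

open Polynomial in
theorem norm_coeff_lagrange_basis_le {K : ℕ} {w : ℕ → ℂ}
    (hw : ∀ i ≤ K, ∀ j ≤ K, i ≠ j → 1 ≤ ‖w i - w j‖) (hw' : ∀ i ≤ K, ‖w i‖ ≤ K + 2) {j : ℕ}
    (hj : j ≤ K) (s : ℕ) :
    ‖(Lagrange.basis (Finset.range (K + 1)) w j).coeff s‖ ≤ (K + 3 : ℝ) ^ K := by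
  have key : ∀ S : Finset ℕ, S ⊆ (Finset.range (K + 1)).erase j → ∀ s,
      ‖(∏ i ∈ S, Lagrange.basisDivisor (w j) (w i)).coeff s‖ ≤ (K + 3 : ℝ) ^ S.card := by
    intro S
    induction S using Finset.induction_on with
    | empty =>
      intro _ s
      rw [Finset.prod_empty, coeff_one]
      split_ifs <;> simp
    | insert a S ha ih =>
      intro hS s
      have ih' := ih ((Finset.subset_insert _ _).trans hS)
      have haK : a ≠ j ∧ a ≤ K := by
        have := hS (Finset.mem_insert_self a S)
        simpa [Nat.lt_succ_iff] using this
      rw [Finset.prod_insert ha, Finset.card_insert_of_notMem ha, Lagrange.basisDivisor,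
        mul_assoc, coeff_C_mul, sub_mul, coeff_sub, coeff_C_mul, norm_mul, norm_inv, pow_succ']
      have h1 : ‖w j - w a‖⁻¹ ≤ 1 := inv_le_one_of_one_le₀ (hw j hj a haK.2 haK.1.symm)
      set G := ∏ i ∈ S, Lagrange.basisDivisor (w j) (w i)
      have h2 : ‖(X * G).coeff s‖ ≤ (K + 3 : ℝ) ^ S.card := by
        cases s with
        | zero => simp; positivity
        | succ s => rw [coeff_X_mul]; exact ih' s
      have h3 : ‖(X * G).coeff s - w a * G.coeff s‖ ≤ (K + 3) * (K + 3 : ℝ) ^ S.card := by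
        refine (norm_sub_le _ _).trans ?_
        rw [norm_mul]
        have := mul_le_mul (hw' a haK.2) (ih' s) (norm_nonneg _) (by positivity)
        nlinarith
      exact (mul_le_of_le_one_left (norm_nonneg _) h1).trans h3
  have := key _ subset_rfl s
  rwa [Finset.card_erase_of_mem (Finset.mem_range.2 (by omega)), Finset.card_range,
    Nat.add_sub_cancel] at this

open Polynomial in
theorem norm_coeff_le_of_norm_eval_le {K : ℕ} {w : ℕ → ℂ}
    (hw : ∀ i ≤ K, ∀ j ≤ K, i ≠ j → 1 ≤ ‖w i - w j‖) (hw' : ∀ i ≤ K, ‖w i‖ ≤ K + 2)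
    {P : ℂ[X]} (hP : P.natDegree ≤ K) {ε : ℝ} (hε : ∀ j ≤ K, ‖P.eval (w j)‖ ≤ ε) (s : ℕ) :
    ‖P.coeff s‖ ≤ (K + 1) * (K + 3) ^ K * ε := by
  have hinj : Set.InjOn w (Finset.range (K + 1)) := by
    intro i hi j hj hij
    by_contra hne
    have := hw i (by simpa [Nat.lt_succ_iff] using hi) j (by simpa [Nat.lt_succ_iff] using hj) hne
    rw [hij, sub_self, norm_zero] at this
    linarith
  have hdeg : P.degree < (Finset.range (K + 1)).card := by
    rw [Finset.card_range]
    exact degree_le_natDegree.trans_lt (by exact_mod_cast Nat.lt_succ_of_le hP)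
  have hcoeff : P.coeff s = ∑ j ∈ Finset.range (K + 1),
      P.eval (w j) * (Lagrange.basis (Finset.range (K + 1)) w j).coeff s := by
    conv_lhs => rw [Lagrange.eq_interpolate hinj hdeg, Lagrange.interpolate_apply]
    simp [finsetSum_coeff]
  rw [hcoeff]
  calc _ ≤ ∑ j ∈ Finset.range (K + 1), ε * (K + 3 : ℝ) ^ K := by
        refine norm_sum_le_of_le _ fun j hj => ?_
        have hj' : j ≤ K := by simpa [Nat.lt_succ_iff] using hj
        rw [norm_mul]
        exact mul_le_mul (hε j hj') (norm_coeff_lagrange_basis_le hw hw' hj' s) (norm_nonneg _)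
          ((norm_nonneg _).trans (hε j hj'))
    _ = _ := by simp; ring

namespace PowerSeries

theorem Conv.norm_ev_zero_le {f : PowerSeries ℤ} (hf : f.Conv) {ρ δ : ℝ} (h0 : 0 < ρ) (h1 : ρ < 1)
    (hδ : ∀ q : ℂ, ‖q‖ = ρ → ‖f.ev q‖ ≤ δ) : |((coeff 0 f : ℤ) : ℝ)| ≤ δ := by
  have hsub : Metric.closedBall (0 : ℂ) ρ ⊆ Metric.ball 0 1 := Metric.closedBall_subset_ball h1
  have hd : DiffContOnCl ℂ f.ev (Metric.ball 0 ρ) :=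
    DifferentiableOn.diffContOnCl (hf.differentiableOn.mono (by
      rwa [closure_ball _ h0.ne']))
  have h := Complex.norm_le_of_forall_mem_frontier_norm_le Metric.isBounded_ball hd (C := δ)
    (fun z hz => hδ z (by rw [frontier_ball _ h0.ne'] at hz; simpa using hz)) (z := 0)
    (subset_closure (Metric.mem_ball_self h0))
  simpa [ev_zero_arg] using h

/-- A power series with integer coefficients that is small on a circle vanishes to high order. -/
theorem Conv.coeff_eq_zero_of_norm_ev_le {f : PowerSeries ℤ} (hf : f.Conv) {ρ δ : ℝ} (h0 : 0 < ρ)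
    (h1 : ρ < 1) (hδ : ∀ q : ℂ, ‖q‖ = ρ → ‖f.ev q‖ ≤ δ) (m : ℕ) (hm : δ < ρ ^ m) :
    coeff m f = 0 := by
  induction m using Nat.strong_induction_on with
  | _ m ih =>
    have hlow : ∀ k < m, coeff k f = 0 := fun k hk =>
      ih k hk (hm.trans_le (pow_le_pow_of_le_one h0.le h1.le hk.le))
    have hsh := (hf.shift m).norm_ev_zero_le h0 h1 (δ := δ / ρ ^ m) fun q hq => by
      have := hδ q hq
      rw [ev_eq_pow_mul_ev_shift hf hlow (by rw [hq]; exact h1), norm_mul, norm_pow, hq] at this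
      rw [le_div_iff₀ (by positivity)]
      linarith
    have hlt : |((coeff m f : ℤ) : ℝ)| < 1 := by
      have : δ / ρ ^ m < 1 := (div_lt_one (by positivity)).2 hm
      rw [PowerSeries.shift, coeff_mk, zero_add] at hsh
      exact hsh.trans_lt this
    rw [← Int.cast_abs] at hlt
    exact Int.abs_lt_one_iff.1 (by exact_mod_cast hlt)

end PowerSeries

end

section

section
open Polynomial

/-- The polynomial in `w` whose value at `w` is `A(x w² + κ w, y w⁴, z w⁶)`. -/
noncomputable def transformPoly (A : MvPolynomial (Fin 3) ℤ) (v : Fin 3 → ℂ) (κ : ℂ) : ℂ[X] :=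
  MvPolynomial.aeval ![C (v 0) * X ^ 2 + C κ * X, C (v 1) * X ^ 4, C (v 2) * X ^ 6] A

theorem transformPoly_eq_sum (A : MvPolynomial (Fin 3) ℤ) (v : Fin 3 → ℂ) (κ : ℂ) :
    transformPoly A v κ = ∑ m ∈ A.support, ((A.coeff m : ℤ) : ℂ[X]) *
      ((C (v 0) * X + C κ) ^ m 0 * C (v 1 ^ m 1 * v 2 ^ m 2) * X ^ (m 0 + 4 * m 1 + 6 * m 2)) := by
  rw [transformPoly, MvPolynomial.aeval_fin_three]
  refine Finset.sum_congr rfl fun m _ => ?_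
  simp only [Matrix.cons_val_zero, Matrix.cons_val_one, Matrix.cons_val]
  rw [show C (v 0) * X ^ 2 + C κ * X = (C (v 0) * X + C κ) * X by ring]
  simp only [mul_pow, map_mul, map_pow]
  ring

theorem eval_transformPoly (A : MvPolynomial (Fin 3) ℤ) (v : Fin 3 → ℂ) (κ w : ℂ) :
    (transformPoly A v κ).eval w =
      MvPolynomial.aeval ![w ^ 2 * v 0 + κ * w, w ^ 4 * v 1, w ^ 6 * v 2] A := by
  rw [transformPoly, MvPolynomial.aeval_fin_three, MvPolynomial.aeval_fin_three, eval_finsetSum]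
  refine Finset.sum_congr rfl fun m _ => ?_
  simp
  left
  ring

theorem natDegree_C_mul_X_add_C_pow_le (x κ : ℂ) (a : ℕ) :
    ((C x * X + C κ) ^ a).natDegree ≤ a :=
  natDegree_pow_le_of_le a natDegree_linear_le |>.trans (by simp)

theorem natDegree_transform_term_le (x κ y : ℂ) (a b : ℕ) :
    ((C x * X + C κ) ^ a * C y * X ^ b).natDegree ≤ a + b := by
  refine natDegree_mul_le.trans (add_le_add (natDegree_mul_le.trans ?_) (natDegree_X_pow_le b))
  simpa using natDegree_C_mul_X_add_C_pow_le x κ a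

theorem natDegree_transformPoly_le {A : MvPolynomial (Fin 3) ℤ} {d : ℕ} (hd : A.totalDegree ≤ d)
    (v : Fin 3 → ℂ) (κ : ℂ) : (transformPoly A v κ).natDegree ≤ 6 * d := by
  rw [transformPoly_eq_sum]
  refine natDegree_sum_le_of_forall_le _ _ fun m hm => ?_
  have h := Finsupp.sum_le_of_mem_support_fin_three hm hd
  rw [← C_eq_intCast]
  refine (natDegree_C_mul_le _ _).trans ((natDegree_transform_term_le _ _ _ _ _).trans ?_)
  omega

theorem coeff_transformPoly (A : MvPolynomial (Fin 3) ℤ) (v : Fin 3 → ℂ) (κ : ℂ) (s : ℕ) :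
    (transformPoly A v κ).coeff s = ∑ m ∈ A.support, ((A.coeff m : ℤ) : ℂ) *
      ((C (v 0) * X + C κ) ^ m 0 * C (v 1 ^ m 1 * v 2 ^ m 2) *
        X ^ (m 0 + 4 * m 1 + 6 * m 2)).coeff s := by
  rw [transformPoly_eq_sum, finsetSum_coeff]
  simp only [← C_eq_intCast, coeff_C_mul]

theorem coeff_transform_term_top (x κ y : ℂ) (a b : ℕ) :
    ((C x * X + C κ) ^ a * C y * X ^ b).coeff (a + b) = x ^ a * y := by
  have h := coeff_pow_of_natDegree_le (m := a) (natDegree_linear_le (a := x) (b := κ))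
  rw [mul_one] at h
  rw [coeff_mul_X_pow, coeff_mul_C, h]
  simp

theorem coeff_transform_term_bot (x κ y : ℂ) (a b : ℕ) :
    ((C x * X + C κ) ^ a * C y * X ^ b).coeff b = κ ^ a * y := by
  rw [coeff_mul_X_pow', if_pos le_rfl, Nat.sub_self, coeff_mul_C, coeff_zero_eq_eval_zero]
  simp

end

theorem qpar_add_natCast (z : ℂ) (j : ℕ) : qpar (z + j) = qpar z := by
  have : 2 * Real.pi * Complex.I * (z + j) = 2 * Real.pi * Complex.I * z +
      j * (2 * Real.pi * Complex.I) := by ring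
  rw [qpar, this, Complex.exp_add, Complex.exp_nat_mul_two_pi_mul_I, mul_one, qpar]

theorem aeval_eis_ev_S (A : MvPolynomial (Fin 3) ℤ) {τ : ℂ} (hτ : 0 < τ.im) (j : ℕ) :
    (MvPolynomial.aeval eis A).ev (qpar (-1 / (τ + j))) =
      (transformPoly A (fun i => (eis i).ev (qpar τ)) (6 / (Real.pi * Complex.I))).eval (τ + j) := by
  have him : 0 < (τ + j).im := by simpa using hτ
  have hS : 0 < (-1 / (τ + j)).im := by
    have := (ModularGroup.S • (⟨τ + j, him⟩ : UpperHalfPlane)).im_pos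
    rw [← UpperHalfPlane.coe_im, UpperHalfPlane.modular_S_smul] at this
    rwa [neg_div, one_div, ← inv_neg]
  rw [PowerSeries.ev_aeval eis_conv A (norm_qpar_lt_one hS), eval_transformPoly]
  congr 1
  congr 1
  have h0 := eis_zero_ev_S ⟨τ + j, him⟩
  have h1 := eis_one_ev_S ⟨τ + j, him⟩
  have h2 := eis_two_ev_S ⟨τ + j, him⟩
  simp only [qpar_add_natCast] at h0 h1 h2
  funext i
  fin_cases i
  · simpa using h0
  · simpa using h1
  · simpa using h2

theorem norm_qpar_neg_one_div_le {w : ℂ} {N : ℝ} (hw : w.im = 1) (hN : ‖w‖ ≤ N) (hN0 : 0 < N) :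
    ‖qpar (-1 / w)‖ ≤ Real.exp (-(3 / N ^ 2)) * Real.exp (-(3 / N ^ 2)) := by
  have hw0 : w ≠ 0 := fun h => by simp [h] at hw
  have hpos : 0 < ‖w‖ := norm_pos_iff.2 hw0
  have him : (-1 / w).im = 1 / ‖w‖ ^ 2 := by
    rw [neg_div, one_div, Complex.neg_im, Complex.inv_im, hw, Complex.normSq_eq_norm_sq]
    ring
  rw [norm_qpar, him, ← Real.exp_add, Real.exp_le_exp]
  have h1 : 1 / N ^ 2 ≤ 1 / ‖w‖ ^ 2 := by gcongr
  have h2 := Real.pi_gt_three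
  have h3 : 0 < 1 / N ^ 2 := by positivity
  have h4 : 3 / N ^ 2 = 3 * (1 / N ^ 2) := by ring
  rw [h4]
  nlinarith

theorem norm_coeff_transformPoly_le {A : MvPolynomial (Fin 3) ℤ} {d M : ℕ}
    (hd : A.totalDegree ≤ d) (hM : ∀ m < M, PowerSeries.coeff m (MvPolynomial.aeval eis A) = 0)
    {τ : ℂ} (him : τ.im = 1) (h0 : 0 ≤ τ.re) (h1 : τ.re ≤ 1) (s : ℕ) :
    ‖(transformPoly A (fun i => (eis i).ev (qpar τ)) (6 / (Real.pi * Complex.I))).coeff s‖ ≤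
      (6 * d + 1) * (6 * d + 3) ^ (6 * d) * (Real.exp (-(3 / (6 * d + 2 : ℝ) ^ 2)) ^ M *
        (A.len * (362880 * (6 * d + 2 : ℝ) ^ 14) ^ d)) := by
  have hN : (2 : ℝ) ≤ 6 * d + 2 := by linarith [(Nat.cast_nonneg d : (0 : ℝ) ≤ d)]
  set N : ℝ := 6 * d + 2
  set r : ℝ := Real.exp (-(3 / N ^ 2))
  have hw' : ∀ i ≤ 6 * d, ‖τ + i‖ ≤ N := fun i hi => by
    have hi' : (i : ℝ) ≤ 6 * d := by exact_mod_cast hi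
    refine (Complex.norm_le_abs_re_add_abs_im _).trans ?_
    simp only [Complex.add_re, Complex.natCast_re, Complex.add_im, Complex.natCast_im, him]
    rw [abs_of_nonneg (by positivity)]
    norm_num
    simp only [N]
    linarith
  have hr1 : 1 / N ^ 2 ≤ 1 - r := by
    have h3 : 3 / N ^ 2 ≤ 1 := by rw [div_le_one (by positivity)]; nlinarith
    have h4 := Real.add_one_le_exp (3 / N ^ 2)
    have h5 : r * Real.exp (3 / N ^ 2) = 1 := by rw [← Real.exp_add]; simp
    have h6 : 0 < r := Real.exp_pos _
    have h7 : 1 / N ^ 2 = (3 / N ^ 2) / 3 := by ring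
    rw [h7]
    have h8 : 0 ≤ 3 / N ^ 2 := by positivity
    generalize 3 / N ^ 2 = y at *
    have : r * (y + 1) ≤ 1 := by nlinarith
    nlinarith
  have hr : r < 1 := by
    have : 0 < 1 / N ^ 2 := by positivity
    linarith
  have hB : ∀ i, (eis i).WBound r (362880 * N ^ 14) := fun i =>
    (eis_wBound i (Real.exp_pos _).le hr).mono (by
      have : (1 - r)⁻¹ ≤ N ^ 2 := by
        rw [one_div] at hr1
        exact inv_le_of_inv_le₀ (by positivity) hr1
      have h14 : (1 - r)⁻¹ ^ 7 ≤ (N ^ 2) ^ 7 := by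
        have : 0 ≤ (1 - r)⁻¹ := inv_nonneg.2 (by linarith)
        gcongr
      rw [div_eq_mul_inv, ← inv_pow]
      calc _ ≤ 362880 * (N ^ 2) ^ 7 := by gcongr
        _ = _ := by ring)
  have hB1 : 1 ≤ 362880 * N ^ 14 := by
    have : 1 ≤ N ^ 14 := one_le_pow₀ (by linarith)
    linarith
  have key := norm_coeff_le_of_norm_eval_le (K := 6 * d) (w := fun j => τ + j) (fun i _ j _ hij => by
      rw [add_sub_add_left_eq_sub]
      have : ((i : ℂ) - j) = (((i : ℤ) - j : ℤ) : ℂ) := by push_cast; rfl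
      rw [this, Complex.norm_intCast]
      have h : (i : ℤ) - j ≠ 0 := by omega
      exact_mod_cast Int.one_le_abs h) (fun i hi => by simpa [N] using hw' i hi)
    (natDegree_transformPoly_le hd (fun i => (eis i).ev (qpar τ)) (6 / (Real.pi * Complex.I)))
    (ε := r ^ M * (A.len * (362880 * N ^ 14) ^ d)) (fun j hj => by
      rw [← aeval_eis_ev_S A (by rw [him]; exact one_pos)]
      have hq := norm_qpar_neg_one_div_le (w := τ + j) (by simpa using him) (hw' j hj) (by linarith)
      have hlen : 0 ≤ A.len := A.len_nonneg
      refine ((PowerSeries.WBound.aeval (Real.exp_pos _).le hB1 hB hd).norm_ev_le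
        (Real.exp_pos _) (hq.trans (mul_le_of_le_one_left (Real.exp_pos _).le hr.le)) hM).trans ?_
      gcongr
      rw [div_le_iff₀ (Real.exp_pos _)]
      exact hq) s
  push_cast at key
  exact key

end

section

open Filter in
theorem eventually_pow_le_exp_sq : ∀ᶠ d : ℕ in atTop,
    (6 * d + 1 : ℝ) * (6 * d + 3) ^ (6 * d) * (362880 * (6 * d + 2 : ℝ) ^ 14) ^ d ≤
      Real.exp (d ^ 2) := by
  have h1 : ∀ᶠ x : ℝ in atTop, Real.log x ≤ (1 / 243) * x := by
    have := Real.isLittleO_log_id_atTop.bound (c := 1 / 243) (by norm_num)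
    filter_upwards [this, eventually_ge_atTop 0] with x hx h0
    simp only [id, Real.norm_eq_abs, abs_of_nonneg h0] at hx
    exact (le_abs_self _).trans hx
  have h2 : Tendsto (fun d : ℕ => (9 * d : ℝ)) atTop atTop :=
    tendsto_natCast_atTop_atTop.const_mul_atTop (by norm_num)
  filter_upwards [h2.eventually h1, eventually_ge_atTop 1] with d hd hd1
  have hd1' : (1 : ℝ) ≤ d := by exact_mod_cast hd1
  have h9 : (362880 : ℝ) ≤ (9 * d : ℝ) ^ 6 := by
    calc (362880 : ℝ) ≤ 9 ^ 6 := by norm_num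
      _ ≤ (9 * d : ℝ) ^ 6 := by gcongr; linarith
  calc (6 * d + 1 : ℝ) * (6 * d + 3) ^ (6 * d) * (362880 * (6 * d + 2 : ℝ) ^ 14) ^ d
      ≤ (9 * d : ℝ) ^ d * (9 * d : ℝ) ^ (6 * d) * ((9 * d : ℝ) ^ 6 * (9 * d : ℝ) ^ 14) ^ d := by
        gcongr
        · calc (6 * d + 1 : ℝ) ≤ (9 * d : ℝ) ^ 1 := by linarith
            _ ≤ (9 * d : ℝ) ^ d := pow_le_pow_right₀ (by linarith) hd1
        · linarith
        · linarith
    _ = (9 * d : ℝ) ^ (27 * d) := by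
        rw [← pow_add, ← pow_add, ← pow_mul, ← pow_add]
        congr 1
        ring
    _ = Real.exp (27 * d * Real.log (9 * d : ℝ)) := by
        rw [← Real.rpow_natCast, Real.rpow_def_of_pos (by positivity)]
        push_cast
        ring_nf
    _ ≤ _ := by
        rw [Real.exp_le_exp]
        nlinarith

theorem exists_qpar_eq_of_norm_eq {q : ℂ} (hq : ‖q‖ = Real.exp (-(2 * Real.pi))) :
    ∃ τ : ℂ, τ.im = 1 ∧ 0 ≤ τ.re ∧ τ.re ≤ 1 ∧ qpar τ = q := by
  obtain ⟨τ, rfl⟩ := exists_qpar_eq (norm_pos_iff.1 (by rw [hq]; positivity))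
    (by rw [hq, Real.exp_lt_one_iff]; linarith [Real.pi_pos])
  refine ⟨τ - ⌊(τ : ℂ).re⌋, ?_, ?_, ?_, ?_⟩
  · rw [norm_qpar, Real.exp_eq_exp] at hq
    have := Real.pi_pos
    simp only [Complex.sub_im, Complex.intCast_im, sub_zero]
    nlinarith
  · simp
  · have := Int.lt_floor_add_one (τ : ℂ).re
    simp only [Complex.sub_re, Complex.intCast_re]
    linarith
  · have : 2 * Real.pi * Complex.I * ((τ : ℂ) - ⌊(τ : ℂ).re⌋) = 2 * Real.pi * Complex.I * τ -
      ⌊(τ : ℂ).re⌋ * (2 * Real.pi * Complex.I) := by ring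
    rw [qpar, this, Complex.exp_sub, Complex.exp_int_mul_two_pi_mul_I, div_one, qpar]

theorem coeff_eq_zero_of_norm_le_transformPoly {A : MvPolynomial (Fin 3) ℤ} {d M : ℕ}
    (hC : (6 * d + 1 : ℝ) * (6 * d + 3) ^ (6 * d) * (362880 * (6 * d + 2 : ℝ) ^ 14) ^ d ≤
      Real.exp (d ^ 2)) (hd : A.totalDegree ≤ d) (hlen : A.len ≤ Real.exp (d ^ 2))
    (hM : ∀ m < M, PowerSeries.coeff m (MvPolynomial.aeval eis A) = 0)
    {g : PowerSeries ℤ} (hg : g.Conv) {s : ℕ} (hgs : ∀ τ : ℂ, τ.im = 1 → ‖g.ev (qpar τ)‖ ≤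
      ‖(transformPoly A (fun i => (eis i).ev (qpar τ)) (6 / (Real.pi * Complex.I))).coeff s‖)
    {m : ℕ} (hm : 7 * (m : ℝ) + 2 * d ^ 2 < 3 * M / (6 * d + 2) ^ 2) :
    PowerSeries.coeff m g = 0 := by
  refine hg.coeff_eq_zero_of_norm_ev_le (ρ := Real.exp (-(2 * Real.pi))) (Real.exp_pos _)
    (by rw [Real.exp_lt_one_iff]; linarith [Real.pi_pos])
    (δ := Real.exp (2 * d ^ 2 - 3 * M / (6 * d + 2) ^ 2)) (fun q hq => ?_) m ?_
  · obtain ⟨τ, him, h0, h1, rfl⟩ := exists_qpar_eq_of_norm_eq hq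
    refine ((hgs τ him).trans (norm_coeff_transformPoly_le hd hM him h0 h1 s)).trans ?_
    calc _ = ((6 * d + 1 : ℝ) * (6 * d + 3) ^ (6 * d) * (362880 * (6 * d + 2 : ℝ) ^ 14) ^ d) *
          A.len * Real.exp (-(3 / (6 * d + 2 : ℝ) ^ 2)) ^ M := by ring
      _ ≤ Real.exp (d ^ 2) * Real.exp (d ^ 2) * Real.exp (-(3 / (6 * d + 2 : ℝ) ^ 2)) ^ M := by
          have := A.len_nonneg
          gcongr
      _ = _ := by
          rw [← Real.exp_nat_mul, ← Real.exp_add, ← Real.exp_add]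
          congr 1
          ring
  · rw [← Real.exp_nat_mul, Real.exp_lt_exp]
    have h1 := Real.pi_lt_d2
    have h2 : (0 : ℝ) ≤ m := Nat.cast_nonneg m
    nlinarith

namespace MvPolynomial

/-- The part of `A` supported on the monomials in `s`. -/
noncomputable def part (A : MvPolynomial (Fin 3) ℤ) (s : Finset (Fin 3 →₀ ℕ)) :
    MvPolynomial (Fin 3) ℤ := ∑ m ∈ s, monomial m (A.coeff m)

theorem coeff_part (A : MvPolynomial (Fin 3) ℤ) (s : Finset (Fin 3 →₀ ℕ)) (m : Fin 3 →₀ ℕ) :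
    (A.part s).coeff m = if m ∈ s then A.coeff m else 0 := by
  classical
  simp [part, coeff_sum, coeff_monomial]

theorem support_part {A : MvPolynomial (Fin 3) ℤ} {s : Finset (Fin 3 →₀ ℕ)} (hs : s ⊆ A.support) :
    (A.part s).support = s := by
  ext m
  rw [mem_support_iff, coeff_part]
  split_ifs with h
  · simpa [h] using mem_support_iff.1 (hs h)
  · simp [h]

theorem totalDegree_part_le {A : MvPolynomial (Fin 3) ℤ} {s : Finset (Fin 3 →₀ ℕ)}
    (hs : s ⊆ A.support) : (A.part s).totalDegree ≤ A.totalDegree := by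
  rw [totalDegree, support_part hs]
  exact Finset.sup_mono hs

theorem len_part_le {A : MvPolynomial (Fin 3) ℤ} {s : Finset (Fin 3 →₀ ℕ)}
    (hs : s ⊆ A.support) : (A.part s).len ≤ A.len := by
  rw [len, support_part hs, len]
  refine (Finset.sum_le_sum fun m hm => ?_).trans
    (Finset.sum_le_sum_of_subset_of_nonneg hs fun _ _ _ => abs_nonneg _)
  rw [coeff_part, if_pos hm]

end MvPolynomial

end

section

open MvPolynomial in
theorem transformPoly_coeff_top {A : MvPolynomial (Fin 3) ℤ} {k : ℕ}
    (hk : ∀ m ∈ A.support, 2 * m 0 + 4 * m 1 + 6 * m 2 ≤ k) (v : Fin 3 → ℂ) (κ : ℂ) :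
    (transformPoly A v κ).coeff k =
      aeval v (A.part (A.support.filter fun m => 2 * m 0 + 4 * m 1 + 6 * m 2 = k)) := by
  rw [coeff_transformPoly, aeval_fin_three, support_part (Finset.filter_subset _ _),
    Finset.sum_filter]
  refine Finset.sum_congr rfl fun m hm => ?_
  split_ifs with h
  · rw [coeff_part, if_pos (Finset.mem_filter.2 ⟨hm, h⟩),
      show k = m 0 + (m 0 + 4 * m 1 + 6 * m 2) by omega, coeff_transform_term_top]
    ring
  · rw [Polynomial.coeff_eq_zero_of_natDegree_lt, mul_zero]
    refine (natDegree_transform_term_le _ _ _ _ _).trans_lt ?_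
    have := hk m hm
    omega

open MvPolynomial in
theorem transformPoly_coeff_bot {A : MvPolynomial (Fin 3) ℤ} {k p : ℕ}
    (hk : ∀ m ∈ A.support, 2 * m 0 + 4 * m 1 + 6 * m 2 = k) (hp : ∀ m ∈ A.support, m 0 ≤ p)
    (hpk : p ≤ k) (v : Fin 3 → ℂ) (κ : ℂ) :
    (transformPoly A v κ).coeff (k - p) = κ ^ p * ∑ m ∈ A.support.filter fun m => m 0 = p,
      ((A.coeff m : ℤ) : ℂ) * (v 1 ^ m 1 * v 2 ^ m 2) := by
  rw [coeff_transformPoly, Finset.mul_sum, Finset.sum_filter]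
  refine Finset.sum_congr rfl fun m hm => ?_
  have h1 := hk m hm
  have h2 := hp m hm
  split_ifs with h
  · rw [show k - p = m 0 + 4 * m 1 + 6 * m 2 by omega, coeff_transform_term_bot, h]
    ring
  · rw [Polynomial.coeff_mul_X_pow', if_neg (by omega), mul_zero]

theorem lt_div_of_mul_lt {d a M : ℝ} (hd : 200 ≤ d) (ha : 0 ≤ a)
    (h : 49 * d ^ 2 * (7 * a + 2 * d ^ 2) < 3 * M) :
    7 * a + 2 * d ^ 2 < 3 * M / (6 * d + 2) ^ 2 := by
  rw [lt_div_iff₀ (by positivity)]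
  have h1 : (6 * d + 2) ^ 2 ≤ 49 * d ^ 2 := by nlinarith
  have h2 : 0 ≤ 7 * a + 2 * d ^ 2 := by positivity
  nlinarith [mul_le_mul_of_nonneg_left h1 h2]

open MvPolynomial Filter in
/-- Zero estimate: a nonzero integer polynomial of degree `d` and moderate height in `E₂, E₄, E₆`
vanishes at the cusp to order less than `d ^ 8`. -/
theorem eventually_exists_coeff_ne_zero : ∀ᶠ d : ℕ in atTop, ∀ A : MvPolynomial (Fin 3) ℤ,
    A ≠ 0 → A.totalDegree ≤ d → A.len ≤ Real.exp (d ^ 2) →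
      ∃ m < d ^ 8, PowerSeries.coeff m (aeval eis A) ≠ 0 := by
  filter_upwards [eventually_pow_le_exp_sq, eventually_ge_atTop 200] with d hC hd200 A hA hd hlen
  have hd' : (200 : ℝ) ≤ d := by exact_mod_cast hd200
  by_contra! hM
  -- restrict to the component of highest weight
  obtain ⟨m₁, hm₁, hmax₁⟩ := A.support.exists_max_image (fun m => 2 * m 0 + 4 * m 1 + 6 * m 2)
    (support_nonempty.2 hA)
  set k := 2 * m₁ 0 + 4 * m₁ 1 + 6 * m₁ 2
  set s := A.support.filter fun m => 2 * m 0 + 4 * m 1 + 6 * m 2 = k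
  have hs : s ⊆ A.support := Finset.filter_subset _ _
  have hsupp := support_part hs
  have hM₁ : ∀ m < d ^ 5, PowerSeries.coeff m (aeval eis (A.part s)) = 0 := by
    intro m hm
    refine coeff_eq_zero_of_norm_le_transformPoly hC hd hlen hM (PowerSeries.Conv.aeval eis_conv _)
      (s := k) (fun τ him => ?_) (lt_div_of_mul_lt hd' (Nat.cast_nonneg _) ?_)
    · rw [transformPoly_coeff_top hmax₁, PowerSeries.ev_aeval eis_conv _
        (norm_qpar_lt_one (by rw [him]; exact one_pos))]
    · have : (m : ℝ) ≤ d ^ 5 := by exact_mod_cast hm.le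
      push_cast
      calc 49 * (d : ℝ) ^ 2 * (7 * m + 2 * d ^ 2) ≤ 49 * (d : ℝ) ^ 2 * (7 * d ^ 5 + 2 * d ^ 2) := by
            gcongr
        _ ≤ 441 * (d : ℝ) ^ 7 := by
            have : (d : ℝ) ^ 4 ≤ d ^ 7 := pow_le_pow_right₀ (by linarith) (by norm_num)
            nlinarith
        _ < 3 * (d : ℝ) ^ 8 := by
            have : 0 < (d : ℝ) ^ 7 := by positivity
            nlinarith
  have hdeg₁ : (A.part s).totalDegree ≤ d := (totalDegree_part_le hs).trans hd
  have hlen₁ : (A.part s).len ≤ Real.exp (d ^ 2) := (len_part_le hs).trans hlen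
  -- restrict further to the component of highest degree in `E₂`
  obtain ⟨m₂, hm₂, hmax₂⟩ := (A.part s).support.exists_max_image (fun m => m 0)
    (by rw [hsupp]; exact ⟨m₁, Finset.mem_filter.2 ⟨hm₁, rfl⟩⟩)
  set p := m₂ 0
  have hk : ∀ m ∈ (A.part s).support, 2 * m 0 + 4 * m 1 + 6 * m 2 = k := fun m hm => by
    rw [hsupp] at hm
    exact (Finset.mem_filter.1 hm).2
  have hpk : p ≤ k := by have := hk m₂ hm₂; omega
  set t := (A.part s).support.filter fun m => m 0 = p
  set G : MvPolynomial (Fin 3) ℤ := ∑ m ∈ t, C ((A.part s).coeff m) * (X 1 ^ m 1 * X 2 ^ m 2)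
  have hG : aeval eis G =
      ∑ m ∈ t, (((A.part s).coeff m : ℤ) : PowerSeries ℤ) * (eis 1 ^ m 1 * eis 2 ^ m 2) := by
    simp [G]
  obtain ⟨v, hv, hne⟩ := exists_coeff_ne_zero_of_isobaric (s := t) (W := k / 2 - p) (d := d)
    ⟨m₂, Finset.mem_filter.2 ⟨hm₂, rfl⟩⟩ (c := fun m => (A.part s).coeff m)
    (fun m hm => mem_support_iff.1 (Finset.mem_filter.1 hm).1) (a := fun m => m 1)
    (b := fun m => m 2) (fun m hm => by
      have h1 := hk m (Finset.mem_filter.1 hm).1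
      have h2 := (Finset.mem_filter.1 hm).2
      omega)
    (fun m hm => by
      have := Finsupp.sum_le_of_mem_support_fin_three (Finset.mem_filter.1 hm).1 hdeg₁
      omega)
    (fun m hm m' hm' (h : m 2 = m' 2) => by
      have h1 := hk m (Finset.mem_filter.1 hm).1
      have h2 := (Finset.mem_filter.1 hm).2
      have h1' := hk m' (Finset.mem_filter.1 hm').1
      have h2' := (Finset.mem_filter.1 hm').2
      ext i
      fin_cases i
      · exact h2.trans h2'.symm
      · change m 1 = m' 1
        omega
      · exact h)
  rw [← hG] at hne
  refine hne (coeff_eq_zero_of_norm_le_transformPoly hC hdeg₁ hlen₁ hM₁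
    (PowerSeries.Conv.aeval eis_conv _) (s := k - p) (fun τ him => ?_) (lt_div_of_mul_lt hd' (Nat.cast_nonneg _) ?_))
  · rw [transformPoly_coeff_bot hk hmax₂ hpk, PowerSeries.ev_aeval eis_conv _
        (norm_qpar_lt_one (by rw [him]; exact one_pos)), norm_mul]
    refine le_of_eq_of_le (b := 1 * ‖∑ m ∈ t, (((A.part s).coeff m : ℤ) : ℂ) *
      ((eis 1).ev (qpar τ) ^ m 1 * (eis 2).ev (qpar τ) ^ m 2)‖) (by simp [G])
      (mul_le_mul_of_nonneg_right ?_ (norm_nonneg _))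
    rw [norm_pow]
    refine one_le_pow₀ ?_
    rw [norm_div, norm_mul, Complex.norm_I, mul_one, Complex.norm_real, Real.norm_eq_abs,
      abs_of_pos Real.pi_pos, le_div_iff₀ Real.pi_pos]
    have := Real.pi_lt_four
    norm_num
    linarith
  · have : (v : ℝ) ≤ d := by exact_mod_cast hv
    push_cast
    calc 49 * (d : ℝ) ^ 2 * (7 * v + 2 * d ^ 2) ≤ 49 * (d : ℝ) ^ 2 * (7 * d + 2 * d ^ 2) := by
          gcongr
      _ ≤ 441 * (d : ℝ) ^ 4 := by
          have : (d : ℝ) ^ 3 ≤ d ^ 4 := pow_le_pow_right₀ (by linarith) (by norm_num)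
          nlinarith
      _ < 3 * (d : ℝ) ^ 5 := by
          have : 0 < (d : ℝ) ^ 4 := by positivity
          nlinarith

end

section

theorem one_div_eight_le_one_sub_pow {N m : ℕ} (hN : 2 ≤ N) (hm : m ≤ N) :
    1 / 8 ≤ (1 - 1 / N : ℝ) ^ m := by
  have hN' : (2 : ℝ) ≤ N := by exact_mod_cast hN
  have h1 : Real.exp (-(2 / N)) ≤ 1 - 1 / (N : ℝ) := by
    rw [Real.exp_neg, inv_le_comm₀ (Real.exp_pos _)
      (by rw [sub_pos, div_lt_one (by linarith)]; linarith)]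
    refine le_trans ?_ (Real.add_one_le_exp _)
    have h2 : 1 - 1 / (N : ℝ) = (N - 1) / N := by field_simp
    rw [h2, inv_div, div_add_one (by linarith), div_le_div_iff₀ (by linarith) (by linarith)]
    nlinarith
  have h8 : Real.exp 2 ≤ 8 := by
    have h3 := Real.exp_one_lt_d9
    have h4 : Real.exp 2 = Real.exp 1 * Real.exp 1 := by rw [← Real.exp_add]; norm_num
    have := Real.exp_pos 1
    rw [h4]
    nlinarith
  calc (1 / 8 : ℝ) ≤ Real.exp (-2) := by
        rw [Real.exp_neg, one_div]
        exact inv_anti₀ (Real.exp_pos _) h8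
    _ ≤ Real.exp (-(2 / N)) ^ m := by
        rw [← Real.exp_nat_mul, Real.exp_le_exp]
        have : (m : ℝ) ≤ N := by exact_mod_cast hm
        rw [mul_neg, neg_le_neg_iff, mul_div_assoc', div_le_iff₀ (by linarith)]
        linarith
    _ ≤ _ := by gcongr

theorem eis_wBound_one_sub {N : ℕ} (hN : 2 ≤ N) (i : Fin 3) :
    (eis i).WBound (1 - 1 / N : ℝ) (362880 * N ^ 7) := by
  have hN' : (2 : ℝ) ≤ N := by exact_mod_cast hN
  have h0 : 0 < 1 / (N : ℝ) := by positivity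
  have h1 : 1 / (N : ℝ) ≤ 1 := by rw [div_le_one (by linarith)]; linarith
  refine (eis_wBound i (by linarith) (by linarith)).mono (le_of_eq ?_)
  rw [sub_sub_cancel]
  field_simp

/-- The exponent vector of a triple. -/
noncomputable def triple {n : ℕ} (x : Fin 3 → Fin n) : Fin 3 →₀ ℕ :=
  Finsupp.equivFunOnFinite.symm fun i => (x i : ℕ)

theorem triple_injective {n : ℕ} : Function.Injective (triple (n := n)) := fun x y h => by
  funext i
  have := DFunLike.congr_fun h i
  simpa [triple, Fin.ext_iff] using this

theorem totalDegree_monomial_triple_le {n : ℕ} (x : Fin 3 → Fin n) (c : ℤ) :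
    (MvPolynomial.monomial (triple x) c).totalDegree ≤ 3 * n := by
  refine (MvPolynomial.totalDegree_monomial_le _ _).trans ?_
  rw [Finsupp.sum_fintype _ _ (fun _ => rfl), Fin.sum_univ_three]
  have h0 := (x 0).2
  have h1 := (x 1).2
  have h2 := (x 2).2
  simp only [triple, Finsupp.equivFunOnFinite_symm_apply_apply, id]
  omega

open MvPolynomial in
theorem abs_coeff_aeval_triple_le {n : ℕ} (hn : 2 ≤ n) (x : Fin 3 → Fin n) {m : ℕ}
    (hm : m ≤ n ^ 3) : |((PowerSeries.coeff m (aeval eis (monomial (triple x) (1 : ℤ))) : ℤ) : ℝ)| ≤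
      8 * (362880 * n ^ 21 : ℝ) ^ (3 * n) := by
  have hN : 2 ≤ n ^ 3 := hn.trans (Nat.le_self_pow (by norm_num) n)
  have hN' : (2 : ℝ) ≤ (n ^ 3 : ℕ) := by exact_mod_cast hN
  have hr : (0 : ℝ) ≤ 1 - 1 / (n ^ 3 : ℕ) := by
    rw [sub_nonneg, div_le_one (by linarith)]; linarith
  have hB : (1 : ℝ) ≤ 362880 * (n ^ 3 : ℕ) ^ 7 := by
    have : (1 : ℝ) ≤ ((n ^ 3 : ℕ) : ℝ) ^ 7 := one_le_pow₀ (by linarith)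
    linarith
  have h1 := ((PowerSeries.WBound.aeval hr hB (eis_wBound_one_sub hN)
    (totalDegree_monomial_triple_le x 1)).abs_coeff_mul_le hr m)
  have h2 := one_div_eight_le_one_sub_pow hN hm
  have hlen : (monomial (triple x) (1 : ℤ)).len = 1 := by
    classical
    rw [len, support_monomial, if_neg one_ne_zero, Finset.sum_singleton, coeff_monomial, if_pos rfl]
    simp
  rw [hlen, one_mul] at h1
  have h3 : (362880 * (n ^ 3 : ℕ) ^ 7 : ℝ) = 362880 * n ^ 21 := by push_cast; ring
  rw [h3] at h1
  have h4 := mul_le_mul_of_nonneg_left h2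
    (abs_nonneg ((PowerSeries.coeff m (aeval eis (monomial (triple x) (1 : ℤ))) : ℤ) : ℝ))
  have h5 := h4.trans h1
  rw [mul_one_div, div_le_iff₀ (by norm_num), mul_comm] at h5
  exact h5

attribute [local instance] Matrix.seminormedAddCommGroup in
open MvPolynomial in
/-- Auxiliary polynomial from Siegel's lemma. -/
theorem exists_auxiliary_polynomial {n : ℕ} (hn : 2 ≤ n) : ∃ A : MvPolynomial (Fin 3) ℤ, A ≠ 0 ∧
    A.totalDegree ≤ 3 * n ∧ A.len ≤ n ^ 6 * (8 * (362880 * n ^ 21 : ℝ) ^ (3 * n)) ∧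
    ∀ m < n ^ 3 / 2, PowerSeries.coeff m (aeval eis A) = 0 := by
  classical
  have hN : 2 ^ 3 ≤ n ^ 3 := Nat.pow_le_pow_left hn 3
  set N := n ^ 3 with hNdef
  set E : ℝ := 8 * (362880 * n ^ 21 : ℝ) ^ (3 * n) with hE
  have hn' : (2 : ℝ) ≤ n := by exact_mod_cast hn
  have hE1 : 1 ≤ E := by
    have h1 : (1 : ℝ) ≤ (n : ℝ) ^ 21 := one_le_pow₀ (by linarith)
    have : (1 : ℝ) ≤ (362880 * n ^ 21 : ℝ) ^ (3 * n) := one_le_pow₀ (by linarith)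
    linarith
  let Mat : Matrix (Fin (N / 2)) (Fin 3 → Fin n) ℤ := fun m x =>
    PowerSeries.coeff (m : ℕ) (aeval eis (monomial (triple x) (1 : ℤ)))
  have hcard : Fintype.card (Fin 3 → Fin n) = N := by simp [hNdef]
  obtain ⟨t, ht0, htA, htn⟩ := Int.Matrix.exists_ne_zero_int_vec_norm_le Mat
    (by rw [hcard, Fintype.card_fin]; omega) (by rw [Fintype.card_fin]; omega)
  have hNR : (8 : ℝ) ≤ N := by exact_mod_cast hN
  have hMat : max 1 ‖Mat‖ ≤ E := by
    refine max_le hE1 ((Matrix.norm_le_iff (by linarith)).2 fun m x => ?_)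
    rw [Int.norm_eq_abs]
    exact abs_coeff_aeval_triple_le hn x (by have := m.2; omega)
  have ht : ‖t‖ ≤ N * E := by
    refine htn.trans ?_
    rw [hcard, Fintype.card_fin]
    have h2 : ((N / 2 : ℕ) : ℝ) ≤ N / 2 := Nat.cast_div_le
    have h3 : (1 : ℝ) ≤ N * max 1 ‖Mat‖ :=
      one_le_mul_of_one_le_of_one_le (by linarith) (le_max_left _ _)
    calc _ ≤ (N * max 1 ‖Mat‖ : ℝ) ^ (1 : ℝ) := by
          refine Real.rpow_le_rpow_of_exponent_le h3 ?_
          rw [div_le_one (by linarith)]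
          linarith
      _ ≤ _ := by rw [Real.rpow_one]; gcongr
  set A : MvPolynomial (Fin 3) ℤ := ∑ x, monomial (triple x) (t x) with hA
  have hcoeff : ∀ x, A.coeff (triple x) = t x := fun x => by
    rw [hA, coeff_sum, Finset.sum_eq_single x]
    · rw [coeff_monomial, if_pos rfl]
    · intro y _ hy
      rw [coeff_monomial, if_neg fun h => hy (triple_injective h)]
    · simp
  have hsupp : A.support ⊆ Finset.univ.image (triple (n := n)) := by
    intro m hm
    by_contra hne
    refine mem_support_iff.1 hm ?_
    rw [hA, coeff_sum]
    refine Finset.sum_eq_zero fun x _ => ?_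
    rw [coeff_monomial, if_neg]
    rintro rfl
    exact hne (Finset.mem_image_of_mem _ (Finset.mem_univ x))
  refine ⟨A, fun h => ht0 (funext fun x => ?_), ?_, ?_, fun m hm => ?_⟩
  · rw [← hcoeff, h, coeff_zero]; rfl
  · exact (totalDegree_finsetSum _ _).trans
      (Finset.sup_le fun x _ => totalDegree_monomial_triple_le x _)
  · calc A.len ≤ ∑ m ∈ Finset.univ.image (triple (n := n)), |((A.coeff m : ℤ) : ℝ)| :=
          Finset.sum_le_sum_of_subset_of_nonneg hsupp fun _ _ _ => abs_nonneg _
      _ = ∑ x : Fin 3 → Fin n, |(t x : ℝ)| := by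
          rw [Finset.sum_image triple_injective.injOn]
          simp only [hcoeff]
      _ ≤ ∑ x : Fin 3 → Fin n, (N * E : ℝ) := by
          refine Finset.sum_le_sum fun x _ => ?_
          have := norm_le_pi_norm t x
          rw [Int.norm_eq_abs] at this
          exact this.trans ht
      _ = _ := by
          rw [Finset.sum_const, Finset.card_univ, hcard, nsmul_eq_mul, hNdef]
          push_cast
          ring
  · have h := congrFun htA ⟨m, hm⟩
    rw [Matrix.mulVec, dotProduct] at h
    rw [hA, map_sum, map_sum]
    refine Eq.trans (Finset.sum_congr rfl fun x _ => ?_) h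
    have h1 : monomial (triple x) (t x) = t x • monomial (triple x) (1 : ℤ) := by
      rw [smul_monomial, smul_eq_mul, mul_one]
    rw [h1, map_smul, map_smul, smul_eq_mul, mul_comm]

end

section

open scoped Topology in
/-- A holomorphic function vanishing to order `T` at `c` is divisible by `(z - c) ^ T`. -/
theorem DifferentiableOn.exists_eq_pow_mul {U : Set ℂ} {c : ℂ} (hU : U ∈ 𝓝 c) {T : ℕ} :
    ∀ {f : ℂ → ℂ}, DifferentiableOn ℂ f U → (T : ℕ∞) ≤ analyticOrderAt f c →
      ∃ h : ℂ → ℂ, DifferentiableOn ℂ h U ∧ ∀ z, f z = (z - c) ^ T * h z := by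
  induction T with
  | zero => exact fun {f} hf _ => ⟨f, hf, fun z => by simp⟩
  | succ T ih =>
    intro f hf hord
    have hfc : f c = 0 := apply_eq_zero_of_analyticOrderAt_ne_zero fun h => by
      rw [h] at hord
      exact absurd (le_antisymm hord zero_le) (by simp)
    have hd : DifferentiableOn ℂ (dslope f c) U := (Complex.differentiableOn_dslope hU).2 hf
    have hfac : f = (fun z => z - c) * dslope f c := by
      funext z
      have := sub_smul_dslope f c z
      rw [hfc, sub_zero] at this
      simpa using this.symm
    have hord' : (T : ℕ∞) ≤ analyticOrderAt (dslope f c) c := by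
      have h1 : analyticOrderAt (fun z : ℂ => z - c) c = 1 := by
        exact analyticOrderAt_id_sub_const_self
      rw [hfac, analyticOrderAt_mul (by fun_prop) (hd.analyticAt hU), h1, add_comm T,
        Nat.cast_add, Nat.cast_one] at hord
      exact (ENat.add_le_add_iff_left ENat.one_ne_top).1 hord
    obtain ⟨h, hh, hh'⟩ := ih hd hord'
    refine ⟨h, hh, fun z => ?_⟩
    rw [congrFun hfac z, Pi.mul_apply, hh', pow_succ']
    ring

open ComplexConjugate in
/-- A Schwarz lemma for functions with a zero of high order. -/
theorem norm_apply_zero_le_of_le_analyticOrderAt {f : ℂ → ℂ} {c : ℂ} {R B : ℝ} {T : ℕ}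
    (hf : DifferentiableOn ℂ f (Metric.ball 0 1)) (hR0 : 0 < R) (hR : R < 1) (hc : ‖c‖ < 1)
    (hB : ∀ z, ‖z‖ = R → ‖f z‖ ≤ B) (hord : (T : ℕ∞) ≤ analyticOrderAt f c) :
    ‖f 0‖ ≤ (‖c‖ / R) ^ T * B := by
  obtain ⟨h, hh, hfac⟩ := hf.exists_eq_pow_mul
    (Metric.isOpen_ball.mem_nhds (by simpa using hc)) hord
  have hRc : (R : ℂ) ≠ 0 := by exact_mod_cast hR0.ne'
  let k : ℂ → ℂ := fun z => h z * ((R ^ 2 - conj c * z) / R) ^ T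
  have hd : DiffContOnCl ℂ k (Metric.ball 0 R) := by
    refine DifferentiableOn.diffContOnCl ?_
    rw [closure_ball _ hR0.ne']
    refine (hh.mono (Metric.closedBall_subset_ball hR)).mul ?_
    fun_prop
  have hk : ∀ z ∈ frontier (Metric.ball (0 : ℂ) R), ‖k z‖ ≤ B := by
    intro z hz
    have hz' : ‖z‖ = R := by rw [frontier_ball _ hR0.ne'] at hz; simpa using hz
    refine le_trans (le_of_eq ?_) (hB z hz')
    have h1 : (R : ℂ) ^ 2 - conj c * z = z * conj (z - c) := by
      rw [← hz', map_sub, mul_sub, Complex.mul_conj, Complex.normSq_eq_norm_sq]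
      push_cast
      ring
    have h2 : ‖((R : ℂ) ^ 2 - conj c * z) / R‖ = ‖z - c‖ := by
      rw [h1, norm_div, norm_mul, Complex.norm_conj, hz', Complex.norm_real, Real.norm_eq_abs,
        abs_of_pos hR0]
      field_simp
    rw [hfac, norm_mul, norm_mul, norm_pow, h2, norm_pow, mul_comm]
  have h0 := Complex.norm_le_of_forall_mem_frontier_norm_le Metric.isBounded_ball hd hk
    (subset_closure (Metric.mem_ball_self hR0))
  have h3 : ‖k 0‖ = ‖h 0‖ * R ^ T := by
    have h4 : ((R : ℂ) ^ 2 - conj c * 0) / R = R := by field_simp; ring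
    simp only [k]
    rw [h4, norm_mul, norm_pow, Complex.norm_real, Real.norm_eq_abs, abs_of_pos hR0]
  rw [h3] at h0
  rw [hfac, norm_mul, norm_pow, zero_sub, norm_neg, div_pow, div_mul_eq_mul_div, mul_div_assoc]
  gcongr
  rwa [le_div_iff₀ (by positivity)]

namespace PowerSeries

variable {f : PowerSeries ℤ} {q : ℂ}

theorem Conv.analyticAt (hf : f.Conv) (hq : ‖q‖ < 1) : AnalyticAt ℂ f.ev q :=
  hf.differentiableOn.analyticAt (Metric.isOpen_ball.mem_nhds (by simpa using hq))

open Filter Topology in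
theorem Conv.natCast_le_analyticOrderAt (hq0 : q ≠ 0) (hq : ‖q‖ < 1) {T : ℕ} :
    ∀ {f : PowerSeries ℤ}, f.Conv → (∀ t < T, (PowerSeries.theta^[t] f).ev q = 0) →
      (T : ℕ∞) ≤ analyticOrderAt f.ev q := by
  induction T with
  | zero => simp
  | succ T ih =>
    intro f hf h
    have h0 : f.ev q = 0 := h 0 (Nat.succ_pos _)
    have h1 := ih hf.theta fun t ht => h (t + 1) (by omega)
    have heq : (PowerSeries.theta f).ev =ᶠ[𝓝 q] (fun z => z) * deriv f.ev := by
      filter_upwards [Metric.isOpen_ball.mem_nhds (show q ∈ Metric.ball 0 1 by simpa using hq)]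
        with z hz
      exact ev_theta hf (by simpa using hz)
    have hid : analyticOrderAt (fun z : ℂ => z) q = 0 :=
      analyticOrderAt_eq_zero.2 (Or.inr hq0)
    rw [analyticOrderAt_congr heq, analyticOrderAt_mul (by fun_prop) (hf.analyticAt hq).deriv,
      hid, zero_add] at h1
    have h2 := (hf.analyticAt hq).analyticOrderAt_deriv_add_one
    simp only [h0, sub_zero] at h2
    rw [← h2, Nat.cast_add, Nat.cast_one]
    gcongr

open Filter Topology in
theorem Conv.one_le_of_theta_iterate_eq_zero (hf : f.Conv) (hq0 : q ≠ 0) (hq : ‖q‖ < 1) {M T : ℕ}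
    (hM : ∀ m < M, coeff m f = 0) (hM' : coeff M f ≠ 0)
    (hT : ∀ t < T, (PowerSeries.theta^[t] f).ev q = 0) {R B : ℝ} (hR0 : 0 < R) (hR : R < 1)
    (hB : f.WBound R B) : 1 ≤ (‖q‖ / R) ^ T * (B / R ^ M) := by
  have hord := Conv.natCast_le_analyticOrderAt hq0 hq hf hT
  have heq : f.ev =ᶠ[𝓝 q] (fun z => z ^ M) * (f.shift M).ev := by
    filter_upwards [Metric.isOpen_ball.mem_nhds (show q ∈ Metric.ball 0 1 by simpa using hq)]
      with z hz
    exact ev_eq_pow_mul_ev_shift hf hM (by simpa using hz)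
  have hid : analyticOrderAt (fun z : ℂ => z ^ M) q = 0 :=
    analyticOrderAt_eq_zero.2 (Or.inr (pow_ne_zero _ hq0))
  rw [analyticOrderAt_congr heq, analyticOrderAt_mul (by fun_prop) ((hf.shift M).analyticAt hq),
    hid, zero_add] at hord
  have h := norm_apply_zero_le_of_le_analyticOrderAt (hf.shift M).differentiableOn hR0 hR hq
    (fun z hz => (hB.shift hR0 M).norm_ev_le' hR0 hz.le) hord
  refine le_trans ?_ h
  rw [ev_zero_arg, PowerSeries.shift, coeff_mk, zero_add, Complex.norm_intCast]
  exact_mod_cast Int.one_le_abs hM'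

end PowerSeries

end

section

namespace MvPolynomial

variable {σ : Type*}

theorem len_eq_sum {P : MvPolynomial σ ℤ} {s : Finset (σ →₀ ℕ)} (hs : P.support ⊆ s) :
    P.len = ∑ m ∈ s, |((P.coeff m : ℤ) : ℝ)| :=
  Finset.sum_subset hs fun m _ hm => by rw [notMem_support_iff.1 hm, Int.cast_zero, abs_zero]

theorem len_zero : (0 : MvPolynomial σ ℤ).len = 0 := by simp [len]

theorem len_monomial (m : σ →₀ ℕ) (a : ℤ) : (monomial m a).len = |(a : ℝ)| := by
  classical
  rw [len_eq_sum (support_monomial_subset (s := m) (a := a)), Finset.sum_singleton, coeff_monomial,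
    if_pos rfl]

theorem len_add_le (P Q : MvPolynomial σ ℤ) : (P + Q).len ≤ P.len + Q.len := by
  classical
  rw [len_eq_sum (support_add (p := P) (q := Q)), len_eq_sum (P := P) Finset.subset_union_left,
    len_eq_sum (P := Q) Finset.subset_union_right, ← Finset.sum_add_distrib]
  refine Finset.sum_le_sum fun m _ => ?_
  rw [coeff_add, Int.cast_add]
  exact abs_add_le _ _

theorem len_neg (P : MvPolynomial σ ℤ) : (-P).len = P.len := by
  simp [len, support_neg]

theorem len_sub_le (P Q : MvPolynomial σ ℤ) : (P - Q).len ≤ P.len + Q.len := by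
  rw [sub_eq_add_neg, ← len_neg Q]
  exact len_add_le _ _

theorem len_sum_le {ι : Type*} (s : Finset ι) (P : ι → MvPolynomial σ ℤ) :
    (∑ i ∈ s, P i).len ≤ ∑ i ∈ s, (P i).len :=
  Finset.le_sum_of_subadditive _ len_zero.le len_add_le _ _

theorem len_mul_le (P Q : MvPolynomial σ ℤ) : (P * Q).len ≤ P.len * Q.len := by
  have h : P * Q = ∑ m ∈ P.support, ∑ n ∈ Q.support,
      monomial (m + n) (P.coeff m * Q.coeff n) := by
    conv_lhs => rw [P.as_sum, Q.as_sum, Finset.sum_mul_sum]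
    simp only [monomial_mul]
  rw [h, len.eq_def P, len.eq_def Q, Finset.sum_mul_sum]
  refine (len_sum_le _ _).trans (Finset.sum_le_sum fun m _ => (len_sum_le _ _).trans
    (Finset.sum_le_sum fun n _ => ?_))
  rw [len_monomial, Int.cast_mul, abs_mul]

theorem len_X (i : σ) : (X i : MvPolynomial σ ℤ).len = 1 := by
  rw [X, len_monomial]; simp

end MvPolynomial

open MvPolynomial

theorem len_ramanujanDerivation_X_le (i : Fin 3) : (ramanujanDerivation (X i)).len ≤ 12 := by
  have hX := fun i j : Fin 3 => (len_mul_le (X i : MvPolynomial (Fin 3) ℤ) (X j)).trans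
    (by rw [len_X, len_X, one_mul])
  have hC : ∀ a : ℤ, (C a : MvPolynomial (Fin 3) ℤ).len = |(a : ℝ)| := len_monomial 0
  have h4 : (4 : MvPolynomial (Fin 3) ℤ) = C 4 := by simp
  have h6 : (6 : MvPolynomial (Fin 3) ℤ) = C 6 := by simp
  have hsub : ∀ P Q : MvPolynomial (Fin 3) ℤ, P.len ≤ 1 → Q.len ≤ 1 → (P - Q).len ≤ 2 :=
    fun P Q hP hQ => (len_sub_le _ _).trans (by linarith)
  rw [ramanujanDerivation, mkDerivation_X]
  fin_cases i
  · refine (hsub _ _ ?_ (len_X _).le).trans (by norm_num)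
    rw [pow_two]; exact hX _ _
  · refine (len_mul_le _ _).trans ?_
    have := hsub _ _ (hX 0 1) (len_X (2 : Fin 3)).le
    rw [h4, hC]
    norm_num
    linarith
  · refine (len_mul_le _ _).trans ?_
    have := hsub _ _ (hX 0 2) (hX 1 1)
    rw [h6, hC, pow_two]
    norm_num
    linarith

theorem totalDegree_ramanujanDerivation_X_le (i : Fin 3) :
    (ramanujanDerivation (X i)).totalDegree ≤ 2 := by
  have hX := fun i j : Fin 3 => (totalDegree_mul (X i : MvPolynomial (Fin 3) ℤ) (X j)).trans
    (by rw [totalDegree_X, totalDegree_X])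
  have hsub : ∀ P Q : MvPolynomial (Fin 3) ℤ, P.totalDegree ≤ 2 → Q.totalDegree ≤ 2 →
      (P - Q).totalDegree ≤ 2 :=
    fun P Q hP hQ => (totalDegree_sub _ _).trans (max_le hP hQ)
  have hC : ∀ (a : ℤ) (P : MvPolynomial (Fin 3) ℤ), P.totalDegree ≤ 2 →
      (C a * P).totalDegree ≤ 2 := fun a P hP => by
    refine (totalDegree_mul _ _).trans ?_
    rwa [totalDegree_C, zero_add]
  have h1 : ∀ i : Fin 3, (X i : MvPolynomial (Fin 3) ℤ).totalDegree ≤ 2 := fun i => by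
    rw [totalDegree_X]; norm_num
  have h4 : (4 : MvPolynomial (Fin 3) ℤ) = C 4 := by simp
  have h6 : (6 : MvPolynomial (Fin 3) ℤ) = C 6 := by simp
  rw [ramanujanDerivation, mkDerivation_X, h4, h6, pow_two, pow_two]
  fin_cases i
  · exact hsub _ _ (hX _ _) (h1 _)
  · exact hC _ _ (hsub _ _ (hX _ _) (h1 _))
  · exact hC _ _ (hsub _ _ (hX _ _) (hX _ _))

theorem ramanujanDerivation_eq_sum (A : MvPolynomial (Fin 3) ℤ) :
    ramanujanDerivation A = ∑ m ∈ A.support, ∑ i, monomial (m - Finsupp.single i 1)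
      (A.coeff m * m i) * ramanujanDerivation (X i) := by
  conv_lhs => rw [A.as_sum, map_sum]
  refine Finset.sum_congr rfl fun m _ => ?_
  rw [ramanujanDerivation, mkDerivation_monomial, Finsupp.sum_fintype _ _ (by simp),
    Finset.smul_sum]
  refine Finset.sum_congr rfl fun i _ => ?_
  rw [mkDerivation_X, smul_eq_mul, ← smul_mul_assoc, smul_monomial, smul_eq_mul]

theorem totalDegree_ramanujanDerivation_le {A : MvPolynomial (Fin 3) ℤ} {d : ℕ}
    (hd : A.totalDegree ≤ d) : (ramanujanDerivation A).totalDegree ≤ d + 1 := by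
  rw [ramanujanDerivation_eq_sum]
  refine (totalDegree_finsetSum _ _).trans (Finset.sup_le fun m hm =>
    (totalDegree_finsetSum _ _).trans (Finset.sup_le fun i _ => ?_))
  rcases Nat.eq_zero_or_pos (m i) with h | h
  · simp [h]
  · refine (totalDegree_mul _ _).trans ?_
    have h1 := totalDegree_ramanujanDerivation_X_le i
    have h2 := totalDegree_monomial_le (m - Finsupp.single i 1) (A.coeff m * (m i : ℤ))
    have h3 := Finsupp.sum_le_of_mem_support_fin_three hm hd
    rw [Finsupp.sum_fintype _ _ (fun _ => rfl), Fin.sum_univ_three] at h2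
    have h4 : ∀ j, (m - Finsupp.single i 1 : Fin 3 →₀ ℕ) j = m j - if i = j then 1 else 0 :=
      fun j => by rw [Finsupp.tsub_apply, Finsupp.single_apply]
    simp only [h4, id] at h2
    fin_cases i <;> simp at h h2 <;> simp at h1 ⊢ <;> omega

theorem len_ramanujanDerivation_le {A : MvPolynomial (Fin 3) ℤ} {d : ℕ}
    (hd : A.totalDegree ≤ d) : (ramanujanDerivation A).len ≤ A.len * (12 * d) := by
  rw [ramanujanDerivation_eq_sum, len.eq_def A, Finset.sum_mul]
  refine (len_sum_le _ _).trans (Finset.sum_le_sum fun m hm => (len_sum_le _ _).trans ?_)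
  calc _ ≤ ∑ i, |((A.coeff m : ℤ) : ℝ)| * m i * 12 := by
        refine Finset.sum_le_sum fun i _ => (len_mul_le _ _).trans ?_
        rw [len_monomial]
        have := len_ramanujanDerivation_X_le i
        refine mul_le_mul (le_of_eq ?_) this (len_nonneg _) (by positivity)
        rw [Int.cast_mul, abs_mul, Int.cast_natCast, Nat.abs_cast]
    _ = |((A.coeff m : ℤ) : ℝ)| * (12 * ((m 0 + m 1 + m 2 : ℕ) : ℝ)) := by
        rw [Fin.sum_univ_three]; push_cast; ring
    _ ≤ _ := by
        gcongr
        exact Finsupp.sum_le_of_mem_support_fin_three hm hd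

theorem totalDegree_ramanujanDerivation_iterate_le {A : MvPolynomial (Fin 3) ℤ} {d : ℕ}
    (hd : A.totalDegree ≤ d) (t : ℕ) : (ramanujanDerivation^[t] A).totalDegree ≤ d + t := by
  induction t with
  | zero => simpa
  | succ t ih =>
    rw [Function.iterate_succ_apply']
    exact totalDegree_ramanujanDerivation_le ih

theorem len_ramanujanDerivation_iterate_le {A : MvPolynomial (Fin 3) ℤ} {d T : ℕ}
    (hd : A.totalDegree ≤ d) {t : ℕ} (ht : t ≤ T) :
    (ramanujanDerivation^[t] A).len ≤ A.len * (12 * (d + T : ℕ)) ^ t := by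
  induction t with
  | zero => simp
  | succ t ih =>
    rw [Function.iterate_succ_apply', pow_succ, ← mul_assoc]
    have h1 := totalDegree_ramanujanDerivation_iterate_le hd t
    refine (len_ramanujanDerivation_le (h1.trans (by omega : d + t ≤ d + T))).trans ?_
    gcongr
    exact ih (by omega)

end

section

open MvPolynomial

theorem PowerSeries.Conv.theta_iterate {f : PowerSeries ℤ} (hf : f.Conv) (t : ℕ) :
    (PowerSeries.theta^[t] f).Conv := by
  induction t with
  | zero => exact hf
  | succ t ih => rw [Function.iterate_succ_apply']; exact ih.theta

theorem aeval_ramanujanDerivation_iterate (A : MvPolynomial (Fin 3) ℤ) (t : ℕ) {q : ℂ}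
    (hq : ‖q‖ < 1) : aeval (fun i => (eis i).ev q) (ramanujanDerivation^[t] A) =
      12 ^ t * (PowerSeries.theta^[t] (aeval eis A)).ev q := by
  rw [← PowerSeries.ev_aeval eis_conv _ hq, ← theta_iterate_aeval_eis]
  have h : (12 : PowerSeries ℤ) ^ t = ((12 ^ t : ℤ) : PowerSeries ℤ) := by push_cast; rfl
  rw [h, PowerSeries.ev_mul (PowerSeries.Conv.intCast _)
    ((PowerSeries.Conv.aeval eis_conv A).theta_iterate t) hq, PowerSeries.ev_intCast]
  push_cast
  rfl

open Filter Topology in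
/-- If the first `T` derivatives of `A(E₂, E₄, E₆)` vanish at `q`, then `T` is not too large. -/
theorem exists_aeval_ramanujanDerivation_iterate_ne_zero {q : ℂ} (hq0 : q ≠ 0) (hq : ‖q‖ < 1) :
    ∀ᶠ n : ℕ in atTop, ∀ (A : MvPolynomial (Fin 3) ℤ) (T : ℕ), A ≠ 0 → A.totalDegree ≤ 3 * n →
      A.len ≤ (n : ℝ) ^ (73 * n) → 413 * (n * Real.log n) < -Real.log ‖q‖ / 2 * T →
      ∃ t < T, aeval (fun i => (eis i).ev q) (ramanujanDerivation^[t] A) ≠ 0 := by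
  have hx0 : 0 < ‖q‖ := norm_pos_iff.2 hq0
  have hd : Tendsto (fun n : ℕ => 3 * n) atTop atTop := tendsto_id.const_mul_atTop' (by norm_num)
  have hsqrt : Real.sqrt ‖q‖ < 1 := by
    rw [Real.sqrt_lt' one_pos]; simpa
  have hR : ∀ᶠ n : ℕ in atTop, Real.sqrt ‖q‖ ≤ 1 - 1 / ((3 * n) ^ 8 : ℕ) := by
    have h1 : Tendsto (fun n : ℕ => (1 : ℝ) - 1 / ((3 * n) ^ 8 : ℕ)) atTop (𝓝 (1 - 0)) :=
      tendsto_const_nhds.sub (tendsto_one_div_atTop_nhds_zero_nat.comp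
        ((tendsto_pow_atTop (by norm_num)).comp hd))
    rw [sub_zero] at h1
    exact (h1.eventually (eventually_gt_nhds hsqrt)).mono fun _ h => h.le
  have hlog : ∀ᶠ n : ℕ in atTop, Real.log n ≤ 9 / 73 * n := by
    have := (Real.isLittleO_log_id_atTop.comp_tendsto tendsto_natCast_atTop_atTop).bound
      (show (0 : ℝ) < 9 / 73 by norm_num)
    filter_upwards [this] with n hn
    simp only [Function.comp, id, Real.norm_eq_abs, Nat.abs_cast] at hn
    exact (le_abs_self _).trans hn
  filter_upwards [hd.eventually eventually_exists_coeff_ne_zero, hR, hlog,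
    eventually_ge_atTop 362880] with n hzero hR hlog hn A T hA0 hdeg hlen hT
  have hy : (362880 : ℝ) ≤ n := by exact_mod_cast hn
  have hy0 : (0 : ℝ) < n := by linarith
  have hy1 : (1 : ℝ) ≤ n := by linarith
  have hpow : ∀ e : ℕ, (n : ℝ) ^ e = Real.exp (e * Real.log n) := fun e => by
    rw [Real.exp_nat_mul, Real.exp_log hy0]
  have hlen' : A.len ≤ Real.exp ((3 * n : ℕ) ^ 2) := by
    refine hlen.trans ?_
    rw [hpow, Real.exp_le_exp]
    push_cast
    nlinarith
  by_contra! hcon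
  obtain ⟨m, hm, hm0⟩ := hzero A hA0 hdeg hlen'
  classical
  let F := aeval eis A
  have hex : ∃ m, PowerSeries.coeff m F ≠ 0 := ⟨m, hm0⟩
  have hfm : Nat.find hex ≤ (3 * n) ^ 8 := (Nat.find_min' hex hm0).trans hm.le
  have hN2 : 2 ≤ (3 * n) ^ 8 := le_trans (by omega) (Nat.le_self_pow (by norm_num) (3 * n))
  set N := (3 * n) ^ 8 with hN
  set R : ℝ := 1 - 1 / (N : ℕ) with hRdef
  have hN2' : (2 : ℝ) ≤ N := by exact_mod_cast hN2
  have hR1 : R < 1 := by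
    have : (0 : ℝ) < 1 / N := by positivity
    linarith
  have hR0 : 0 < R := (Real.sqrt_pos.2 hx0).trans_le hR
  have hB1 : (1 : ℝ) ≤ 362880 * N ^ 7 := by
    have : (1 : ℝ) ≤ (N : ℝ) ^ 7 := one_le_pow₀ (by linarith)
    linarith
  have hW : F.WBound R (A.len * (362880 * N ^ 7 : ℝ) ^ (3 * n)) :=
    PowerSeries.WBound.aeval hR0.le hB1 (eis_wBound_one_sub hN2) hdeg
  have h1 := (PowerSeries.Conv.aeval eis_conv A).one_le_of_theta_iterate_eq_zero hq0 hq
    (fun m hm => not_not.1 (Nat.find_min hex hm)) (Nat.find_spec hex) (T := T)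
    (fun t ht => by
      have := hcon t ht
      rw [aeval_ramanujanDerivation_iterate A t hq] at this
      exact (mul_eq_zero.1 this).resolve_left (pow_ne_zero _ (by norm_num))) hR0 hR1 hW
  have h2 : ‖q‖ / R ≤ Real.exp (Real.log ‖q‖ / 2) := by
    rw [← Real.log_sqrt (norm_nonneg _), Real.exp_log (Real.sqrt_pos.2 hx0), div_le_iff₀ hR0]
    calc ‖q‖ = Real.sqrt ‖q‖ * Real.sqrt ‖q‖ := (Real.mul_self_sqrt (norm_nonneg _)).symm
      _ ≤ _ := by gcongr
  have h3 : (362880 * N ^ 7 : ℝ) ≤ (n : ℝ) ^ 113 := by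
    have : (N : ℝ) ≤ (n : ℝ) ^ 16 := by
      rw [hN]
      push_cast
      calc (3 * n : ℝ) ^ 8 ≤ (n * n) ^ 8 := by gcongr; linarith
        _ = _ := by ring
    calc (362880 * N ^ 7 : ℝ) ≤ n * ((n : ℝ) ^ 16) ^ 7 := by gcongr
      _ = _ := by ring
  have h4 : A.len * (362880 * N ^ 7 : ℝ) ^ (3 * n) / R ^ Nat.find hex ≤ (n : ℝ) ^ (413 * n) := by
    have h5 := one_div_eight_le_one_sub_pow hN2 hfm
    calc _ ≤ (n : ℝ) ^ (73 * n) * ((n : ℝ) ^ 113) ^ (3 * n) / (1 / 8) := by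
          gcongr
      _ ≤ (n : ℝ) ^ (73 * n) * ((n : ℝ) ^ 113) ^ (3 * n) * (n : ℝ) ^ n := by
          rw [div_div_eq_mul_div, div_one]
          gcongr
          exact (show (8 : ℝ) ≤ n by linarith).trans (le_self_pow₀ hy1 (by omega))
      _ = _ := by rw [← pow_mul, ← pow_add, ← pow_add]; congr 1; ring
  have h5 : 1 ≤ Real.exp (Real.log ‖q‖ / 2) ^ T * (n : ℝ) ^ (413 * n) := by
    refine h1.trans (mul_le_mul (pow_le_pow_left₀ (by positivity) h2 _) h4 ?_ (by positivity))
    have := hW.nonneg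
    positivity
  rw [hpow, ← Real.exp_nat_mul, ← Real.exp_add, Real.one_le_exp_iff] at h5
  push_cast at h5
  linarith

end

section

open MvPolynomial

open Filter Topology in
/-- Integer polynomials taking small nonzero values at `(E₂, E₄, E₆)`. -/
theorem exists_small_nonzero_value {q : ℂ} (hq0 : q ≠ 0) (hq : ‖q‖ < 1) :
    ∃ c > 0, ∃ K : ℝ, ∀ᶠ n : ℕ in atTop, ∀ T : ℕ, 413 * (n * Real.log n) < c * T →
      K * (n + T) ≤ n ^ 2 → ∃ P : MvPolynomial (Fin 3) ℤ, P.totalDegree ≤ 3 * n + T ∧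
        P.len ≤ Real.exp ((76 * n + 2 * T) * Real.log n) ∧
        aeval (fun i => (eis i).ev q) P ≠ 0 ∧ ‖aeval (fun i => (eis i).ev q) P‖ ≤
          Real.exp ((76 * n + 2 * T) * Real.log n - c * n ^ 3) := by
  have hx0 : 0 < ‖q‖ := norm_pos_iff.2 hq0
  set μ : ℝ := -Real.log ‖q‖ / 3 with hμ
  have hμ0 : 0 < μ := by
    have := Real.log_neg hx0 hq
    rw [hμ]; linarith
  set ρ : ℝ := Real.exp (-μ) with hρ
  have hρ0 : 0 < ρ := Real.exp_pos _
  have hρ1 : ρ < 1 := Real.exp_zero ▸ Real.exp_lt_exp.2 (by linarith)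
  have hρ3 : ‖q‖ = ρ ^ 3 := by
    rw [hρ, ← Real.exp_nat_mul, hμ]
    conv_lhs => rw [← Real.exp_log hx0]
    congr 1
    push_cast
    ring
  set b : ℝ := 362880 / (1 - ρ) ^ 7 with hb
  have hb1 : 1 ≤ b := by
    rw [hb, le_div_iff₀ (pow_pos (by linarith) _), one_mul]
    have : (1 - ρ) ^ 7 ≤ 1 := pow_le_one₀ (by linarith) (by linarith)
    linarith
  refine ⟨μ / 4, by positivity, max 36 (12 / μ), ?_⟩
  filter_upwards [exists_aeval_ramanujanDerivation_iterate_ne_zero hq0 hq,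
    eventually_ge_atTop 362880, eventually_ge_atTop ⌈b⌉₊] with n hne hn hbn T hT hK
  have hy : (362880 : ℝ) ≤ n := by exact_mod_cast hn
  have hy0 : (0 : ℝ) < n := by linarith
  have hy1 : (1 : ℝ) ≤ n := by linarith
  have hbn' : b ≤ n := Nat.ceil_le.1 hbn
  have hpow : ∀ e : ℕ, (n : ℝ) ^ e = Real.exp (e * Real.log n) := fun e => by
    rw [Real.exp_nat_mul, Real.exp_log hy0]
  have hT0 : (0 : ℝ) ≤ T := Nat.cast_nonneg T
  have hK1 : 36 * (n + T : ℝ) ≤ n ^ 2 :=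
    (mul_le_mul_of_nonneg_right (le_max_left _ _) (by linarith)).trans hK
  have hK2 : 12 / μ * (n + T : ℝ) ≤ n ^ 2 :=
    (mul_le_mul_of_nonneg_right (le_max_right _ _) (by linarith)).trans hK
  obtain ⟨A, hA0, hdeg, hlen, hvan⟩ := exists_auxiliary_polynomial (show 2 ≤ n by omega)
  have hlen' : A.len ≤ (n : ℝ) ^ (73 * n) := by
    refine hlen.trans ?_
    calc (n : ℝ) ^ 6 * (8 * (362880 * n ^ 21 : ℝ) ^ (3 * n))
        ≤ (n : ℝ) ^ (6 * n) * ((n : ℝ) ^ n * ((n : ℝ) * n ^ 21) ^ (3 * n)) := by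
          gcongr
          · omega
          · exact (show (8 : ℝ) ≤ n by linarith).trans (le_self_pow₀ hy1 (by omega))
      _ = _ := by rw [← pow_succ', ← pow_mul, ← pow_add, ← pow_add]; congr 1; ring
  obtain ⟨t, htT, ht0⟩ := hne A T hA0 hdeg hlen' (by
    refine hT.trans_le (mul_le_mul_of_nonneg_right ?_ hT0)
    rw [hμ] at hμ0 ⊢
    linarith)
  have hexp : ∀ e : ℕ, e ≤ 76 * n + 2 * T →
      (n : ℝ) ^ e ≤ Real.exp ((76 * n + 2 * T) * Real.log n) := fun e he => by
    refine (pow_le_pow_right₀ hy1 he).trans (le_of_eq ?_)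
    rw [hpow]
    push_cast
    rfl
  refine ⟨_, (totalDegree_ramanujanDerivation_iterate_le hdeg t).trans (by omega), ?_, ht0, ?_⟩
  · refine (len_ramanujanDerivation_iterate_le hdeg htT.le).trans ?_
    calc A.len * (12 * (3 * n + T : ℕ) : ℝ) ^ t
        ≤ (n : ℝ) ^ (73 * n) * ((n : ℝ) ^ 2) ^ t := by
          have : (12 * (3 * n + T : ℕ) : ℝ) ≤ n ^ 2 := by push_cast; linarith
          gcongr
      _ = (n : ℝ) ^ (73 * n + 2 * t) := by rw [← pow_mul, ← pow_add]
      _ ≤ _ := hexp _ (by omega)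
  · have hW := (PowerSeries.WBound.aeval hρ0.le hb1 (fun i => eis_wBound i hρ0.le hρ1)
      hdeg).theta_iterate hρ0.le hρ0 hρ1 t
    have h1 := hW.norm_ev_le (q := q) (by positivity)
      (by rw [hρ3]; nlinarith [sq_nonneg ρ, mul_pos hρ0 hρ0]) (M := n ^ 3 / 2) fun m hm => by
        rw [PowerSeries.coeff_theta_iterate, hvan m hm, mul_zero]
    have h2 : ‖q‖ / (ρ * ρ) = ρ := by rw [hρ3]; field_simp
    have h3 : -Real.log ρ = μ := by rw [hρ, Real.log_exp, neg_neg]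
    rw [h2, h3] at h1
    have h4 : ρ ^ (n ^ 3 / 2) ≤ Real.exp (-(μ / 4 * n ^ 3)) := by
      rw [hρ, ← Real.exp_nat_mul, Real.exp_le_exp]
      have h5 : (n : ℝ) ^ 3 ≤ 4 * (n ^ 3 / 2 : ℕ) := by
        have h6 : 2 ≤ n ^ 3 := le_trans (by omega) (Nat.le_self_pow (by norm_num) n)
        have : n ^ 3 ≤ 4 * (n ^ 3 / 2) := by omega
        exact_mod_cast this
      nlinarith
    have h5 : (12 : ℝ) ^ t * (t.factorial / μ ^ t) ≤ (n : ℝ) ^ (2 * t) := by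
      have h6 : (t.factorial : ℝ) ≤ (T : ℝ) ^ t := by
        exact_mod_cast t.factorial_le_pow.trans (Nat.pow_le_pow_left htT.le t)
      have h7 : 12 * T / μ ≤ (n : ℝ) ^ 2 := by
        refine le_trans ?_ hK2
        rw [mul_div_right_comm]
        gcongr
        linarith
      calc (12 : ℝ) ^ t * (t.factorial / μ ^ t) ≤ 12 ^ t * ((T : ℝ) ^ t / μ ^ t) := by gcongr
        _ = (12 * T / μ) ^ t := by rw [div_pow (12 * T : ℝ) μ, mul_pow, mul_div_assoc]
        _ ≤ _ := by rw [pow_mul]; gcongr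
    have hA := A.len_nonneg
    rw [aeval_ramanujanDerivation_iterate A t hq, norm_mul, norm_pow, Complex.norm_ofNat,
      sub_eq_add_neg, Real.exp_add, mul_comm (Real.exp _)]
    calc (12 : ℝ) ^ t * ‖(PowerSeries.theta^[t] (aeval eis A)).ev q‖
        ≤ 12 ^ t * (ρ ^ (n ^ 3 / 2) * (t.factorial / μ ^ t * (A.len * b ^ (3 * n)))) := by gcongr
      _ = ρ ^ (n ^ 3 / 2) * (12 ^ t * (t.factorial / μ ^ t) * (A.len * b ^ (3 * n))) := by ring
      _ ≤ Real.exp (-(μ / 4 * n ^ 3)) * ((n : ℝ) ^ (2 * t) *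
          ((n : ℝ) ^ (73 * n) * (n : ℝ) ^ (3 * n))) := by gcongr
      _ ≤ _ := by
          gcongr
          rw [← pow_add, ← pow_add]
          exact hexp _ (by omega)

end

section

open MvPolynomial Filter Topology

theorem eventually_mul_ceil_log_pow_le (C : ℝ) :
    ∀ᶠ k : ℕ in atTop, C * (⌈Real.log k⌉₊ : ℝ) ^ 3 ≤ k := by
  have h := (Real.isLittleO_pow_log_id_atTop (n := 3)).comp_tendsto
    (tendsto_natCast_atTop_atTop (R := ℝ))
  have hb := h.bound (show (0 : ℝ) < 1 / (8 * (|C| + 1)) by positivity)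
  filter_upwards [hb, eventually_ge_atTop 3] with k hk hk3
  simp only [Function.comp, id, Real.norm_eq_abs, Nat.abs_cast] at hk
  have hk3' : (3 : ℝ) ≤ k := by exact_mod_cast hk3
  have hl : 1 ≤ Real.log k := by
    rw [Real.le_log_iff_exp_le (by linarith)]
    linarith [Real.exp_one_lt_d9]
  have hL : (⌈Real.log k⌉₊ : ℝ) ≤ 2 * Real.log k := by
    have := Nat.ceil_lt_add_one (show 0 ≤ Real.log k by linarith)
    linarith
  rw [abs_of_nonneg (by positivity), one_div, inv_mul_eq_div, le_div_iff₀ (by positivity)] at hk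
  calc C * (⌈Real.log k⌉₊ : ℝ) ^ 3 ≤ (|C| + 1) * (2 * Real.log k) ^ 3 := by
        gcongr
        linarith [le_abs_self C]
    _ = Real.log k ^ 3 * (8 * (|C| + 1)) := by ring
    _ ≤ k := hk

theorem tendsto_ceil_log_atTop : Tendsto (fun k : ℕ => (⌈Real.log k⌉₊ : ℝ)) atTop atTop :=
  tendsto_atTop_mono (fun _ => Nat.le_ceil _)
    (Real.tendsto_log_atTop.comp tendsto_natCast_atTop_atTop)

/-- The values of `E₂`, `E₄`, `E₆` at a point are not all algebraic over `ℚ(θ)`. -/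
theorem false_of_eis_algebraic {q : ℂ} (hq0 : q ≠ 0) (hq : ‖q‖ < 1) {θ : ℂ}
    (hθ : Transcendental ℤ θ) (hω : ∀ i, ∃ p : Polynomial (Polynomial ℤ), p ≠ 0 ∧
      p.eval₂ (Polynomial.aeval θ : Polynomial ℤ →ₐ[ℤ] ℂ).toRingHom ((eis i).ev q) = 0) :
    False := by
  obtain ⟨c, hc, K, hsmall⟩ := exists_small_nonzero_value hq0 hq
  obtain ⟨C, hC, hpoly⟩ := exists_polynomial_of_algebraic (ω := fun i => (eis i).ev q) hθ hω
  have hmain : ∀ᶠ k : ℕ in atTop, ∃ R : Polynomial ℤ, R.SizeLE (k ^ 5) ∧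
      ‖Polynomial.aeval θ R‖ ≤ Real.exp (-(k : ℝ) ^ 11) := by
    have hn : Tendsto (fun k : ℕ => k ^ 4) atTop atTop := tendsto_pow_atTop (by norm_num)
    filter_upwards [hn.eventually hsmall, eventually_mul_ceil_log_pow_le (2 * |K|),
      eventually_mul_ceil_log_pow_le (317 * C), eventually_mul_ceil_log_pow_le 312,
      tendsto_ceil_log_atTop.eventually_gt_atTop (1652 / c), eventually_ge_atTop ⌈3 / c⌉₊,
      tendsto_ceil_log_atTop.eventually_ge_atTop 1, eventually_ge_atTop 1]
      with k hsmall hK hkC hk312 hLc hkc hL1 hk1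
    set L := ⌈Real.log k⌉₊ with hL
    have hlL : Real.log k ≤ L := Nat.le_ceil _
    have hk1' : (1 : ℝ) ≤ k := by exact_mod_cast hk1
    have hl0 : 0 ≤ Real.log k := Real.log_nonneg hk1'
    have hkc' : 3 / c ≤ k := Nat.ceil_le.1 hkc
    have hk4 : (1 : ℝ) ≤ (k : ℝ) ^ 4 := one_le_pow₀ hk1'
    have hL2 : (1 : ℝ) ≤ (L : ℝ) ^ 2 := one_le_pow₀ hL1
    have hL23 : (L : ℝ) ^ 2 ≤ (L : ℝ) ^ 3 := pow_le_pow_right₀ hL1 (by norm_num)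
    have hlog : Real.log ((k ^ 4 : ℕ) : ℝ) = 4 * Real.log k := by
      push_cast
      rw [Real.log_pow]
      norm_num
    obtain ⟨P, hPdeg, hPlen, hP0, hPsmall⟩ := hsmall (k ^ 4 * L ^ 2) (by
      rw [hlog]
      push_cast
      rw [div_lt_iff₀ hc] at hLc
      calc (413 * ((k : ℝ) ^ 4 * (4 * Real.log k))) = (k : ℝ) ^ 4 * (1652 * Real.log k) := by ring
        _ ≤ (k : ℝ) ^ 4 * (1652 * L) := by gcongr
        _ < (k : ℝ) ^ 4 * ((L * c) * L) := by gcongr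
        _ = _ := by ring) (by
      push_cast
      calc K * ((k : ℝ) ^ 4 + (k : ℝ) ^ 4 * (L : ℝ) ^ 2)
          ≤ |K| * ((k : ℝ) ^ 4 + (k : ℝ) ^ 4 * (L : ℝ) ^ 2) := by gcongr; exact le_abs_self K
        _ = |K| * (1 + (L : ℝ) ^ 2) * (k : ℝ) ^ 4 := by ring
        _ ≤ |K| * (2 * (L : ℝ) ^ 3) * (k : ℝ) ^ 4 := by gcongr; linarith
        _ = (2 * |K| * (L : ℝ) ^ 3) * (k : ℝ) ^ 4 := by ring
        _ ≤ k * (k : ℝ) ^ 4 := by gcongr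
        _ ≤ (k : ℝ) ^ 4 * (k : ℝ) ^ 4 := by gcongr; exact le_self_pow₀ hk1' (by norm_num)
        _ = _ := by ring)
    rw [hlog] at hPlen hPsmall
    set H : ℝ := (76 * ((k ^ 4 : ℕ) : ℝ) + 2 * ((k ^ 4 * L ^ 2 : ℕ) : ℝ)) * (4 * Real.log k)
      with hH
    have hH0 : 0 ≤ H := by positivity
    have hHle : H ≤ 312 * (L : ℝ) ^ 3 * (k : ℝ) ^ 4 := by
      rw [hH]
      push_cast
      calc (76 * (k : ℝ) ^ 4 + 2 * ((k : ℝ) ^ 4 * (L : ℝ) ^ 2)) * (4 * Real.log k)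
          ≤ (76 * ((k : ℝ) ^ 4 * (L : ℝ) ^ 2) + 2 * ((k : ℝ) ^ 4 * (L : ℝ) ^ 2)) * (4 * L) := by
            gcongr
            exact le_mul_of_one_le_right (by positivity) hL2
        _ = _ := by ring
    obtain ⟨R, hR0, hRdeg, hRcoeff, hRsmall⟩ := hpoly _ H P hH0 hPdeg hPlen hP0
    set d : ℕ := 3 * k ^ 4 + k ^ 4 * L ^ 2 with hd
    have hdle : (d : ℝ) ≤ 4 * (L : ℝ) ^ 3 * (k : ℝ) ^ 4 := by
      rw [hd]
      push_cast
      nlinarith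
    have hsum : C * (d + H + 1) ≤ (k : ℝ) ^ 5 := by
      have h1 : (1 : ℝ) ≤ (L : ℝ) ^ 3 * (k : ℝ) ^ 4 :=
        one_le_mul_of_one_le_of_one_le (hL2.trans hL23) hk4
      calc C * (d + H + 1) ≤ C * (317 * ((L : ℝ) ^ 3 * (k : ℝ) ^ 4)) := by gcongr; linarith
        _ = 317 * C * (L : ℝ) ^ 3 * (k : ℝ) ^ 4 := by ring
        _ ≤ k * (k : ℝ) ^ 4 := by gcongr
        _ = _ := by ring
    refine ⟨R, ⟨hR0, ?_, fun i => (hRcoeff i).trans ?_⟩, ?_⟩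
    · have : (R.natDegree : ℝ) ≤ (k : ℝ) ^ 5 := by
        refine hRdeg.trans (le_trans ?_ hsum)
        gcongr
        linarith
      exact_mod_cast this
    · rw [Real.exp_le_exp]
      exact_mod_cast hsum
    · have hHk : H ≤ (k : ℝ) ^ 5 := by
        refine hHle.trans ?_
        calc 312 * (L : ℝ) ^ 3 * (k : ℝ) ^ 4 ≤ k * (k : ℝ) ^ 4 := by gcongr
          _ = _ := by ring
      refine hRsmall.trans ((mul_le_mul_of_nonneg_right hPsmall (Real.exp_nonneg _)).trans ?_)
      rw [← Real.exp_add, Real.exp_le_exp]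
      push_cast
      have h1 : (k : ℝ) ^ 5 ≤ (k : ℝ) ^ 11 := pow_le_pow_right₀ hk1' (by norm_num)
      have h2 : 3 * (k : ℝ) ^ 11 ≤ c * ((k : ℝ) ^ 4) ^ 3 := by
        rw [div_le_iff₀ hc] at hkc'
        calc 3 * (k : ℝ) ^ 11 ≤ (k * c) * (k : ℝ) ^ 11 := by gcongr
          _ = _ := by ring
      linarith
  choose! R hR using hmain.exists_forall_of_atTop.choose_spec
  exact Polynomial.gelfond_criterion hθ R
    (eventually_atTop.2 ⟨_, fun k hk => hR k hk⟩)

end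

theorem eis_ev_qpar_eq (i : Fin 3) {z : ℂ} (hz : 0 < z.im) :
    (eis i).ev (qpar z) = (![Ek 2 z, Ek 4 z, Ek 6 z] : Fin 3 → ℂ) i := by
  have h : ∀ s : ℕ, ∑' n : ℕ+, (∑ d ∈ (n : ℕ).divisors, (d : ℂ) ^ s) * qpar z ^ (n : ℕ) =
      ∑' n : ℕ, (∑ d ∈ n.divisors, (d : ℂ) ^ s) * qpar z ^ n := fun s =>
    PNat.coe_injective.tsum_eq (f := fun n : ℕ => (∑ d ∈ n.divisors, (d : ℂ) ^ s) * qpar z ^ n)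
      fun n hn => by
        rcases Nat.eq_zero_or_pos n with rfl | hpos
        · simp at hn
        · exact ⟨⟨n, hpos⟩, rfl⟩
  rw [eis_ev_eq i (norm_qpar_lt_one hz), h]
  fin_cases i
  · simp [Ek, qpar, eisCoeff, show bernoulli 2 = 1 / 6 by decide +kernel]
    ring
  · simp [Ek, qpar, eisCoeff, show bernoulli 4 = -1 / 30 by decide +kernel]
    ring
  · simp [Ek, qpar, eisCoeff, show bernoulli 6 = 1 / 42 by decide +kernel]
    ring

/- Here `AlgebraicClosure ℚ` plays the role of the field `Q̄` of algebraic numbers; any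
ring homomorphism `ι : AlgebraicClosure ℚ →+* ℂ` identifies it with the algebraic
closure of `ℚ` inside `ℂ`. -/
theorem stmt11 (ι : AlgebraicClosure ℚ →+* ℂ)
    (P Q : MvPolynomial (Fin 3) (AlgebraicClosure ℚ))
    (hP : Irreducible P) (hQ : Irreducible Q) (hPQ : ¬ Associated P Q) :
    ¬ ∃ a : ℂ, 0 < a.im ∧ psi (P.map ι) a = 0 ∧ psi (Q.map ι) a = 0 := by
  rintro ⟨a, ha, hPa, hQa⟩
  obtain ⟨θ, hθ, hω⟩ := exists_transcendental_of_common_zero ι hP hQ hPQ _ hPa hQa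
  exact false_of_eis_algebraic (qpar_ne_zero a) (norm_qpar_lt_one ha) hθ fun i => by
    rw [eis_ev_qpar_eq i ha]
    exact hω i
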